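/- Let 0 < θ ≤ 0.0664·π and let q be an action minimizer of A over P(Q_S, Q_{E₂}). Then q extends to a global orbit: there exists a twice continuously differentiable function Q:ℝ→(ℝ²)⁴ that is collision-free for all t∈ℝ, solves the Newtonian equations on all of ℝ, satisfies Q(t)=q(t) for every t∈[0,1], and satisfies the rotation symmetry Qᵢ(t+4) = Qᵢ(t)·R(4θ) (row-vector multiplication, for each body i) for all t∈ℝ. In particular, if θ = (k/l)·π for positive integers k, l, then Q is periodic with period 4l. -/

import Mathlib

open Real MeasureTheory Set
open scoped ENNReal

noncomputable section

/-- Euclidean norm on `ℝ × ℝ` (row vectors in the plane). -/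
def enorm2 (v : ℝ × ℝ) : ℝ := Real.sqrt (v.1 ^ 2 + v.2 ^ 2)

/-- Row vector multiplied on the right by the rotation matrix `R θ`
with rows `(cos θ, sin θ)` and `(-sin θ, cos θ)`. -/
def rotV (θ : ℝ) (v : ℝ × ℝ) : ℝ × ℝ :=
  (v.1 * Real.cos θ - v.2 * Real.sin θ, v.1 * Real.sin θ + v.2 * Real.cos θ)

/-- `H¹([0,1],(ℝ²)⁴)`: absolutely continuous paths `[0,1] → (ℝ²)⁴` with
square-integrable derivative, recorded via an integrable (a.e.-)derivative `v`
together with the integral representation of `q`. -/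
structure H1Path4 where
  q : ℝ → Fin 4 → ℝ × ℝ
  v : ℝ → Fin 4 → ℝ × ℝ
  hvInt : ∀ i : Fin 4, IntegrableOn (fun t => v t i) (Icc (0:ℝ) 1)
  hrep : ∀ i : Fin 4, ∀ t ∈ Icc (0:ℝ) 1, q t i = q 0 i + ∫ s in (0:ℝ)..t, v s i
  hL2 : ∀ i : Fin 4, IntegrableOn (fun t => enorm2 (v t i) ^ 2) (Icc (0:ℝ) 1)

/-- Center of mass at the origin throughout `[0,1]` (the path lies in `χ`). -/
def H1Path4.inChi (p : H1Path4) : Prop := ∀ t ∈ Icc (0:ℝ) 1, ∑ i, p.q t i = 0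

/-- The Lagrangian action functional `A`, with value `+∞` allowed. -/
def action (p : H1Path4) : ℝ≥0∞ :=
  ∫⁻ t in Icc (0:ℝ) 1,
    (ENNReal.ofReal ((1/2) * ∑ i, enorm2 (p.v t i) ^ 2)
      + ∑ i : Fin 4, ∑ j ∈ Finset.univ.filter (fun j => i < j),
          (ENNReal.ofReal (enorm2 (p.q t i - p.q t j)))⁻¹)

/-- The starting boundary configuration set `Q_S` (double isosceles with order
constraints). -/
def QSset : Set (Fin 4 → ℝ × ℝ) :=
  { c | ∃ a₁ b₁ c₁ : ℝ, 0 ≤ b₁ ∧ 0 ≤ c₁ ∧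
      c = ![(-a₁ - c₁, 0), (-a₁, 0), ((2*a₁ + c₁)/2, b₁), ((2*a₁ + c₁)/2, -b₁)] }

/-- The ending boundary configuration set `Q_{E₁}`. -/
def QE1set (θ : ℝ) : Set (Fin 4 → ℝ × ℝ) :=
  { c | ∃ a₂ b₂ c₂ : ℝ, 0 ≤ b₂ ∧ 0 ≤ c₂ ∧
      c = fun i => rotV θ (![(-b₂, -a₂), (-c₂, a₂), (c₂, a₂), (b₂, -a₂)] i) }

/-- The ending boundary configuration set `Q_{E₂}`. -/
def QE2set (θ : ℝ) : Set (Fin 4 → ℝ × ℝ) :=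
  { c | ∃ a₂ b₂ c₂ : ℝ, 0 ≤ b₂ ∧ 0 ≤ c₂ ∧
      c = fun i => rotV θ (![(-a₂, -b₂), (-a₂, b₂), (a₂, c₂), (a₂, -c₂)] i) }

/-- Membership in the admissible class `P(Q_S, E)`. -/
def inAdm (E : Set (Fin 4 → ℝ × ℝ)) (p : H1Path4) : Prop :=
  p.inChi ∧ p.q 0 ∈ QSset ∧ p.q 1 ∈ E

/-- `p` is an action minimizer over `P(Q_S, E)`. -/
def isMin (E : Set (Fin 4 → ℝ × ℝ)) (p : H1Path4) : Prop :=
  inAdm E p ∧ ∀ p' : H1Path4, inAdm E p' → action p ≤ action p'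

/-- The Newtonian equations of the equal-mass four-body problem, on a set `s`
of times. -/
def newton (Q : ℝ → Fin 4 → ℝ × ℝ) (s : Set ℝ) : Prop :=
  ∀ i : Fin 4, ∀ t ∈ s,
    deriv (deriv (fun u => Q u i)) t =
      ∑ j ∈ Finset.univ.erase i, (1 / enorm2 (Q t j - Q t i) ^ 3) • (Q t j - Q t i)

/-- `f` is a primitive of the integrable function `g` on `[a, b]`. -/
structure IsPrim (f g : ℝ → ℝ) (a b : ℝ) : Prop where
  int : IntervalIntegrable g volume a b
  eq : ∀ t ∈ Icc a b, f t = f a + ∫ s in a..t, g s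

theorem IsPrim.ac {f g : ℝ → ℝ} {a b : ℝ} (h : IsPrim f g a b) (hab : a ≤ b) :
    AbsolutelyContinuousOnInterval f a b := by
  have h1 := h.int.absolutelyContinuousOnInterval_intervalIntegral (c := a) (by simp)
  rw [absolutelyContinuousOnInterval_iff] at h1 ⊢
  intro ε hε
  obtain ⟨δ, hδ, H⟩ := h1 ε hε
  refine ⟨δ, hδ, fun E hE hs => ?_⟩
  convert H E hE hs using 2 with i hi
  obtain ⟨h2, h3⟩ := hE.1 i hi
  rw [uIcc_of_le hab] at h2 h3
  rw [h.eq _ h2, h.eq _ h3, dist_add_left]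

theorem IsPrim.ae_hasDerivAt {f g : ℝ → ℝ} {a b : ℝ} (h : IsPrim f g a b) (hab : a ≤ b) :
    ∀ᵐ x, x ∈ Ioo a b → HasDerivAt f (g x) x := by
  filter_upwards [h.int.ae_hasDerivAt_integral] with x hx hxI
  have h1 := hx (by rw [uIcc_of_le hab]; exact Ioo_subset_Icc_self hxI) a (by simp)
  refine (h1.const_add (f a)).congr_of_eventuallyEq ?_
  filter_upwards [Ioo_mem_nhds hxI.1 hxI.2] with y hy
  exact h.eq y (Ioo_subset_Icc_self hy)

theorem IsPrim.continuousOn {f g : ℝ → ℝ} {a b : ℝ} (h : IsPrim f g a b) (hab : a ≤ b) :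
    ContinuousOn f (Icc a b) := by
  have := (h.ac hab).continuousOn
  rwa [uIcc_of_le hab] at this

theorem IsPrim.mono {f g : ℝ → ℝ} {a b c d : ℝ} (h : IsPrim f g a b) (hac : a ≤ c) (hcd : c ≤ d)
    (hdb : d ≤ b) : IsPrim f g c d := by
  have hab : a ≤ b := by linarith
  have hsub : uIcc c d ⊆ uIcc a b := by
    rw [uIcc_of_le hcd, uIcc_of_le hab]; exact Icc_subset_Icc hac hdb
  refine ⟨h.int.mono_set hsub, fun t ht => ?_⟩
  have hi : ∀ u ∈ Icc a b, IntervalIntegrable g volume a u := fun u hu =>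
    h.int.mono_set (by rw [uIcc_of_le hab, uIcc_of_le hu.1]; exact Icc_subset_Icc le_rfl hu.2)
  have hc : c ∈ Icc a b := ⟨hac, hcd.trans hdb⟩
  have ht' : t ∈ Icc a b := ⟨hac.trans ht.1, ht.2.trans hdb⟩
  rw [h.eq t ht', h.eq c hc, ← intervalIntegral.integral_interval_sub_left (hi t ht') (hi c hc)]
  ring

theorem IsPrim.lin {f g f' g' : ℝ → ℝ} {a b : ℝ} (h : IsPrim f g a b) (h' : IsPrim f' g' a b)
    (α β : ℝ) : IsPrim (fun t => α * f t + β * f' t) (fun t => α * g t + β * g' t) a b := by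
  refine ⟨(h.int.const_mul α).add (h'.int.const_mul β), fun t ht => ?_⟩
  have hab : a ≤ b := ht.1.trans ht.2
  have hs : uIcc a t ⊆ uIcc a b := by
    rw [uIcc_of_le hab, uIcc_of_le ht.1]; exact Icc_subset_Icc le_rfl ht.2
  rw [intervalIntegral.integral_add ((h.int.mono_set hs).const_mul α)
    ((h'.int.mono_set hs).const_mul β), intervalIntegral.integral_const_mul,
    intervalIntegral.integral_const_mul, h.eq t ht, h'.eq t ht]
  ring

theorem AbsolutelyContinuousOnInterval.sub_le_integral {F h : ℝ → ℝ} {a b : ℝ} (hab : a ≤ b)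
    (hF : AbsolutelyContinuousOnInterval F a b) (hh : IntervalIntegrable h volume a b)
    (H : ∀ᵐ x, x ∈ Ioo a b → ∃ d, HasDerivAt F d x ∧ d ≤ h x) :
    F b - F a ≤ ∫ x in a..b, h x := by
  rw [← hF.integral_deriv_eq_sub]
  refine intervalIntegral.integral_mono_ae_restrict hab hF.intervalIntegrable_deriv hh ?_
  rw [← Measure.restrict_congr_set (Ioo_ae_eq_Icc (μ := volume) (a := a) (b := b))]
  refine (ae_restrict_iff' measurableSet_Ioo).2 ?_
  filter_upwards [H] with x hx hxI
  obtain ⟨d, hd, hle⟩ := hx hxI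
  rwa [hd.deriv]

theorem absolutelyContinuousOnInterval_of_abs_sub_le {F x y : ℝ → ℝ} {a b C : ℝ}
    (hx : AbsolutelyContinuousOnInterval x a b) (hy : AbsolutelyContinuousOnInterval y a b)
    (H : ∀ s ∈ uIcc a b, ∀ t ∈ uIcc a b, |F s - F t| ≤ C * (|x s - x t| + |y s - y t|)) :
    AbsolutelyContinuousOnInterval F a b := by
  have h1 := (Filter.Tendsto.add hx hy).const_mul C
  rw [add_zero, mul_zero] at h1
  refine squeeze_zero'
    (Filter.Eventually.of_forall fun E => Finset.sum_nonneg fun i _ => dist_nonneg)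
    ?_ h1
  refine Filter.Eventually.filter_mono inf_le_right ?_
  rw [Filter.eventually_principal]
  intro E hE
  rw [← Finset.sum_add_distrib, Finset.mul_sum]
  refine Finset.sum_le_sum fun i hi => ?_
  simpa only [Real.dist_eq] using H _ (hE.1 i hi).1 _ (hE.1 i hi).2

theorem AbsolutelyContinuousOnInterval.comp_contDiffOn {φ s : ℝ → ℝ} {a b c d : ℝ}
    (hs : AbsolutelyContinuousOnInterval s a b) (hφ : ContDiffOn ℝ 1 φ (Icc c d))
    (hm : ∀ t ∈ uIcc a b, s t ∈ Icc c d) :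
    AbsolutelyContinuousOnInterval (fun t => φ (s t)) a b := by
  obtain ⟨K, hK⟩ := hφ.exists_lipschitzOnWith (by decide) (convex_Icc _ _) isCompact_Icc
  refine absolutelyContinuousOnInterval_of_abs_sub_le (C := K) hs hs fun u hu v hv => ?_
  have := hK.dist_le_mul _ (hm u hu) _ (hm v hv)
  rw [Real.dist_eq, Real.dist_eq] at this
  have h0 : 0 ≤ (K : ℝ) * |s u - s v| := by positivity
  linarith

theorem abs_sqrt_sub_sqrt_le (x y x' y' : ℝ) :
    |√(x ^ 2 + y ^ 2) - √(x' ^ 2 + y' ^ 2)| ≤ |x - x'| + |y - y'| := by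
  have h : ∀ a b : ℝ, √(a ^ 2 + b ^ 2) = ‖(⟨a, b⟩ : ℂ)‖ := fun a b => by
    rw [Complex.norm_def, Complex.normSq_mk, sq, sq]
  rw [h, h]
  refine (abs_norm_sub_norm_le _ _).trans ?_
  simpa using Complex.norm_le_abs_re_add_abs_im ((⟨x, y⟩ : ℂ) - ⟨x', y'⟩)

theorem IsPrim.ac_sqrt {x y u v : ℝ → ℝ} {a b : ℝ} (hab : a ≤ b) (hx : IsPrim x u a b)
    (hy : IsPrim y v a b) :
    AbsolutelyContinuousOnInterval (fun t => √(x t ^ 2 + y t ^ 2)) a b :=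
  absolutelyContinuousOnInterval_of_abs_sub_le (C := 1) (hx.ac hab) (hy.ac hab)
    fun s _ t _ => by rw [one_mul]; exact abs_sqrt_sub_sqrt_le _ _ _ _

theorem HasDerivAt.sqrt_sq_add_sq {x y : ℝ → ℝ} {u v t : ℝ} (hx : HasDerivAt x u t)
    (hy : HasDerivAt y v t) (h0 : √(x t ^ 2 + y t ^ 2) ≠ 0) :
    HasDerivAt (fun t => √(x t ^ 2 + y t ^ 2))
      ((x t * u + y t * v) / √(x t ^ 2 + y t ^ 2)) t := by
  have h1 : x t ^ 2 + y t ^ 2 ≠ 0 := fun h => h0 (by rw [h, Real.sqrt_zero])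
  convert! ((hx.pow 2).add (hy.pow 2)).sqrt h1 using 1
  simp only [Pi.add_apply, Pi.pow_apply]
  field_simp
  norm_num
  ring

theorem integral_inv_pos {d : ℝ → ℝ} {a b : ℝ} (hab : a < b) (hd : ContinuousOn d (Icc a b))
    (hd0 : ∀ t, 0 ≤ d t)
    (hS : IntervalIntegrable (fun t => (d t)⁻¹) volume a b)
    (hne : ∀ᵐ t, t ∈ Ioo a b → d t ≠ 0) : 0 < ∫ t in a..b, (d t)⁻¹ := by
  obtain ⟨M, hM⟩ := isCompact_Icc.exists_bound_of_continuousOn hd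
  have hM0 : 0 ≤ M := (norm_nonneg _).trans (hM a ⟨le_rfl, hab.le⟩)
  have h1 : ∫ t in a..b, (M + 1)⁻¹ ≤ ∫ t in a..b, (d t)⁻¹ := by
    refine intervalIntegral.integral_mono_ae_restrict hab.le (by simp) hS ?_
    rw [← Measure.restrict_congr_set (Ioo_ae_eq_Icc (μ := volume) (a := a) (b := b))]
    refine (ae_restrict_iff' measurableSet_Ioo).2 ?_
    filter_upwards [hne] with t ht htI
    have h2 := hM t (Ioo_subset_Icc_self htI)
    rw [Real.norm_eq_abs, abs_of_nonneg (hd0 t)] at h2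
    have h3 : 0 < d t := lt_of_le_of_ne (hd0 t) (ht htI).symm
    exact inv_anti₀ h3 (by linarith)
  rw [intervalIntegral.integral_const, smul_eq_mul] at h1
  have : 0 < (b - a) * (M + 1)⁻¹ := mul_pos (sub_pos.2 hab) (by positivity)
  linarith

theorem hasDerivAt_mul_tan (k β s : ℝ) (h : Real.cos (β - k * s) ≠ 0) :
    HasDerivAt (fun s => k * Real.tan (β - k * s))
      (-((k * Real.tan (β - k * s)) ^ 2 + k ^ 2)) s := by
  have h1 : HasDerivAt (fun s => β - k * s) (-k) s := by
    simpa using ((hasDerivAt_id s).const_mul k).const_sub β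
  convert! ((Real.hasDerivAt_tan h).comp s h1).const_mul k using 1
  rw [Real.tan_eq_sin_div_cos]
  have := Real.sin_sq_add_cos_sq (β - k * s)
  field_simp
  linear_combination -k ^ 2 * this

theorem contDiffOn_mul_tan (k β S : ℝ) (h : ∀ s ∈ Icc 0 S, Real.cos (β - k * s) ≠ 0) :
    ContDiffOn ℝ 1 (fun s => k * Real.tan (β - k * s)) (Icc 0 S) := fun s hs =>
  (contDiffAt_const.mul ((Real.contDiffAt_tan.2 (h s hs)).comp s
    (contDiffAt_const.sub (contDiffAt_const.mul contDiffAt_id)))).contDiffWithinAt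

/-- Sectorial estimate behind the Kepler action bound: if a planar path starts on the positive
first axis and ends on the ray at angle `2ψ ≤ π`, then `(2ψ)² (b - a) ≤ (∫ |r'|²) (∫ 1/|r|)²`. -/
theorem sector_bound {x y u v : ℝ → ℝ} {a b ψ : ℝ} (hab : a < b) (hx : IsPrim x u a b)
    (hy : IsPrim y v a b)
    (hK : IntervalIntegrable (fun t => u t ^ 2 + v t ^ 2) volume a b)
    (hS : IntervalIntegrable (fun t => (√(x t ^ 2 + y t ^ 2))⁻¹) volume a b)
    (hne : ∀ᵐ t, t ∈ Ioo a b → √(x t ^ 2 + y t ^ 2) ≠ 0)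
    (hxa : √(x a ^ 2 + y a ^ 2) = x a) (hψ0 : 0 < ψ) (hψ1 : ψ ≤ π / 2)
    (hxb : x b = √(x b ^ 2 + y b ^ 2) * Real.cos (2 * ψ)) :
    (2 * ψ) ^ 2 * (b - a) ≤ (∫ t in a..b, (u t ^ 2 + v t ^ 2)) *
      (∫ t in a..b, (√(x t ^ 2 + y t ^ 2))⁻¹) ^ 2 := by
  set d : ℝ → ℝ := fun t => √(x t ^ 2 + y t ^ 2) with hd
  have hd0 : ∀ t, 0 ≤ d t := fun t => Real.sqrt_nonneg _
  have hdac : AbsolutelyContinuousOnInterval d a b := IsPrim.ac_sqrt hab.le hx hy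
  have hdc : ContinuousOn d (Icc a b) := by
    have := hdac.continuousOn; rwa [uIcc_of_le hab.le] at this
  have hSpos := integral_inv_pos hab hdc hd0 hS hne
  set S := ∫ t in a..b, (d t)⁻¹ with hSdef
  set K := ∫ t in a..b, (u t ^ 2 + v t ^ 2) with hKdef
  let s : ℝ → ℝ := fun t => ∫ τ in a..t, (d τ)⁻¹
  have hsP : IsPrim s (fun t => (d t)⁻¹) a b := ⟨hS, fun t _ => by simp [s]⟩
  have hsm : ∀ t ∈ uIcc a b, s t ∈ Icc 0 S := by
    intro t ht
    rw [uIcc_of_le hab.le] at ht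
    refine ⟨intervalIntegral.integral_nonneg ht.1 fun τ _ => inv_nonneg.2 (hd0 τ), ?_⟩
    exact intervalIntegral.integral_mono_interval le_rfl ht.1 ht.2
      (Filter.Eventually.of_forall fun τ => inv_nonneg.2 (hd0 τ)) hS
  have main : ∀ κ ∈ Ioo 0 ψ, (2 * κ) ^ 2 * (b - a) ≤ K * S ^ 2 := by
    intro κ hκ
    set k := κ / S with hk
    have hkS : k * S = κ := by rw [hk]; field_simp
    have hk0 : 0 < k := div_pos hκ.1 hSpos
    have hc1 : ∀ σ ∈ Icc 0 S, Real.cos (0 - k * σ) ≠ 0 := by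
      intro σ hσ
      have h1 : k * σ ≤ κ := by rw [← hkS]; exact mul_le_mul_of_nonneg_left hσ.2 hk0.le
      have h2 : 0 ≤ k * σ := mul_nonneg hk0.le hσ.1
      exact (Real.cos_pos_of_mem_Ioo ⟨by linarith [hκ.2], by linarith [hκ.2, hκ.1]⟩).ne'
    have hc2 : ∀ σ ∈ Icc 0 S, Real.cos ((π / 2 - (ψ - κ)) - k * σ) ≠ 0 := by
      intro σ hσ
      have h1 : k * σ ≤ κ := by rw [← hkS]; exact mul_le_mul_of_nonneg_left hσ.2 hk0.le
      have h2 : 0 ≤ k * σ := mul_nonneg hk0.le hσ.1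
      exact (Real.cos_pos_of_mem_Ioo ⟨by linarith [hκ.2, hκ.1], by linarith [hκ.2, hκ.1]⟩).ne'
    let m1 : ℝ → ℝ := fun σ => k * Real.tan (0 - k * σ)
    let m2 : ℝ → ℝ := fun σ => k * Real.tan ((π / 2 - (ψ - κ)) - k * σ)
    have hm1 : AbsolutelyContinuousOnInterval (fun t => m1 (s t)) a b :=
      (hsP.ac hab.le).comp_contDiffOn (contDiffOn_mul_tan _ _ _ hc1) hsm
    have hm2 : AbsolutelyContinuousOnInterval (fun t => m2 (s t)) a b :=
      (hsP.ac hab.le).comp_contDiffOn (contDiffOn_mul_tan _ _ _ hc2) hsm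
    let W : ℝ → ℝ := fun t => m1 (s t) * (d t + x t) + m2 (s t) * (d t - x t)
    have hW : AbsolutelyContinuousOnInterval W a b :=
      (hm1.fun_mul (hdac.fun_add (hx.ac hab.le))).fun_add
        (hm2.fun_mul (hdac.fun_sub (hx.ac hab.le)))
    have hInt : IntervalIntegrable (fun t => (u t ^ 2 + v t ^ 2) / 2 - 2 * k ^ 2) volume a b :=
      (hK.div_const 2).sub (by simp)
    have hle := hW.sub_le_integral hab.le hInt (by
      filter_upwards [hx.ae_hasDerivAt hab.le, hy.ae_hasDerivAt hab.le, hsP.ae_hasDerivAt hab.le,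
        hne] with t h1 h2 h3 h4 ht
      have hst := hsm t (by rw [uIcc_of_le hab.le]; exact Ioo_subset_Icc_self ht)
      have hd' := HasDerivAt.sqrt_sq_add_sq (h1 ht) (h2 ht) (h4 ht)
      have e1 := (hasDerivAt_mul_tan k 0 (s t) (hc1 _ hst)).comp t (h3 ht)
      have e2 := (hasDerivAt_mul_tan k (π / 2 - (ψ - κ)) (s t) (hc2 _ hst)).comp t (h3 ht)
      refine ⟨_, (e1.mul (hd'.add (h1 ht))).add (e2.mul (hd'.sub (h1 ht))), ?_⟩
      have hdt : d t ≠ 0 := h4 ht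
      have hsq : d t ^ 2 = x t ^ 2 + y t ^ 2 := Real.sq_sqrt (by positivity)
      change -(m1 (s t) ^ 2 + k ^ 2) * (d t)⁻¹ * (d t + x t) +
        m1 (s t) * ((x t * u t + y t * v t) / d t + u t) +
        (-(m2 (s t) ^ 2 + k ^ 2) * (d t)⁻¹ * (d t - x t) +
        m2 (s t) * ((x t * u t + y t * v t) / d t - u t)) ≤ _
      generalize m1 (s t) = p
      generalize m2 (s t) = q
      obtain ⟨c, hc⟩ : ∃ c, c * d t = x t := ⟨x t / d t, by field_simp⟩
      obtain ⟨σ, hσ⟩ : ∃ σ, σ * d t = y t := ⟨y t / d t, by field_simp⟩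
      have hcs : c ^ 2 + σ ^ 2 = 1 := by
        have : (c ^ 2 + σ ^ 2 - 1) * d t ^ 2 = 0 := by
          linear_combination (c * d t + x t) * hc + (σ * d t + y t) * hσ - hsq
        rcases mul_eq_zero.1 this with h | h
        · linarith
        · exact absurd (pow_eq_zero_iff (two_ne_zero)|>.1 h) hdt
      have E : -(p ^ 2 + k ^ 2) * (d t)⁻¹ * (d t + x t) +
          p * ((x t * u t + y t * v t) / d t + u t) +
          (-(q ^ 2 + k ^ 2) * (d t)⁻¹ * (d t - x t) + q * ((x t * u t + y t * v t) / d t - u t))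
          = -(p ^ 2 + k ^ 2) * (1 + c) + p * (c * u t + σ * v t + u t) +
          (-(q ^ 2 + k ^ 2) * (1 - c) + q * (c * u t + σ * v t - u t)) := by
        rw [← hc, ← hσ]; field_simp
      rw [E]
      have hsq1 := sq_nonneg (u t - ((p + q) * c + (p - q)))
      have hsq2 := sq_nonneg (v t - (p + q) * σ)
      have hs2 : σ ^ 2 = 1 - c ^ 2 := by linarith
      have e3 : (v t - (p + q) * σ) ^ 2
          = v t ^ 2 - 2 * (p + q) * σ * v t + (p + q) ^ 2 * (1 - c ^ 2) := by
        rw [← hs2]; ring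
      nlinarith)
    have hWa : W a = 0 := by
      have : d a = x a := hxa
      simp [W, m1, m2, s, this]
    have hWb : 0 ≤ W b := by
      have e1 : k * s b = κ := hkS
      have e2 : (π / 2 - (ψ - κ)) - k * s b = π / 2 - ψ := by rw [e1]; ring
      have hsψ : 0 < Real.sin ψ := Real.sin_pos_of_pos_of_lt_pi hψ0 (by linarith [Real.pi_pos])
      have hcψ : 0 ≤ Real.cos ψ := Real.cos_nonneg_of_mem_Icc ⟨by linarith, hψ1⟩
      have hcκ : 0 < Real.cos κ := Real.cos_pos_of_mem_Ioo ⟨by linarith [hκ.1], by linarith [hκ.2]⟩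
      have hsub : 0 ≤ Real.sin (ψ - κ) :=
        Real.sin_nonneg_of_nonneg_of_le_pi (by linarith [hκ.2]) (by linarith [hκ.1, Real.pi_pos])
      have hxb' : x b = d b * Real.cos (2 * ψ) := hxb
      have e3 : W b = 2 * k * d b * Real.cos ψ * Real.sin (ψ - κ) / Real.cos κ := by
        simp only [W, m1, m2]
        rw [e2, e1, hxb', Real.tan_pi_div_two_sub, zero_sub, Real.tan_neg, Real.tan_eq_sin_div_cos,
          Real.tan_eq_sin_div_cos, Real.sin_sub, Real.cos_two_mul]
        have := Real.sin_sq_add_cos_sq ψ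
        field_simp
        have h4 : Real.cos ψ ^ 2 = 1 - Real.sin ψ ^ 2 := by linarith
        rw [h4]; ring_nf
        try rw [h4]
        try ring
      rw [e3]
      have := hd0 b
      positivity
    rw [intervalIntegral.integral_sub (hK.div_const 2) (by simp),
      intervalIntegral.integral_div, intervalIntegral.integral_const, smul_eq_mul] at hle
    have h5 : 4 * k ^ 2 * (b - a) ≤ K := by nlinarith
    calc (2 * κ) ^ 2 * (b - a) = 4 * k ^ 2 * (b - a) * S ^ 2 := by rw [← hkS]; ring
      _ ≤ K * S ^ 2 := mul_le_mul_of_nonneg_right h5 (sq_nonneg _)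
  have hcont : Filter.Tendsto (fun κ : ℝ => (2 * κ) ^ 2 * (b - a)) (nhdsWithin ψ (Iio ψ))
      (nhds ((2 * ψ) ^ 2 * (b - a))) :=
    Filter.Tendsto.mono_left (Continuous.tendsto (by fun_prop) ψ) nhdsWithin_le_nhds
  refine le_of_tendsto hcont ?_
  filter_upwards [Ioo_mem_nhdsLT hψ0] with κ hκ using main κ hκ

theorem IsPrim.reflect {f g : ℝ → ℝ} {a b : ℝ} (h : IsPrim f g a b) :
    IsPrim (fun t => f (a + b - t)) (fun t => -g (a + b - t)) a b := by
  have hi : IntervalIntegrable (fun t => g (a + b - t)) volume a b := by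
    have := (h.int.comp_sub_left (a + b)).symm
    simpa using this
  refine ⟨hi.neg, fun t ht => ?_⟩
  have hm : a + b - t ∈ Icc a b := ⟨by linarith [ht.2], by linarith [ht.1]⟩
  have e := (h.mono hm.1 hm.2 le_rfl).eq b ⟨hm.2, le_rfl⟩
  rw [intervalIntegral.integral_neg, intervalIntegral.integral_comp_sub_left (fun s => g s)]
  simp only [add_sub_cancel_left]
  rw [e]; ring

theorem rot_sq_add_sq {c s : ℝ} (h : c ^ 2 + s ^ 2 = 1) (x y : ℝ) :
    (c * x + s * y) ^ 2 + (-s * x + c * y) ^ 2 = x ^ 2 + y ^ 2 := by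
  linear_combination (x ^ 2 + y ^ 2) * h

/-- Hypotheses on a planar path `(x, y)` with velocity `(u, v)` on `[a, b]` under which its Kepler
action is finite. -/
structure PlanePath (x y u v : ℝ → ℝ) (a b : ℝ) : Prop where
  hx : IsPrim x u a b
  hy : IsPrim y v a b
  hK : IntervalIntegrable (fun t => u t ^ 2 + v t ^ 2) volume a b
  hS : IntervalIntegrable (fun t => (√(x t ^ 2 + y t ^ 2))⁻¹) volume a b
  hne : ∀ᵐ t, t ∈ Ioo a b → √(x t ^ 2 + y t ^ 2) ≠ 0

theorem PlanePath.rot {x y u v : ℝ → ℝ} {a b c s : ℝ} (p : PlanePath x y u v a b)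
    (h : c ^ 2 + s ^ 2 = 1) :
    PlanePath (fun t => c * x t + s * y t) (fun t => -s * x t + c * y t)
      (fun t => c * u t + s * v t) (fun t => -s * u t + c * v t) a b := by
  refine ⟨p.hx.lin p.hy c s, p.hx.lin p.hy (-s) c, ?_, ?_, ?_⟩
  · simpa only [rot_sq_add_sq h] using p.hK
  · simpa only [rot_sq_add_sq h] using p.hS
  · simpa only [rot_sq_add_sq h] using p.hne

theorem PlanePath.mono {x y u v : ℝ → ℝ} {a b c d : ℝ} (p : PlanePath x y u v a b)
    (hac : a ≤ c) (hcd : c ≤ d) (hdb : d ≤ b) : PlanePath x y u v c d := by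
  have hsub : uIcc c d ⊆ uIcc a b := by
    rw [uIcc_of_le hcd, uIcc_of_le (by linarith)]; exact Icc_subset_Icc hac hdb
  refine ⟨p.hx.mono hac hcd hdb, p.hy.mono hac hcd hdb, p.hK.mono_set hsub, p.hS.mono_set hsub, ?_⟩
  filter_upwards [p.hne] with t ht h using ht ⟨hac.trans_lt h.1, h.2.trans_le hdb⟩

theorem PlanePath.bound_of_zero_left {x y u v : ℝ → ℝ} {a b : ℝ} (hab : a < b)
    (p : PlanePath x y u v a b) (hxa : x a = 0) (hya : y a = 0) :
    π ^ 2 * (b - a) ≤ (∫ t in a..b, (u t ^ 2 + v t ^ 2)) *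
      (∫ t in a..b, (√(x t ^ 2 + y t ^ 2))⁻¹) ^ 2 := by
  obtain ⟨c, s, h, hb⟩ : ∃ c s : ℝ, c ^ 2 + s ^ 2 = 1 ∧
      c * x b + s * y b = -√(x b ^ 2 + y b ^ 2) := by
    by_cases h0 : √(x b ^ 2 + y b ^ 2) = 0
    · have h1 : x b ^ 2 + y b ^ 2 = 0 := by
        rwa [Real.sqrt_eq_zero (by positivity)] at h0
      have h2 : x b = 0 := by nlinarith [sq_nonneg (x b), sq_nonneg (y b)]
      exact ⟨1, 0, by norm_num, by rw [h0, h2]; norm_num⟩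
    · have hsq : √(x b ^ 2 + y b ^ 2) ^ 2 = x b ^ 2 + y b ^ 2 := Real.sq_sqrt (by positivity)
      refine ⟨-x b / √(x b ^ 2 + y b ^ 2), -y b / √(x b ^ 2 + y b ^ 2), ?_, ?_⟩
      · field_simp; linarith
      · field_simp; linarith
  have q := p.rot h
  have := sector_bound (ψ := π / 2) hab q.hx q.hy q.hK q.hS q.hne (by simp [hxa, hya])
    (by positivity) le_rfl (by
      rw [mul_div_cancel₀ _ two_ne_zero, Real.cos_pi, rot_sq_add_sq h, hb]; ring)
  simpa only [rot_sq_add_sq h, mul_div_cancel₀ π two_ne_zero] using this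

theorem PlanePath.bound_of_zero_right {x y u v : ℝ → ℝ} {a b : ℝ} (hab : a < b)
    (p : PlanePath x y u v a b) (hxb : x b = 0) (hyb : y b = 0) :
    π ^ 2 * (b - a) ≤ (∫ t in a..b, (u t ^ 2 + v t ^ 2)) *
      (∫ t in a..b, (√(x t ^ 2 + y t ^ 2))⁻¹) ^ 2 := by
  have q : PlanePath (fun t => x (a + b - t)) (fun t => y (a + b - t))
      (fun t => -u (a + b - t)) (fun t => -v (a + b - t)) a b := by
    refine ⟨p.hx.reflect, p.hy.reflect, ?_, ?_, ?_⟩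
    · have := (p.hK.comp_sub_left (a + b)).symm
      simpa using this
    · have := (p.hS.comp_sub_left (a + b)).symm
      simpa using this
    · have := (MeasureTheory.Measure.measurePreserving_sub_left volume
        (a + b)).quasiMeasurePreserving.ae p.hne
      filter_upwards [this] with t ht h
      exact ht ⟨by linarith [h.2], by linarith [h.1]⟩
  have := q.bound_of_zero_left hab (by simpa using hxb) (by simpa using hyb)
  simp only [neg_sq] at this
  rwa [intervalIntegral.integral_comp_sub_left (fun t => u t ^ 2 + v t ^ 2),
    intervalIntegral.integral_comp_sub_left (fun t => (√(x t ^ 2 + y t ^ 2))⁻¹),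
    add_sub_cancel_right, add_sub_cancel_left] at this

theorem PlanePath.bound_of_zero {x y u v : ℝ → ℝ} {τ : ℝ} (p : PlanePath x y u v 0 1)
    (hτ : τ ∈ Icc (0 : ℝ) 1) (hx : x τ = 0) (hy : y τ = 0) :
    π ^ 2 ≤ (∫ t in (0 : ℝ)..1, (u t ^ 2 + v t ^ 2)) *
      (∫ t in (0 : ℝ)..1, (√(x t ^ 2 + y t ^ 2))⁻¹) ^ 2 := by
  have p1 := p.mono le_rfl hτ.1 hτ.2
  have p2 := p.mono hτ.1 hτ.2 le_rfl
  have e1 := intervalIntegral.integral_add_adjacent_intervals p1.hK p2.hK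
  have e2 := intervalIntegral.integral_add_adjacent_intervals p1.hS p2.hS
  have n1 : 0 ≤ ∫ t in (0 : ℝ)..τ, (u t ^ 2 + v t ^ 2) :=
    intervalIntegral.integral_nonneg hτ.1 fun t _ => by positivity
  have n2 : 0 ≤ ∫ t in τ..1, (u t ^ 2 + v t ^ 2) :=
    intervalIntegral.integral_nonneg hτ.2 fun t _ => by positivity
  have n3 : 0 ≤ ∫ t in (0 : ℝ)..τ, (√(x t ^ 2 + y t ^ 2))⁻¹ :=
    intervalIntegral.integral_nonneg hτ.1 fun t _ => by positivity
  have n4 : 0 ≤ ∫ t in τ..1, (√(x t ^ 2 + y t ^ 2))⁻¹ :=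
    intervalIntegral.integral_nonneg hτ.2 fun t _ => by positivity
  have b1 : π ^ 2 * (τ - 0) ≤ (∫ t in (0 : ℝ)..τ, (u t ^ 2 + v t ^ 2)) *
      (∫ t in (0 : ℝ)..τ, (√(x t ^ 2 + y t ^ 2))⁻¹) ^ 2 := by
    rcases hτ.1.eq_or_lt with h | h
    · subst h; simp
    · exact p1.bound_of_zero_right h hx hy
  have b2 : π ^ 2 * (1 - τ) ≤ (∫ t in τ..1, (u t ^ 2 + v t ^ 2)) *
      (∫ t in τ..1, (√(x t ^ 2 + y t ^ 2))⁻¹) ^ 2 := by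
    rcases hτ.2.eq_or_lt with h | h
    · subst h; simp
    · exact p2.bound_of_zero_left h hx hy
  rw [← e1, ← e2]
  generalize (∫ t in (0 : ℝ)..τ, (u t ^ 2 + v t ^ 2)) = A1 at *
  generalize (∫ t in τ..1, (u t ^ 2 + v t ^ 2)) = A2 at *
  generalize (∫ t in (0 : ℝ)..τ, (√(x t ^ 2 + y t ^ 2))⁻¹) = S1 at *
  generalize (∫ t in τ..1, (√(x t ^ 2 + y t ^ 2))⁻¹) = S2 at *
  have h1 : A1 * S1 ^ 2 ≤ A1 * (S1 + S2) ^ 2 := by gcongr; linarith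
  have h2 : A2 * S2 ^ 2 ≤ A2 * (S1 + S2) ^ 2 := by gcongr; linarith
  nlinarith

theorem PlanePath.bound_of_rays {x y u v : ℝ → ℝ} {α φ A B : ℝ} (p : PlanePath x y u v 0 1)
    (hφ0 : 0 < φ) (hφ1 : φ ≤ π) (hA : 0 ≤ A) (hB : 0 ≤ B)
    (hx0 : x 0 = A * Real.cos α) (hy0 : y 0 = A * Real.sin α)
    (hx1 : x 1 = B * Real.cos (α + φ)) (hy1 : y 1 = B * Real.sin (α + φ)) :
    φ ^ 2 ≤ (∫ t in (0 : ℝ)..1, (u t ^ 2 + v t ^ 2)) *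
      (∫ t in (0 : ℝ)..1, (√(x t ^ 2 + y t ^ 2))⁻¹) ^ 2 := by
  have h := Real.cos_sq_add_sin_sq α
  have q := p.rot h
  have e0 : x 0 ^ 2 + y 0 ^ 2 = A ^ 2 := by rw [hx0, hy0]; linear_combination A ^ 2 * h
  have e1 : x 1 ^ 2 + y 1 ^ 2 = B ^ 2 := by
    rw [hx1, hy1]; linear_combination B ^ 2 * Real.cos_sq_add_sin_sq (α + φ)
  have := sector_bound (ψ := φ / 2) one_pos q.hx q.hy q.hK q.hS q.hne
    (by rw [rot_sq_add_sq h, e0, Real.sqrt_sq hA, hx0, hy0]; linear_combination -A * h)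
    (by linarith) (by linarith) (by
      rw [mul_div_cancel₀ _ two_ne_zero, rot_sq_add_sq h, e1, Real.sqrt_sq hB, hx1, hy1,
        Real.cos_add, Real.sin_add]
      linear_combination B * Real.cos φ * h)
  simpa only [rot_sq_add_sq h, mul_div_cancel₀ φ two_ne_zero, sub_zero, mul_one] using this

theorem wirtinger_axis {x y u v : ℝ → ℝ} {φ B : ℝ} (hx : IsPrim x u 0 1) (hy : IsPrim y v 0 1)
    (hK : IntervalIntegrable (fun t => u t ^ 2 + v t ^ 2) volume 0 1)
    (hφ0 : 0 < φ) (hφ1 : φ < π / 2) (hy0 : y 0 = 0)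
    (hx1 : x 1 = B * Real.cos φ) (hy1 : y 1 = B * Real.sin φ) :
    φ ^ 2 * (∫ t in (0 : ℝ)..1, (x t ^ 2 + y t ^ 2)) ≤ ∫ t in (0 : ℝ)..1, (u t ^ 2 + v t ^ 2) := by
  have hI : IntervalIntegrable (fun t => x t ^ 2 + y t ^ 2) volume 0 1 := by
    refine ContinuousOn.intervalIntegrable ?_
    rw [uIcc_of_le zero_le_one]
    exact ((hx.continuousOn zero_le_one).pow 2).add ((hy.continuousOn zero_le_one).pow 2)
  have main : ∀ k ∈ Ioo 0 φ, k ^ 2 * (∫ t in (0 : ℝ)..1, (x t ^ 2 + y t ^ 2)) ≤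
      ∫ t in (0 : ℝ)..1, (u t ^ 2 + v t ^ 2) := by
    intro k hk
    have hc1 : ∀ σ ∈ Icc (0 : ℝ) 1, Real.cos (0 - k * σ) ≠ 0 := by
      intro σ hσ
      have h1 : k * σ ≤ k := by nlinarith [hσ.2, hk.1]
      have h2 : 0 ≤ k * σ := mul_nonneg hk.1.le hσ.1
      exact (Real.cos_pos_of_mem_Ioo ⟨by linarith [hk.2], by linarith [hk.2, hk.1]⟩).ne'
    have hc2 : ∀ σ ∈ Icc (0 : ℝ) 1, Real.cos ((π / 2 - (φ - k)) - k * σ) ≠ 0 := by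
      intro σ hσ
      have h1 : k * σ ≤ k := by nlinarith [hσ.2, hk.1]
      have h2 : 0 ≤ k * σ := mul_nonneg hk.1.le hσ.1
      exact (Real.cos_pos_of_mem_Ioo ⟨by linarith [hk.2, hk.1], by linarith [hk.2, hk.1]⟩).ne'
    have hm1 : AbsolutelyContinuousOnInterval (fun t => k * Real.tan (0 - k * t)) 0 1 :=
      ContDiffOn.absolutelyContinuousOnInterval
        (by rw [uIcc_of_le zero_le_one]; exact contDiffOn_mul_tan _ _ _ hc1)
    have hm2 : AbsolutelyContinuousOnInterval
        (fun t => k * Real.tan ((π / 2 - (φ - k)) - k * t)) 0 1 :=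
      ContDiffOn.absolutelyContinuousOnInterval
        (by rw [uIcc_of_le zero_le_one]; exact contDiffOn_mul_tan _ _ _ hc2)
    have hx' := hx.ac zero_le_one
    have hy' := hy.ac zero_le_one
    have hW := (hm1.fun_mul (hx'.fun_mul hx')).fun_add (hm2.fun_mul (hy'.fun_mul hy'))
    have hle := hW.sub_le_integral zero_le_one (hK.sub (hI.const_mul (k ^ 2))) (by
      filter_upwards [hx.ae_hasDerivAt zero_le_one, hy.ae_hasDerivAt zero_le_one] with t h1 h2 ht
      have e1 := hasDerivAt_mul_tan k 0 t (hc1 t (Ioo_subset_Icc_self ht))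
      have e2 := hasDerivAt_mul_tan k (π / 2 - (φ - k)) t (hc2 t (Ioo_subset_Icc_self ht))
      refine ⟨_, (e1.mul ((h1 ht).mul (h1 ht))).add (e2.mul ((h2 ht).mul (h2 ht))), ?_⟩
      simp only [Pi.mul_apply]
      generalize k * Real.tan (0 - k * t) = p
      generalize k * Real.tan (π / 2 - (φ - k) - k * t) = q
      nlinarith [sq_nonneg (u t - p * x t), sq_nonneg (v t - q * y t)])
    have hs : 0 < Real.sin φ := Real.sin_pos_of_pos_of_lt_pi hφ0 (by linarith [Real.pi_pos])
    have hc : 0 < Real.cos φ := Real.cos_pos_of_mem_Ioo ⟨by linarith, by linarith⟩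
    have hck : 0 < Real.cos k := Real.cos_pos_of_mem_Ioo ⟨by linarith [hk.1], by linarith [hk.2]⟩
    have hsub : 0 ≤ Real.sin (φ - k) :=
      Real.sin_nonneg_of_nonneg_of_le_pi (by linarith [hk.2]) (by linarith [hk.1, Real.pi_pos])
    have e3 : k * Real.tan (0 - k * 1) * (x 1 * x 1) +
        k * Real.tan (π / 2 - (φ - k) - k * 1) * (y 1 * y 1)
        = k * B ^ 2 * Real.cos φ * Real.sin (φ - k) / Real.cos k := by
      rw [hx1, hy1, show π / 2 - (φ - k) - k * 1 = π / 2 - φ by ring, Real.tan_pi_div_two_sub,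
        zero_sub, mul_one, Real.tan_neg, Real.tan_eq_sin_div_cos, Real.tan_eq_sin_div_cos,
        Real.sin_sub]
      field_simp
      ring
    have e4 : 0 ≤ k * B ^ 2 * Real.cos φ * Real.sin (φ - k) / Real.cos k := by
      have := hk.1
      positivity
    rw [intervalIntegral.integral_sub hK (hI.const_mul _), intervalIntegral.integral_const_mul,
      e3, hy0] at hle
    simp only [mul_zero, sub_zero, Real.tan_zero, zero_mul, add_zero] at hle
    linarith
  have hcont : Filter.Tendsto (fun κ : ℝ => κ ^ 2 * ∫ t in (0 : ℝ)..1, (x t ^ 2 + y t ^ 2))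
      (nhdsWithin φ (Iio φ)) (nhds (φ ^ 2 * ∫ t in (0 : ℝ)..1, (x t ^ 2 + y t ^ 2))) :=
    Filter.Tendsto.mono_left (Continuous.tendsto (by fun_prop) φ) nhdsWithin_le_nhds
  refine le_of_tendsto hcont ?_
  filter_upwards [Ioo_mem_nhdsLT hφ0] with κ hκ using main κ hκ

/-- Wirtinger inequality for planar paths joining two lines through the origin at angle `φ`. -/
theorem wirtinger_lines {x y u v : ℝ → ℝ} {α φ A B : ℝ} (hx : IsPrim x u 0 1)
    (hy : IsPrim y v 0 1) (hK : IntervalIntegrable (fun t => u t ^ 2 + v t ^ 2) volume 0 1)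
    (hφ0 : 0 < φ) (hφ1 : φ < π / 2)
    (hx0 : x 0 = A * Real.cos α) (hy0 : y 0 = A * Real.sin α)
    (hx1 : x 1 = B * Real.cos (α + φ)) (hy1 : y 1 = B * Real.sin (α + φ)) :
    φ ^ 2 * (∫ t in (0 : ℝ)..1, (x t ^ 2 + y t ^ 2)) ≤ ∫ t in (0 : ℝ)..1, (u t ^ 2 + v t ^ 2) := by
  have h := Real.cos_sq_add_sin_sq α
  have := wirtinger_axis (φ := φ) (B := B) (hx.lin hy (Real.cos α) (Real.sin α))
    (hx.lin hy (-Real.sin α) (Real.cos α)) (by simpa only [rot_sq_add_sq h] using hK) hφ0 hφ1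
    (by rw [hx0, hy0]; ring)
    (by rw [hx1, hy1, Real.cos_add, Real.sin_add]; linear_combination B * Real.cos φ * h)
    (by rw [hx1, hy1, Real.cos_add, Real.sin_add]; linear_combination B * Real.sin φ * h)
  simpa only [rot_sq_add_sq h] using this

theorem sum_pairs_four {M : Type*} [AddCommMonoid M] (g : Fin 4 → Fin 4 → M) :
    ∑ i : Fin 4, ∑ j ∈ Finset.univ.filter (fun j => i < j), g i j =
      g 0 1 + g 0 2 + g 0 3 + (g 1 2 + g 1 3) + g 2 3 := by
  have h0 : Finset.univ.filter (fun j : Fin 4 => 0 < j) = {1, 2, 3} := by decide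
  have h1 : Finset.univ.filter (fun j : Fin 4 => 1 < j) = {2, 3} := by decide
  have h2 : Finset.univ.filter (fun j : Fin 4 => 2 < j) = {3} := by decide
  have h3 : Finset.univ.filter (fun j : Fin 4 => 3 < j) = ∅ := by decide
  rw [Fin.sum_univ_four, h0, h1, h2, h3]
  simp [add_assoc]

theorem enorm2_sq (w : ℝ × ℝ) : enorm2 w ^ 2 = w.1 ^ 2 + w.2 ^ 2 :=
  Real.sq_sqrt (by positivity)

theorem enorm2_nonneg (w : ℝ × ℝ) : 0 ≤ enorm2 w := Real.sqrt_nonneg _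

theorem enorm2_eq_zero {w : ℝ × ℝ} : enorm2 w = 0 ↔ w = 0 := by
  rw [enorm2, Real.sqrt_eq_zero (by positivity)]
  constructor
  · intro h
    ext
    · show w.1 = 0
      nlinarith [sq_nonneg w.1, sq_nonneg w.2]
    · show w.2 = 0
      nlinarith [sq_nonneg w.1, sq_nonneg w.2]
  · rintro rfl
    simp

theorem enorm2_pos {w : ℝ × ℝ} : 0 < enorm2 w ↔ w ≠ 0 := by
  rw [lt_iff_le_and_ne, ne_comm, ne_eq, enorm2_eq_zero]
  simp [enorm2_nonneg]

theorem enorm2_neg (w : ℝ × ℝ) : enorm2 (-w) = enorm2 w := by simp [enorm2]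

theorem enorm2_sub_comm (w z : ℝ × ℝ) : enorm2 (w - z) = enorm2 (z - w) := by
  rw [← enorm2_neg, neg_sub]

theorem continuous_enorm2 : Continuous enorm2 := by unfold enorm2; fun_prop

namespace H1Path4

variable (p : H1Path4)

/-- The Lagrangian along a path, as a real number. -/
def lag (t : ℝ) : ℝ :=
  (1/2) * ∑ i, enorm2 (p.v t i) ^ 2
    + ∑ i : Fin 4, ∑ j ∈ Finset.univ.filter (fun j => i < j), (enorm2 (p.q t i - p.q t j))⁻¹

theorem lag_nonneg (t : ℝ) : 0 ≤ p.lag t := by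
  have := fun w => enorm2_nonneg w
  unfold lag
  refine add_nonneg (by positivity) (Finset.sum_nonneg fun i _ => Finset.sum_nonneg fun j _ =>
    inv_nonneg.2 (this _))

theorem intervalIntegrable_v (i : Fin 4) : IntervalIntegrable (fun t => p.v t i) volume 0 1 := by
  rw [intervalIntegrable_iff_integrableOn_Icc_of_le zero_le_one]
  exact p.hvInt i

theorem isPrim_fst (i : Fin 4) : IsPrim (fun t => (p.q t i).1) (fun t => (p.v t i).1) 0 1 := by
  have h := p.intervalIntegrable_v i
  refine ⟨?_, fun t ht => ?_⟩
  · rw [intervalIntegrable_iff] at h ⊢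
    exact h.fst
  · have h' : IntervalIntegrable (fun s => p.v s i) volume 0 t :=
      h.mono_set (by rw [uIcc_of_le ht.1, uIcc_of_le zero_le_one]; exact Icc_subset_Icc le_rfl ht.2)
    have := (ContinuousLinearMap.fst ℝ ℝ ℝ).intervalIntegral_comp_comm h'
    rw [p.hrep i t ht]
    simpa using this.symm

theorem isPrim_snd (i : Fin 4) : IsPrim (fun t => (p.q t i).2) (fun t => (p.v t i).2) 0 1 := by
  have h := p.intervalIntegrable_v i
  refine ⟨?_, fun t ht => ?_⟩
  · rw [intervalIntegrable_iff] at h ⊢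
    exact h.snd
  · have h' : IntervalIntegrable (fun s => p.v s i) volume 0 t :=
      h.mono_set (by rw [uIcc_of_le ht.1, uIcc_of_le zero_le_one]; exact Icc_subset_Icc le_rfl ht.2)
    have := (ContinuousLinearMap.snd ℝ ℝ ℝ).intervalIntegral_comp_comm h'
    rw [p.hrep i t ht]
    simpa using this.symm

theorem continuousOn_q (i : Fin 4) : ContinuousOn (fun t => p.q t i) (Icc 0 1) :=
  ((p.isPrim_fst i).continuousOn zero_le_one).prodMk ((p.isPrim_snd i).continuousOn zero_le_one)

theorem memLp_fst (i : Fin 4) : MemLp (fun t => (p.v t i).1) 2 (volume.restrict (Icc 0 1)) := by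
  have h : Integrable (fun t => (p.v t i).1) (volume.restrict (Icc 0 1)) := (p.hvInt i).fst
  rw [memLp_two_iff_integrable_sq h.1]
  refine Integrable.mono (p.hL2 i) (h.1.pow 2) (ae_of_all _ fun t => ?_)
  rw [Real.norm_of_nonneg (by positivity), Real.norm_of_nonneg (by positivity), enorm2_sq]
  nlinarith [sq_nonneg (p.v t i).2]

theorem memLp_snd (i : Fin 4) : MemLp (fun t => (p.v t i).2) 2 (volume.restrict (Icc 0 1)) := by
  have h : Integrable (fun t => (p.v t i).2) (volume.restrict (Icc 0 1)) := (p.hvInt i).snd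
  rw [memLp_two_iff_integrable_sq h.1]
  refine Integrable.mono (p.hL2 i) (h.1.pow 2) (ae_of_all _ fun t => ?_)
  rw [Real.norm_of_nonneg (by positivity), Real.norm_of_nonneg (by positivity), enorm2_sq]
  nlinarith [sq_nonneg (p.v t i).1]

theorem aestronglyMeasurable_dist (i j : Fin 4) :
    AEStronglyMeasurable (fun t => enorm2 (p.q t i - p.q t j)) (volume.restrict (Icc 0 1)) :=
  (continuous_enorm2.comp_continuousOn ((p.continuousOn_q i).sub (p.continuousOn_q j))
    ).aestronglyMeasurable measurableSet_Icc

theorem aestronglyMeasurable_speed (i : Fin 4) :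
    AEStronglyMeasurable (fun t => enorm2 (p.v t i) ^ 2) (volume.restrict (Icc 0 1)) :=
  (p.hL2 i).1

theorem aestronglyMeasurable_lag : AEStronglyMeasurable p.lag (volume.restrict (Icc 0 1)) := by
  unfold lag
  refine ((Finset.univ.aestronglyMeasurable_fun_sum fun i _ =>
    p.aestronglyMeasurable_speed i).const_mul _).add
    (Finset.univ.aestronglyMeasurable_fun_sum fun i _ =>
      Finset.aestronglyMeasurable_fun_sum _ fun j _ => ?_)
  exact (p.aestronglyMeasurable_dist i j).aemeasurable.inv.aestronglyMeasurable

theorem ofReal_lag {t : ℝ} (h : ∀ i j : Fin 4, i < j → p.q t i ≠ p.q t j) :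
    ENNReal.ofReal ((1/2) * ∑ i, enorm2 (p.v t i) ^ 2)
      + ∑ i : Fin 4, ∑ j ∈ Finset.univ.filter (fun j => i < j),
          (ENNReal.ofReal (enorm2 (p.q t i - p.q t j)))⁻¹ = ENNReal.ofReal (p.lag t) := by
  have h0 := fun w => enorm2_nonneg w
  rw [lag, ENNReal.ofReal_add (by positivity) (Finset.sum_nonneg fun i _ =>
    Finset.sum_nonneg fun j _ => inv_nonneg.2 (h0 _)),
    ENNReal.ofReal_sum_of_nonneg (fun i _ => Finset.sum_nonneg fun j _ => inv_nonneg.2 (h0 _))]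
  congr 1
  refine Finset.sum_congr rfl fun i _ => ?_
  rw [ENNReal.ofReal_sum_of_nonneg (fun j _ => inv_nonneg.2 (h0 _))]
  refine Finset.sum_congr rfl fun j hj => ?_
  rw [ENNReal.ofReal_inv_of_pos (enorm2_pos.2 (sub_ne_zero.2 (h i j (by simpa using hj))))]

variable {p}

theorem ae_ne (hp : action p ≠ ∞) :
    ∀ᵐ t ∂(volume.restrict (Icc 0 1)), ∀ i j : Fin 4, i < j → p.q t i ≠ p.q t j := by
  have hm : AEMeasurable (fun t => ENNReal.ofReal ((1/2) * ∑ i, enorm2 (p.v t i) ^ 2)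
      + ∑ i : Fin 4, ∑ j ∈ Finset.univ.filter (fun j => i < j),
          (ENNReal.ofReal (enorm2 (p.q t i - p.q t j)))⁻¹) (volume.restrict (Icc 0 1)) := by
    have h1 : AEMeasurable (fun t => ENNReal.ofReal ((1/2) * ∑ i, enorm2 (p.v t i) ^ 2))
        (volume.restrict (Icc 0 1)) := ((Finset.univ.aestronglyMeasurable_fun_sum fun i _ =>
      p.aestronglyMeasurable_speed i).const_mul _).aemeasurable.ennreal_ofReal
    have h2 : AEMeasurable (fun t => ∑ i : Fin 4, ∑ j ∈ Finset.univ.filter (fun j => i < j),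
        (ENNReal.ofReal (enorm2 (p.q t i - p.q t j)))⁻¹) (volume.restrict (Icc 0 1)) :=
      Finset.univ.aemeasurable_fun_sum fun i _ => Finset.aemeasurable_fun_sum _ fun j _ =>
        (p.aestronglyMeasurable_dist i j).aemeasurable.ennreal_ofReal.inv
    exact h1.add h2
  filter_upwards [ae_lt_top' hm hp] with t ht i j hij he
  refine absurd ht (not_lt.2 ?_)
  rw [top_le_iff, ENNReal.add_eq_top]
  right
  rw [ENNReal.sum_eq_top]
  refine ⟨i, Finset.mem_univ _, ?_⟩
  rw [ENNReal.sum_eq_top]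
  refine ⟨j, by simpa using hij, ?_⟩
  rw [he]
  simp [enorm2]

theorem action_eq_lintegral (hp : action p ≠ ∞) :
    action p = ∫⁻ t in Icc (0 : ℝ) 1, ENNReal.ofReal (p.lag t) := by
  refine lintegral_congr_ae ?_
  filter_upwards [ae_ne hp] with t ht
  exact p.ofReal_lag ht

theorem integrableOn_lag (hp : action p ≠ ∞) : IntegrableOn p.lag (Icc 0 1) := by
  refine ⟨p.aestronglyMeasurable_lag, ?_⟩
  rw [hasFiniteIntegral_iff_ofReal (ae_of_all _ p.lag_nonneg), ← action_eq_lintegral hp]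
  exact lt_top_iff_ne_top.2 hp

theorem action_eq (hp : action p ≠ ∞) : action p = ENNReal.ofReal (∫ t in (0 : ℝ)..1, p.lag t) := by
  rw [action_eq_lintegral hp, intervalIntegral.integral_of_le zero_le_one,
    ← integral_Icc_eq_integral_Ioc,
    ofReal_integral_eq_lintegral_ofReal (integrableOn_lag hp) (ae_of_all _ p.lag_nonneg)]

theorem inv_le_lag (t : ℝ) {i j : Fin 4} (hij : i < j) :
    (enorm2 (p.q t i - p.q t j))⁻¹ ≤ p.lag t := by
  have h0 := fun w => enorm2_nonneg w
  have h1 : (enorm2 (p.q t i - p.q t j))⁻¹ ≤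
      ∑ j ∈ Finset.univ.filter (fun j => i < j), (enorm2 (p.q t i - p.q t j))⁻¹ :=
    Finset.single_le_sum (f := fun j => (enorm2 (p.q t i - p.q t j))⁻¹)
      (fun j _ => inv_nonneg.2 (h0 _)) (by simpa using hij)
  have h2 : (∑ j ∈ Finset.univ.filter (fun j => i < j), (enorm2 (p.q t i - p.q t j))⁻¹) ≤
      ∑ i : Fin 4, ∑ j ∈ Finset.univ.filter (fun j => i < j), (enorm2 (p.q t i - p.q t j))⁻¹ :=
    Finset.single_le_sum (f := fun i => ∑ j ∈ Finset.univ.filter (fun j => i < j),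
      (enorm2 (p.q t i - p.q t j))⁻¹)
      (fun i _ => Finset.sum_nonneg fun j _ => inv_nonneg.2 (h0 _)) (Finset.mem_univ i)
  have h3 : 0 ≤ (1/2) * ∑ i, enorm2 (p.v t i) ^ 2 := by positivity
  unfold lag
  linarith

theorem integrableOn_inv (hp : action p ≠ ∞) {i j : Fin 4} (hij : i < j) :
    IntegrableOn (fun t => (enorm2 (p.q t i - p.q t j))⁻¹) (Icc 0 1) := by
  refine Integrable.mono' (integrableOn_lag hp)
    (p.aestronglyMeasurable_dist i j).aemeasurable.inv.aestronglyMeasurable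
    (ae_of_all _ fun t => ?_)
  rw [Real.norm_of_nonneg (inv_nonneg.2 (enorm2_nonneg _))]
  exact inv_le_lag t hij

theorem intervalIntegrable_sq (f g : ℝ → ℝ) (hf : MemLp f 2 (volume.restrict (Icc 0 1)))
    (hg : MemLp g 2 (volume.restrict (Icc 0 1))) :
    IntervalIntegrable (fun t => f t ^ 2 + g t ^ 2) volume 0 1 := by
  rw [intervalIntegrable_iff_integrableOn_Icc_of_le zero_le_one]
  exact hf.integrable_sq.add hg.integrable_sq

theorem planePath (hp : action p ≠ ∞) {i j : Fin 4} (hij : i ≠ j) :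
    PlanePath (fun t => (p.q t i).1 - (p.q t j).1) (fun t => (p.q t i).2 - (p.q t j).2)
      (fun t => (p.v t i).1 - (p.v t j).1) (fun t => (p.v t i).2 - (p.v t j).2) 0 1 := by
  refine ⟨?_, ?_, ?_, ?_, ?_⟩
  · simpa [sub_eq_add_neg] using (p.isPrim_fst i).lin (p.isPrim_fst j) 1 (-1)
  · simpa [sub_eq_add_neg] using (p.isPrim_snd i).lin (p.isPrim_snd j) 1 (-1)
  · exact intervalIntegrable_sq _ _ ((p.memLp_fst i).sub (p.memLp_fst j))
      ((p.memLp_snd i).sub (p.memLp_snd j))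
  · rw [intervalIntegrable_iff_integrableOn_Icc_of_le zero_le_one]
    rcases lt_or_gt_of_ne hij with h | h
    · exact integrableOn_inv hp h
    · simpa only [enorm2_sub_comm] using! integrableOn_inv hp h
  · have h := (ae_restrict_iff' measurableSet_Icc).1 (ae_ne hp)
    filter_upwards [h] with t ht hI
    have hne : p.q t i ≠ p.q t j := by
      rcases lt_or_gt_of_ne hij with h | h
      · exact ht (Ioo_subset_Icc_self hI) _ _ h
      · exact (ht (Ioo_subset_Icc_self hI) _ _ h).symm
    exact (enorm2_pos.2 (sub_ne_zero.2 hne)).ne'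

end H1Path4

theorem three_mul_le_add_two_mul {a b g : ℝ} (hb : 0 ≤ b) (hg : 0 < g)
    (h : g ^ 3 ≤ a * b ^ 2) : 3 * g ≤ a + 2 * b := by
  by_contra! hlt
  have h1 : 0 ≤ (g - b) ^ 2 * (g + 2 * b) := by positivity
  have hb' : 0 < b ^ 2 := by
    rcases eq_or_lt_of_le (sq_nonneg b) with h0 | h0
    · rw [← h0, mul_zero] at h
      exact absurd h (not_le.2 (by positivity))
    · exact h0
  nlinarith [mul_lt_mul_of_pos_right hlt hb']

theorem eighth_bound {K S κ f : ℝ} (hS : 0 ≤ S) (hκ : 0 < κ) (hκ3 : κ ^ 3 = 2)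
    (hf : 0 < f) (h : (f ^ 3) ^ 2 ≤ K * S ^ 2) : 3 / 4 * κ * f ^ 2 ≤ K / 8 + S := by
  have := three_mul_le_add_two_mul (a := K / 8) (b := S / 2) (g := κ * f ^ 2 / 4) (by positivity)
    (by positivity) ?_
  · linarith
  · have : (κ * f ^ 2 / 4) ^ 3 = κ ^ 3 * (f ^ 3) ^ 2 / 64 := by ring
    rw [this, hκ3]
    nlinarith

theorem quarter_bound {K S κ f : ℝ} (hS : 0 ≤ S) (hκ : 0 < κ) (hκ3 : κ ^ 3 = 2)
    (hf : 0 < f) (h : (f ^ 3) ^ 2 ≤ K * S ^ 2) : 3 / 4 * κ ^ 2 * f ^ 2 ≤ K / 4 + S := by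
  have := three_mul_le_add_two_mul (a := K / 4) (b := S / 2) (g := κ ^ 2 * f ^ 2 / 4) (by positivity)
    (by positivity) ?_
  · linarith
  · have : (κ ^ 2 * f ^ 2 / 4) ^ 3 = (κ ^ 3) ^ 2 * (f ^ 3) ^ 2 / 64 := by ring
    rw [this, hκ3]
    nlinarith

theorem inv_ge_quadratic {d m : ℝ} (hd : 0 < d) (hm : 0 < m) :
    3 / (2 * m) - d ^ 2 / (2 * m ^ 3) ≤ d⁻¹ := by
  have h : d⁻¹ - (3 / (2 * m) - d ^ 2 / (2 * m ^ 3)) =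
      (d - m) ^ 2 * (d + 2 * m) / (2 * m ^ 3 * d) := by
    field_simp
    ring
  have : 0 ≤ (d - m) ^ 2 * (d + 2 * m) / (2 * m ^ 3 * d) := by positivity
  linarith

/-- A primitive of a square integrable function vanishing somewhere in the unit interval. -/
theorem IsPrim.sq_le_of_zero {f g : ℝ → ℝ} (h : IsPrim f g 0 1)
    (hg : IntervalIntegrable (fun t => g t ^ 2) volume 0 1) {τ t : ℝ} (hτ : τ ∈ Icc (0 : ℝ) 1)
    (h0 : f τ = 0) (ht : t ∈ Icc (0 : ℝ) 1) : f t ^ 2 ≤ ∫ s in (0 : ℝ)..1, g s ^ 2 := by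
  have hsub : ∀ u ∈ Icc (0 : ℝ) 1, uIcc 0 u ⊆ uIcc (0 : ℝ) 1 := fun u hu => by
    rw [uIcc_of_le hu.1, uIcc_of_le zero_le_one]; exact Icc_subset_Icc le_rfl hu.2
  have e : f t = ∫ s in τ..t, g s := by
    have h1 := h.eq t ht
    have h2 := h.eq τ hτ
    rw [← intervalIntegral.integral_interval_sub_left (h.int.mono_set (hsub t ht))
      (h.int.mono_set (hsub τ hτ))]
    linarith
  set c := ∫ s in (0 : ℝ)..1, |g s| with hc
  have hle : |f t| ≤ c := by
    rw [e]
    refine (intervalIntegral.norm_integral_le_abs_integral_norm (f := g)).trans ?_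
    have h3 := intervalIntegral.abs_integral_mono_interval (f := fun s => ‖g s‖) (c := 0) (d := 1)
      (a := τ) (b := t) (μ := volume) (by
        rw [uIoc_of_le zero_le_one, uIoc_eq_union]
        rintro x (hx | hx)
        · exact ⟨hτ.1.trans_lt hx.1, hx.2.trans ht.2⟩
        · exact ⟨ht.1.trans_lt hx.1, hx.2.trans hτ.2⟩)
      (ae_of_all _ fun s => norm_nonneg _) h.int.norm
    refine h3.trans (le_of_eq ?_)
    rw [abs_of_nonneg (intervalIntegral.integral_nonneg zero_le_one fun s _ => norm_nonneg _)]
    rfl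
  have habs : IntervalIntegrable (fun s => |g s|) volume 0 1 := h.int.norm
  have hvar : 0 ≤ ∫ s in (0 : ℝ)..1, (|g s| - c) ^ 2 :=
    intervalIntegral.integral_nonneg zero_le_one fun s _ => sq_nonneg _
  have hex : ∫ s in (0 : ℝ)..1, (|g s| - c) ^ 2 = (∫ s in (0 : ℝ)..1, g s ^ 2) - c ^ 2 := by
    have : ∀ s, (|g s| - c) ^ 2 = g s ^ 2 + ((-2 * c) * |g s| + c ^ 2) := fun s => by
      rw [sub_sq, sq_abs]; ring
    simp_rw [this]
    rw [intervalIntegral.integral_add hg ((habs.const_mul _).add intervalIntegrable_const),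
      intervalIntegral.integral_add (habs.const_mul _) intervalIntegrable_const,
      intervalIntegral.integral_const_mul, ← hc]
    simp
    ring
  have : f t ^ 2 ≤ c ^ 2 := by
    rw [← sq_abs]
    exact pow_le_pow_left₀ (abs_nonneg _) hle 2
  linarith

theorem intervalIntegrable_fun_sum {ι : Type*} (s : Finset ι) {f : ι → ℝ → ℝ} {a b : ℝ}
    (h : ∀ i ∈ s, IntervalIntegrable (f i) volume a b) :
    IntervalIntegrable (fun t => ∑ i ∈ s, f i t) volume a b := by
  have := IntervalIntegrable.sum s h
  rwa [show ∑ i ∈ s, f i = fun t => ∑ i ∈ s, f i t from funext fun t => Finset.sum_apply t s f]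
    at this

namespace H1Path4

variable (p : H1Path4)

/-- Twice the relative kinetic energy of a pair, integrated over `[0, 1]`. -/
def kin (i j : Fin 4) : ℝ :=
  ∫ t in (0 : ℝ)..1, (((p.v t i).1 - (p.v t j).1) ^ 2 + ((p.v t i).2 - (p.v t j).2) ^ 2)

/-- The integrated potential of a pair. -/
def pot (i j : Fin 4) : ℝ :=
  ∫ t in (0 : ℝ)..1, (√(((p.q t i).1 - (p.q t j).1) ^ 2 + ((p.q t i).2 - (p.q t j).2) ^ 2))⁻¹

theorem kin_nonneg (i j : Fin 4) : 0 ≤ p.kin i j :=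
  intervalIntegral.integral_nonneg zero_le_one fun _ _ => by positivity

theorem pot_nonneg (i j : Fin 4) : 0 ≤ p.pot i j :=
  intervalIntegral.integral_nonneg zero_le_one fun _ _ => by positivity

theorem kin_comm (i j : Fin 4) : p.kin i j = p.kin j i := by
  unfold kin
  congr 1 with t
  ring

theorem pot_comm (i j : Fin 4) : p.pot i j = p.pot j i := by
  unfold pot
  congr 1 with t
  ring_nf

variable {p}

theorem intervalIntegrable_lag (hp : action p ≠ ∞) : IntervalIntegrable p.lag volume 0 1 := by
  rw [intervalIntegrable_iff_integrableOn_Icc_of_le zero_le_one]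
  exact integrableOn_lag hp

theorem sum_pairs_le (hp : action p ≠ ∞) :
    ∑ i : Fin 4, ∑ j ∈ Finset.univ.filter (fun j => i < j), (p.kin i j / 8 + p.pot i j) ≤
      ∫ t in (0 : ℝ)..1, p.lag t := by
  have hK : ∀ i : Fin 4, ∀ j ∈ Finset.univ.filter (fun j => i < j), IntervalIntegrable (fun t =>
      (((p.v t i).1 - (p.v t j).1) ^ 2 + ((p.v t i).2 - (p.v t j).2) ^ 2) / 8) volume 0 1 :=
    fun i j hj => (planePath hp (by simpa using hj : i < j).ne).hK.div_const 8
  have hS : ∀ i : Fin 4, ∀ j ∈ Finset.univ.filter (fun j => i < j), IntervalIntegrable (fun t =>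
      (√(((p.q t i).1 - (p.q t j).1) ^ 2 + ((p.q t i).2 - (p.q t j).2) ^ 2))⁻¹) volume 0 1 :=
    fun i j hj => (planePath hp (by simpa using hj : i < j).ne).hS
  have e : ∑ i : Fin 4, ∑ j ∈ Finset.univ.filter (fun j => i < j), (p.kin i j / 8 + p.pot i j) =
      ∫ t in (0 : ℝ)..1, ∑ i : Fin 4, ∑ j ∈ Finset.univ.filter (fun j => i < j),
        ((((p.v t i).1 - (p.v t j).1) ^ 2 + ((p.v t i).2 - (p.v t j).2) ^ 2) / 8 +
        (√(((p.q t i).1 - (p.q t j).1) ^ 2 + ((p.q t i).2 - (p.q t j).2) ^ 2))⁻¹) := by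
    rw [intervalIntegral.integral_finsetSum fun i _ => ?_]
    · refine Finset.sum_congr rfl fun i _ => ?_
      rw [intervalIntegral.integral_finsetSum fun j hj => (hK i j hj).add (hS i j hj)]
      refine Finset.sum_congr rfl fun j hj => ?_
      rw [intervalIntegral.integral_add (hK i j hj) (hS i j hj), intervalIntegral.integral_div]
      rfl
    · exact intervalIntegrable_fun_sum _ fun j hj => (hK i j hj).add (hS i j hj)
  rw [e]
  refine intervalIntegral.integral_mono_on zero_le_one ?_ (intervalIntegrable_lag hp) fun t _ => ?_
  · exact intervalIntegrable_fun_sum _ fun i _ =>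
      intervalIntegrable_fun_sum _ fun j hj => (hK i j hj).add (hS i j hj)
  · unfold lag
    simp only [Finset.sum_add_distrib]
    refine add_le_add ?_ le_rfl
    rw [sum_pairs_four, Fin.sum_univ_four]
    simp only [enorm2_sq]
    nlinarith [sq_nonneg ((p.v t 0).1 + (p.v t 1).1 + (p.v t 2).1 + (p.v t 3).1),
      sq_nonneg ((p.v t 0).2 + (p.v t 1).2 + (p.v t 2).2 + (p.v t 3).2)]

theorem isPrim_add_fst (i j : Fin 4) : IsPrim (fun t => (p.q t i).1 + (p.q t j).1)
    (fun t => (p.v t i).1 + (p.v t j).1) 0 1 := by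
  simpa using (p.isPrim_fst i).lin (p.isPrim_fst j) 1 1

theorem isPrim_add_snd (i j : Fin 4) : IsPrim (fun t => (p.q t i).2 + (p.q t j).2)
    (fun t => (p.v t i).2 + (p.v t j).2) 0 1 := by
  simpa using (p.isPrim_snd i).lin (p.isPrim_snd j) 1 1

theorem intervalIntegrable_add_sq (i j : Fin 4) : IntervalIntegrable (fun t =>
    ((p.v t i).1 + (p.v t j).1) ^ 2 + ((p.v t i).2 + (p.v t j).2) ^ 2) volume 0 1 :=
  intervalIntegrable_sq _ _ ((p.memLp_fst i).add (p.memLp_fst j))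
    ((p.memLp_snd i).add (p.memLp_snd j))

theorem binary_pairs_le (hp : action p ≠ ∞) :
    (p.kin 0 1 / 4 + p.pot 0 1) + (p.kin 2 3 / 4 + p.pot 2 3) ≤ ∫ t in (0 : ℝ)..1, p.lag t := by
  have A := planePath hp (show (0 : Fin 4) ≠ 1 by decide)
  have B := planePath hp (show (2 : Fin 4) ≠ 3 by decide)
  unfold kin pot
  rw [← intervalIntegral.integral_div, ← intervalIntegral.integral_div,
    ← intervalIntegral.integral_add (A.hK.div_const 4) A.hS,
    ← intervalIntegral.integral_add (B.hK.div_const 4) B.hS,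
    ← intervalIntegral.integral_add ((A.hK.div_const 4).add A.hS) ((B.hK.div_const 4).add B.hS)]
  refine intervalIntegral.integral_mono_on zero_le_one
    (((A.hK.div_const 4).add A.hS).add ((B.hK.div_const 4).add B.hS))
    (intervalIntegrable_lag hp) fun t _ => ?_
  have h0 := fun i j => inv_nonneg.2 (enorm2_nonneg (p.q t i - p.q t j))
  unfold lag
  rw [sum_pairs_four, Fin.sum_univ_four]
  simp only [enorm2_sq]
  have e1 : (enorm2 (p.q t 0 - p.q t 1))⁻¹ =
      (√(((p.q t 0).1 - (p.q t 1).1) ^ 2 + ((p.q t 0).2 - (p.q t 1).2) ^ 2))⁻¹ := rfl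
  have e2 : (enorm2 (p.q t 2 - p.q t 3))⁻¹ =
      (√(((p.q t 2).1 - (p.q t 3).1) ^ 2 + ((p.q t 2).2 - (p.q t 3).2) ^ 2))⁻¹ := rfl
  rw [← e1, ← e2]
  nlinarith [h0 0 2, h0 0 3, h0 1 2, h0 1 3, sq_nonneg ((p.v t 0).1 + (p.v t 1).1),
    sq_nonneg ((p.v t 0).2 + (p.v t 1).2), sq_nonneg ((p.v t 2).1 + (p.v t 3).1),
    sq_nonneg ((p.v t 2).2 + (p.v t 3).2)]

end H1Path4

namespace H1Path4

variable {p : H1Path4} {θ : ℝ}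

theorem kin_pot_of_collision (hp : action p ≠ ∞) {i j : Fin 4} (hij : i ≠ j) {τ : ℝ}
    (hτ : τ ∈ Icc (0 : ℝ) 1) (h : p.q τ i = p.q τ j) : π ^ 2 ≤ p.kin i j * p.pot i j ^ 2 :=
  (planePath hp hij).bound_of_zero hτ (by simp [h]) (by simp [h])

theorem kin_pot_zero_one (hp : action p ≠ ∞) (hadm : inAdm (QE2set θ) p) (hθ : 0 < θ)
    (hθ' : θ < π / 2) : (π / 2 + θ) ^ 2 ≤ p.kin 0 1 * p.pot 0 1 ^ 2 := by
  obtain ⟨-, ⟨a₁, b₁, c₁, hb₁, hc₁, h0⟩, ⟨a₂, b₂, c₂, hb₂, hc₂, h1⟩⟩ := hadm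
  rw [kin_comm, pot_comm]
  refine (planePath hp (show (1 : Fin 4) ≠ 0 by decide)).bound_of_rays (α := 0) (A := c₁)
    (B := 2 * b₂) (by positivity) (by linarith) hc₁ (by positivity) ?_ ?_ ?_ ?_
  · simp [h0]
  · simp [h0]
  · simp [h1, rotV, Real.cos_add]; ring
  · simp [h1, rotV, Real.sin_add]; ring

theorem kin_pot_two_three (hp : action p ≠ ∞) (hadm : inAdm (QE2set θ) p) (hθ : 0 < θ)
    (hθ' : θ < π / 2) : θ ^ 2 ≤ p.kin 2 3 * p.pot 2 3 ^ 2 := by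
  obtain ⟨-, ⟨a₁, b₁, c₁, hb₁, hc₁, h0⟩, ⟨a₂, b₂, c₂, hb₂, hc₂, h1⟩⟩ := hadm
  refine (planePath hp (show (2 : Fin 4) ≠ 3 by decide)).bound_of_rays (α := π / 2) (A := 2 * b₁)
    (B := 2 * c₂) hθ (by linarith) (by positivity) (by positivity) ?_ ?_ ?_ ?_
  · simp [h0]
  · simp [h0]; ring
  · simp [h1, rotV, Real.cos_add]; ring
  · simp [h1, rotV, Real.sin_add]; ring

theorem wirtinger_two_three (hp : action p ≠ ∞) (hadm : inAdm (QE2set θ) p) (hθ : 0 < θ)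
    (hθ' : θ < π / 2) : θ ^ 2 * (∫ t in (0 : ℝ)..1,
      (((p.q t 2).1 - (p.q t 3).1) ^ 2 + ((p.q t 2).2 - (p.q t 3).2) ^ 2)) ≤ p.kin 2 3 := by
  obtain ⟨-, ⟨a₁, b₁, c₁, hb₁, hc₁, h0⟩, ⟨a₂, b₂, c₂, hb₂, hc₂, h1⟩⟩ := hadm
  have P := planePath hp (show (2 : Fin 4) ≠ 3 by decide)
  refine wirtinger_lines (α := π / 2) (A := 2 * b₁) (B := 2 * c₂) P.hx P.hy P.hK hθ hθ' ?_ ?_ ?_ ?_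
  · simp [h0]
  · simp [h0]; ring
  · simp [h1, rotV, Real.cos_add]; ring
  · simp [h1, rotV, Real.sin_add]; ring

theorem wirtinger_add (hadm : inAdm (QE2set θ) p) (hθ : 0 < θ) (hθ' : θ < π / 2) :
    θ ^ 2 * (∫ t in (0 : ℝ)..1,
      (((p.q t 0).1 + (p.q t 1).1) ^ 2 + ((p.q t 0).2 + (p.q t 1).2) ^ 2)) ≤
    ∫ t in (0 : ℝ)..1,
      (((p.v t 0).1 + (p.v t 1).1) ^ 2 + ((p.v t 0).2 + (p.v t 1).2) ^ 2) := by
  obtain ⟨-, ⟨a₁, b₁, c₁, hb₁, hc₁, h0⟩, ⟨a₂, b₂, c₂, hb₂, hc₂, h1⟩⟩ := hadm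
  refine wirtinger_lines (α := 0) (A := -2 * a₁ - c₁) (B := -2 * a₂) (isPrim_add_fst 0 1)
    (isPrim_add_snd 0 1) (intervalIntegrable_add_sq 0 1) hθ hθ' ?_ ?_ ?_ ?_
  · simp [h0]; ring
  · simp [h0]
  · simp [h1, rotV]; ring
  · simp [h1, rotV]; ring

theorem wirtinger_add' (hadm : inAdm (QE2set θ) p) (hθ : 0 < θ) (hθ' : θ < π / 2) :
    θ ^ 2 * (∫ t in (0 : ℝ)..1,
      (((p.q t 2).1 + (p.q t 3).1) ^ 2 + ((p.q t 2).2 + (p.q t 3).2) ^ 2)) ≤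
    ∫ t in (0 : ℝ)..1,
      (((p.v t 2).1 + (p.v t 3).1) ^ 2 + ((p.v t 2).2 + (p.v t 3).2) ^ 2) := by
  obtain ⟨-, ⟨a₁, b₁, c₁, hb₁, hc₁, h0⟩, ⟨a₂, b₂, c₂, hb₂, hc₂, h1⟩⟩ := hadm
  refine wirtinger_lines (α := 0) (A := 2 * a₁ + c₁) (B := 2 * a₂) (isPrim_add_fst 2 3)
    (isPrim_add_snd 2 3) (intervalIntegrable_add_sq 2 3) hθ hθ' ?_ ?_ ?_ ?_
  · simp [h0]
  · simp [h0]
  · simp [h1, rotV]; ring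
  · simp [h1, rotV]; ring

theorem integral_dist_sq_le_kin (hp : action p ≠ ∞) {i j : Fin 4} (hij : i ≠ j) {τ : ℝ}
    (hτ : τ ∈ Icc (0 : ℝ) 1) (h : p.q τ i = p.q τ j) :
    ∫ t in (0 : ℝ)..1, (((p.q t i).1 - (p.q t j).1) ^ 2 + ((p.q t i).2 - (p.q t j).2) ^ 2) ≤
      p.kin i j := by
  have P := planePath hp hij
  have hm1 := (intervalIntegrable_iff_integrableOn_Icc_of_le (μ := volume) zero_le_one).2
    ((p.memLp_fst i).sub (p.memLp_fst j)).integrable_sq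
  have hm2 := (intervalIntegrable_iff_integrableOn_Icc_of_le (μ := volume) zero_le_one).2
    ((p.memLp_snd i).sub (p.memLp_snd j)).integrable_sq
  have hk : p.kin i j = (∫ t in (0 : ℝ)..1, ((p.v t i).1 - (p.v t j).1) ^ 2) +
      ∫ t in (0 : ℝ)..1, ((p.v t i).2 - (p.v t j).2) ^ 2 :=
    intervalIntegral.integral_add hm1 hm2
  have hc1 := P.hx.continuousOn zero_le_one
  have hc2 := P.hy.continuousOn zero_le_one
  have hInt : IntervalIntegrable (fun t => ((p.q t i).1 - (p.q t j).1) ^ 2 +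
      ((p.q t i).2 - (p.q t j).2) ^ 2) volume 0 1 :=
    ContinuousOn.intervalIntegrable_of_Icc zero_le_one ((hc1.pow 2).add (hc2.pow 2))
  have : ∫ t in (0 : ℝ)..1, (((p.q t i).1 - (p.q t j).1) ^ 2 + ((p.q t i).2 - (p.q t j).2) ^ 2) ≤
      ∫ _t in (0 : ℝ)..1, p.kin i j := by
    refine intervalIntegral.integral_mono_on zero_le_one hInt intervalIntegrable_const fun t ht => ?_
    rw [hk]
    exact add_le_add (P.hx.sq_le_of_zero hm1 hτ (by simp [h]) ht)
      (P.hy.sq_le_of_zero hm2 hτ (by simp [h]) ht)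
  simpa using this

theorem cross_potential_ge {m : ℝ} (hm0 : 0 < m) (hm : m ^ 3 * θ ^ 2 = 4) {t : ℝ}
    (hχ : ∑ i, p.q t i = 0) (hne : ∀ i j : Fin 4, i < j → p.q t i ≠ p.q t j) :
    6 / m - θ ^ 2 / 8 *
      (2 * (((p.q t 0).1 + (p.q t 1).1) ^ 2 + ((p.q t 0).2 + (p.q t 1).2) ^ 2) +
      2 * (((p.q t 2).1 + (p.q t 3).1) ^ 2 + ((p.q t 2).2 + (p.q t 3).2) ^ 2) +
      (((p.q t 2).1 - (p.q t 3).1) ^ 2 + ((p.q t 2).2 - (p.q t 3).2) ^ 2) +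
      (((p.q t 0).1 - (p.q t 1).1) ^ 2 + ((p.q t 0).2 - (p.q t 1).2) ^ 2)) ≤
    (enorm2 (p.q t 0 - p.q t 2))⁻¹ + (enorm2 (p.q t 0 - p.q t 3))⁻¹ +
      ((enorm2 (p.q t 1 - p.q t 2))⁻¹ + (enorm2 (p.q t 1 - p.q t 3))⁻¹) := by
  have key : ∀ i j : Fin 4, i < j → 3 / (2 * m) - θ ^ 2 / 8 *
      (((p.q t i).1 - (p.q t j).1) ^ 2 + ((p.q t i).2 - (p.q t j).2) ^ 2) ≤
      (enorm2 (p.q t i - p.q t j))⁻¹ := fun i j hij => by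
    have := inv_ge_quadratic (enorm2_pos.2 (sub_ne_zero.2 (hne i j hij))) hm0
    refine le_trans (le_of_eq ?_) this
    have hθ2 : θ ^ 2 = 4 / m ^ 3 := by
      rw [eq_div_iff (by positivity)]
      linarith
    rw [enorm2_sq, hθ2, Prod.fst_sub, Prod.snd_sub]
    field_simp
    ring
  have h1 : (p.q t 0).1 + (p.q t 1).1 + (p.q t 2).1 + (p.q t 3).1 = 0 := by
    have := congrArg Prod.fst hχ
    rw [Fin.sum_univ_four] at this
    exact this
  have h2 : (p.q t 0).2 + (p.q t 1).2 + (p.q t 2).2 + (p.q t 3).2 = 0 := by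
    have := congrArg Prod.snd hχ
    rw [Fin.sum_univ_four] at this
    exact this
  have e1 : (p.q t 3).1 = -((p.q t 0).1 + (p.q t 1).1 + (p.q t 2).1) := by linarith
  have e2 : (p.q t 3).2 = -((p.q t 0).2 + (p.q t 1).2 + (p.q t 2).2) := by linarith
  have k := add_le_add (add_le_add (key 0 2 (by decide)) (key 0 3 (by decide)))
    (add_le_add (key 1 2 (by decide)) (key 1 3 (by decide)))
  refine le_trans (le_of_eq ?_) k
  rw [e1, e2]
  ring

theorem action_ge_of_collision_zero_one (hp : action p ≠ ∞) (hadm : inAdm (QE2set θ) p)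
    (hθ : 0 < θ) (hθ' : θ < π / 2) {m : ℝ} (hm0 : 0 < m) (hm : m ^ 3 * θ ^ 2 = 4) {τ : ℝ}
    (hτ : τ ∈ Icc (0 : ℝ) 1) (h : p.q τ 0 = p.q τ 1) :
    (1 - θ ^ 2 / 2) * (p.kin 0 1 / 4 + p.pot 0 1) + 6 / m ≤ ∫ t in (0 : ℝ)..1, p.lag t := by
  have A := planePath hp (show (0 : Fin 4) ≠ 1 by decide)
  have B := planePath hp (show (2 : Fin 4) ≠ 3 by decide)
  have iE := p.intervalIntegrable_add_sq 0 1
  have iF := p.intervalIntegrable_add_sq 2 3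
  have cont : ∀ {f g f' g' : ℝ → ℝ}, IsPrim f f' 0 1 → IsPrim g g' 0 1 →
      IntervalIntegrable (fun t => f t ^ 2 + g t ^ 2) volume 0 1 := fun hf hg =>
    ContinuousOn.intervalIntegrable_of_Icc zero_le_one
      (((hf.continuousOn zero_le_one).pow 2).add ((hg.continuousOn zero_le_one).pow 2))
  have jA := cont A.hx A.hy
  have jB := cont B.hx B.hy
  have jE := cont (p.isPrim_add_fst 0 1) (p.isPrim_add_snd 0 1)
  have jF := cont (p.isPrim_add_fst 2 3) (p.isPrim_add_snd 2 3)
  have jC : IntervalIntegrable (fun _ : ℝ => 6 / m) volume 0 1 := intervalIntegrable_const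
  have i1 := (A.hK.div_const 4).add A.hS
  have i2 := (B.hK.div_const 4).sub (jB.const_mul (θ ^ 2 / 8))
  have i3 := (iE.div_const 4).sub (jE.const_mul (θ ^ 2 / 4))
  have i4 := (iF.div_const 4).sub (jF.const_mul (θ ^ 2 / 4))
  have i5 := jC.sub (jA.const_mul (θ ^ 2 / 8))
  have hInt := (i1.add (i2.add (i3.add (i4.add i5))))
  have hle := intervalIntegral.integral_mono_ae_restrict zero_le_one hInt
    (intervalIntegrable_lag hp) ?_
  · rw [intervalIntegral.integral_add i1 (i2.add (i3.add (i4.add i5))),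
      intervalIntegral.integral_add i2 (i3.add (i4.add i5)),
      intervalIntegral.integral_add i3 (i4.add i5), intervalIntegral.integral_add i4 i5,
      intervalIntegral.integral_add (A.hK.div_const 4) A.hS,
      intervalIntegral.integral_sub (B.hK.div_const 4) (jB.const_mul (θ ^ 2 / 8)),
      intervalIntegral.integral_sub (iE.div_const 4) (jE.const_mul (θ ^ 2 / 4)),
      intervalIntegral.integral_sub (iF.div_const 4) (jF.const_mul (θ ^ 2 / 4)),
      intervalIntegral.integral_sub jC (jA.const_mul (θ ^ 2 / 8))] at hle
    simp only [intervalIntegral.integral_const_mul, intervalIntegral.integral_div,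
      intervalIntegral.integral_const, sub_zero, one_smul] at hle
    have w1 := wirtinger_two_three hp hadm hθ hθ'
    have w2 := wirtinger_add hadm hθ hθ'
    have w3 := wirtinger_add' hadm hθ hθ'
    have w4 := integral_dist_sq_le_kin hp (show (0 : Fin 4) ≠ 1 by decide) hτ h
    have w5 := mul_le_mul_of_nonneg_left w4 (sq_nonneg θ)
    have w6 := mul_nonneg (sq_nonneg θ) (p.pot_nonneg 0 1)
    have w7 := p.kin_nonneg 2 3
    change p.kin 0 1 / 4 + p.pot 0 1 + (p.kin 2 3 / 4 - _ + _) ≤ _ at hle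
    linarith
  · filter_upwards [ae_ne hp, ae_restrict_mem measurableSet_Icc] with t ht htI
    have hc := cross_potential_ge hm0 hm (hadm.1 t htI) ht
    have h0 := fun i j => inv_nonneg.2 (enorm2_nonneg (p.q t i - p.q t j))
    show _ ≤ p.lag t
    unfold lag
    rw [sum_pairs_four, Fin.sum_univ_four]
    simp only [enorm2_sq]
    have e1 : (√(((p.q t 0).1 - (p.q t 1).1) ^ 2 + ((p.q t 0).2 - (p.q t 1).2) ^ 2))⁻¹ =
      (enorm2 (p.q t 0 - p.q t 1))⁻¹ := rfl
    rw [e1]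
    linarith [h0 2 3]

end H1Path4

/-- A continuously differentiable path, as an element of `H1Path4`. -/
def H1Path4.ofC1 (q v : ℝ → Fin 4 → ℝ × ℝ) (hq : ∀ i t, HasDerivAt (fun s => q s i) (v t i) t)
    (hv : ∀ i, Continuous fun t => v t i) : H1Path4 where
  q := q
  v := v
  hvInt i := (hv i).continuousOn.integrableOn_compact isCompact_Icc
  hrep i t _ := by
    rw [intervalIntegral.integral_eq_sub_of_hasDerivAt (fun s _ => hq i s)
      ((hv i).intervalIntegrable _ _)]
    abel
  hL2 i := ((continuous_enorm2.comp (hv i)).pow 2).continuousOn.integrableOn_compact isCompact_Icc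

/-- Two binaries rotating uniformly about the origin, with radii `a`, `b` and angular
velocities `ω`, `θ`. -/
def twoBinaries (a b ω θ : ℝ) : H1Path4 :=
  H1Path4.ofC1
    (fun t => ![(-(a * Real.cos (ω * t)), -(a * Real.sin (ω * t))),
      (a * Real.cos (ω * t), a * Real.sin (ω * t)),
      (-(b * Real.sin (θ * t)), b * Real.cos (θ * t)),
      (b * Real.sin (θ * t), -(b * Real.cos (θ * t)))])
    (fun t => ![(a * (Real.sin (ω * t) * ω), -(a * (Real.cos (ω * t) * ω))),
      (-(a * (Real.sin (ω * t) * ω)), a * (Real.cos (ω * t) * ω)),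
      (-(b * (Real.cos (θ * t) * θ)), -(b * (Real.sin (θ * t) * θ))),
      (b * (Real.cos (θ * t) * θ), b * (Real.sin (θ * t) * θ))])
    (by
      intro i t
      have l : ∀ k : ℝ, HasDerivAt (fun s => k * s) k t := fun k => by
        simpa using (hasDerivAt_id t).const_mul k
      have c1 := ((l ω).cos).const_mul a
      have s1 := ((l ω).sin).const_mul a
      have c2 := ((l θ).cos).const_mul b
      have s2 := ((l θ).sin).const_mul b
      fin_cases i
      · simpa using c1.neg.prodMk s1.neg
      · simpa using c1.prodMk s1
      · simpa using s2.neg.prodMk c2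
      · simpa using s2.prodMk c2.neg)
    (by
      intro i
      fin_cases i <;> exact Continuous.prodMk (by fun_prop) (by fun_prop))

theorem twoBinaries_inAdm {a b θ : ℝ} (ha : 0 ≤ a) (hb : 0 ≤ b) :
    inAdm (QE2set θ) (twoBinaries a b (π / 2 + θ) θ) := by
  refine ⟨fun t _ => ?_, ⟨-a, b, 2 * a, hb, by positivity, ?_⟩, ⟨0, a, b, ha, hb, ?_⟩⟩
  · rw [Fin.sum_univ_four]
    simp [twoBinaries, H1Path4.ofC1]
  · funext i
    fin_cases i <;> (simp [twoBinaries, H1Path4.ofC1]; try ring)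
  · have hc : Real.cos (π / 2 + θ) = -Real.sin θ := by rw [add_comm, Real.cos_add_pi_div_two]
    have hs : Real.sin (π / 2 + θ) = Real.cos θ := by rw [add_comm, Real.sin_add_pi_div_two]
    funext i
    fin_cases i <;> simp [twoBinaries, H1Path4.ofC1, rotV, hc, hs]

theorem inv_le_chord {s P Q : ℝ} (hP : 0 < P) (hs : P ≤ s) (hQ : s ≤ Q) :
    s⁻¹ ≤ (P ^ 2 + P * Q + Q ^ 2 - s ^ 2) / (P * Q * (P + Q)) := by
  have hs0 : 0 < s := by linarith
  have hQ0 : 0 < Q := by linarith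
  have e : (P ^ 2 + P * Q + Q ^ 2 - s ^ 2) / (P * Q * (P + Q)) - s⁻¹ =
      (s - P) * (Q - s) * (s + P + Q) / (P * Q * (P + Q) * s) := by
    field_simp
    ring
  have h1 : 0 ≤ s - P := by linarith
  have h2 : 0 ≤ Q - s := by linarith
  have : 0 ≤ (s - P) * (Q - s) * (s + P + Q) / (P * Q * (P + Q) * s) := by positivity
  linarith

theorem inv_sqrt_add_inv_sqrt_le {a b y : ℝ} (ha : 0 < a) (hab : a < b) (hy : |y| ≤ 2 * a * b) :
    (√(a ^ 2 + b ^ 2 - y))⁻¹ + (√(a ^ 2 + b ^ 2 + y))⁻¹ ≤ 2 * b / (b ^ 2 - a ^ 2) := by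
  obtain ⟨h1, h2⟩ := abs_le.1 hy
  have hP : 0 < b - a := by linarith
  have key : ∀ x, |x| ≤ 2 * a * b → b - a ≤ √(a ^ 2 + b ^ 2 + x) ∧ √(a ^ 2 + b ^ 2 + x) ≤ b + a ∧
      √(a ^ 2 + b ^ 2 + x) ^ 2 = a ^ 2 + b ^ 2 + x := fun x hx => by
    obtain ⟨h1, h2⟩ := abs_le.1 hx
    refine ⟨Real.le_sqrt_of_sq_le (by nlinarith), ?_, Real.sq_sqrt (by nlinarith)⟩
    rw [Real.sqrt_le_left (by linarith)]
    nlinarith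
  obtain ⟨m1, m2, m3⟩ := key (-y) (by rwa [abs_neg])
  obtain ⟨n1, n2, n3⟩ := key y hy
  have e1 := inv_le_chord hP m1 m2
  have e2 := inv_le_chord hP n1 n2
  rw [m3] at e1
  rw [n3] at e2
  rw [← sub_eq_add_neg] at e1
  refine (add_le_add e1 e2).trans (le_of_eq ?_)
  have : b ^ 2 - a ^ 2 = (b - a) * (b + a) := by ring
  rw [this]
  have h3 : b + a ≠ 0 := by linarith
  have h4 : b - a + (b + a) ≠ 0 := by linarith
  field_simp
  ring

theorem action_twoBinaries_le {a b ω θ : ℝ} (ha : 0 < a) (hab : a < b) :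
    action (twoBinaries a b ω θ) ≤ ENNReal.ofReal (a ^ 2 * ω ^ 2 + b ^ 2 * θ ^ 2 + 1 / (2 * a) +
      1 / (2 * b) + 4 * b / (b ^ 2 - a ^ 2)) := by
  have hb : 0 < b := ha.trans hab
  set p := twoBinaries a b ω θ with hpdef
  have hd : ∀ t, ∃ y, |y| ≤ 2 * a * b ∧
      enorm2 (p.q t 0 - p.q t 1) = 2 * a ∧ enorm2 (p.q t 2 - p.q t 3) = 2 * b ∧
      enorm2 (p.q t 0 - p.q t 2) = √(a ^ 2 + b ^ 2 - y) ∧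
      enorm2 (p.q t 0 - p.q t 3) = √(a ^ 2 + b ^ 2 + y) ∧
      enorm2 (p.q t 1 - p.q t 2) = √(a ^ 2 + b ^ 2 + y) ∧
      enorm2 (p.q t 1 - p.q t 3) = √(a ^ 2 + b ^ 2 - y) ∧
      ∑ i, enorm2 (p.v t i) ^ 2 = 2 * (a ^ 2 * ω ^ 2 + b ^ 2 * θ ^ 2) := fun t => by
    have h1 := Real.sin_sq_add_cos_sq (ω * t)
    have h2 := Real.sin_sq_add_cos_sq (θ * t)
    refine ⟨2 * a * b * (Real.cos (ω * t) * Real.sin (θ * t) -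
      Real.sin (ω * t) * Real.cos (θ * t)), ?_, ?_, ?_, ?_, ?_, ?_, ?_, ?_⟩
    · rw [← neg_sub (Real.sin _ * _), mul_comm (Real.cos (ω * t)), mul_comm (Real.sin (ω * t)),
        mul_comm (Real.cos (θ * t)), mul_comm (Real.sin (θ * t)), ← Real.sin_sub, abs_mul, abs_neg,
        abs_of_pos (by positivity : 0 < 2 * a * b)]
      have := Real.abs_sin_le_one (ω * t - θ * t)
      have : 0 < 2 * a * b := by positivity
      nlinarith
    · rw [enorm2, Real.sqrt_eq_iff_mul_self_eq_of_pos (by positivity)]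
      simp [hpdef, twoBinaries, H1Path4.ofC1]
      linear_combination (-4 * a ^ 2) * h1
    · rw [enorm2, Real.sqrt_eq_iff_mul_self_eq_of_pos (by positivity)]
      simp [hpdef, twoBinaries, H1Path4.ofC1]
      linear_combination (-4 * b ^ 2) * h2
    all_goals try
      rw [enorm2]
      congr 1
      simp [hpdef, twoBinaries, H1Path4.ofC1]
      linear_combination a ^ 2 * h1 + b ^ 2 * h2
    · rw [Fin.sum_univ_four]
      simp only [enorm2_sq]
      simp [hpdef, twoBinaries, H1Path4.ofC1]
      linear_combination (2 * a ^ 2 * ω ^ 2) * h1 + 2 * b ^ 2 * θ ^ 2 * h2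
  have hpw : ∀ t, ENNReal.ofReal ((1/2) * ∑ i, enorm2 (p.v t i) ^ 2)
      + ∑ i : Fin 4, ∑ j ∈ Finset.univ.filter (fun j => i < j),
          (ENNReal.ofReal (enorm2 (p.q t i - p.q t j)))⁻¹ ≤
      ENNReal.ofReal (a ^ 2 * ω ^ 2 + b ^ 2 * θ ^ 2 + 1 / (2 * a) +
      1 / (2 * b) + 4 * b / (b ^ 2 - a ^ 2)) := fun t => by
    obtain ⟨y, hy, d1, d2, d3, d4, d5, d6, d7⟩ := hd t
    have hp1 : 0 < √(a ^ 2 + b ^ 2 - y) := Real.sqrt_pos.2 (by nlinarith [(abs_le.1 hy).2])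
    have hp2 : 0 < √(a ^ 2 + b ^ 2 + y) := Real.sqrt_pos.2 (by nlinarith [(abs_le.1 hy).1])
    rw [p.ofReal_lag]
    · refine ENNReal.ofReal_le_ofReal ?_
      unfold H1Path4.lag
      rw [sum_pairs_four, d1, d2, d3, d4, d5, d6, d7]
      have := inv_sqrt_add_inv_sqrt_le ha hab hy
      have e : 4 * b / (b ^ 2 - a ^ 2) = 2 * (2 * b / (b ^ 2 - a ^ 2)) := by ring
      rw [e, one_div (2 * a), one_div (2 * b)]
      linarith
    · intro i j hij
      rw [← sub_ne_zero, ← enorm2_pos]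
      fin_cases i <;> fin_cases j <;> first | exact absurd hij (by decide) | skip
      · exact d1.symm ▸ (by positivity)
      · exact d3.symm ▸ hp1
      · exact d4.symm ▸ hp2
      · exact d5.symm ▸ hp2
      · exact d6.symm ▸ hp1
      · exact d2.symm ▸ (by positivity)
  calc action p ≤ ∫⁻ _t in Icc (0 : ℝ) 1, ENNReal.ofReal (a ^ 2 * ω ^ 2 + b ^ 2 * θ ^ 2 +
      1 / (2 * a) + 1 / (2 * b) + 4 * b / (b ^ 2 - a ^ 2)) := lintegral_mono hpw
    _ = _ := by simp

theorem exists_cube_root {a : ℝ} (ha : 0 < a) : ∃ x : ℝ, 0 < x ∧ x ^ 3 = a := by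
  refine ⟨a ^ ((1 : ℝ) / 3), Real.rpow_pos_of_pos ha _, ?_⟩
  rw [← Real.rpow_natCast, ← Real.rpow_mul ha.le]
  norm_num

theorem one_div_scaled {κ w ω : ℝ} (hκ : 0 < κ) (hκ3 : κ ^ 3 = 2) (hw : 0 < w) (hω : w ^ 3 = ω) :
    (1 / (κ ^ 2 * w ^ 2)) ^ 2 * ω ^ 2 + 1 / (2 * (1 / (κ ^ 2 * w ^ 2))) =
      3 / 4 * κ ^ 2 * w ^ 2 := by
  have h4 : κ ^ 4 = 2 * κ := by linear_combination κ * hκ3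
  subst hω
  field_simp
  linear_combination (-2 * κ ^ 3 - 4) * hκ3

/-- An explicit upper bound for the infimum of the action. -/
theorem action_upper_bound {θ κ s w : ℝ} (hκ : 0 < κ) (hκ3 : κ ^ 3 = 2) (hs : 0 < s)
    (hsθ : s ^ 3 = θ) (hw : 0 < w) (hwω : w ^ 3 = π / 2 + θ) (hκ1 : 1.2599 ≤ κ)
    (hw1 : 1.35 ≤ w ^ 2) (hs1 : s ^ 2 ≤ 0.3518) :
    ∃ p : H1Path4, inAdm (QE2set θ) p ∧
      action p ≤ ENNReal.ofReal (3 / 4 * κ ^ 2 * w ^ 2 + 5.1513 * s ^ 2 + 0.0175) := by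
  have ha0 : 0 < 1 / (κ ^ 2 * w ^ 2) := by positivity
  have hb0 : 0 < 1.31 / s ^ 2 := by positivity
  have ha1 : 1 / (κ ^ 2 * w ^ 2) ≤ 0.4668 := by
    rw [div_le_iff₀ (by positivity)]
    have : 1.2599 ^ 2 * 1.35 ≤ κ ^ 2 * w ^ 2 := by gcongr
    norm_num at this ⊢
    linarith
  have hb1 : 3.723 ≤ 1.31 / s ^ 2 := by
    rw [le_div_iff₀ (by positivity)]
    norm_num at hs1 ⊢
    linarith
  have e1 := one_div_scaled hκ hκ3 hw hwω
  have e2 : (1.31 / s ^ 2) ^ 2 * θ ^ 2 + 9 / (2 * (1.31 / s ^ 2)) ≤ 5.1513 * s ^ 2 := by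
    have : (1.31 / s ^ 2) ^ 2 * θ ^ 2 + 9 / (2 * (1.31 / s ^ 2)) =
        (1.31 ^ 2 + 9 / 2.62) * s ^ 2 := by
      rw [← hsθ]
      field_simp
      norm_num
    rw [this]
    have : (1.31 ^ 2 + 9 / 2.62 : ℝ) ≤ 5.1513 := by norm_num
    gcongr
  refine ⟨_, twoBinaries_inAdm ha0.le hb0.le, ?_⟩
  generalize 1 / (κ ^ 2 * w ^ 2) = a at ha0 ha1 e1 ⊢
  generalize 1.31 / s ^ 2 = b at hb0 hb1 e2 ⊢
  have hab : a < b := by norm_num at ha1 hb1; linarith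
  refine (action_twoBinaries_le ha0 hab).trans (ENNReal.ofReal_le_ofReal ?_)
  have hba : 0 < b ^ 2 - a ^ 2 := by nlinarith
  have e3 : 4 * b / (b ^ 2 - a ^ 2) = 4 / b + 4 * a ^ 2 / (b * (b ^ 2 - a ^ 2)) := by
    field_simp
    ring
  have e4 : 4 * a ^ 2 / (b * (b ^ 2 - a ^ 2)) ≤ 0.0175 := by
    have h1 : (13.64 : ℝ) ≤ b ^ 2 - a ^ 2 := by
      have : b ^ 2 ≥ 3.723 ^ 2 := by gcongr
      have : a ^ 2 ≤ 0.4668 ^ 2 := by gcongr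
      norm_num at *
      linarith
    have h2 : (3.723 * 13.64 : ℝ) ≤ b * (b ^ 2 - a ^ 2) := by gcongr
    rw [div_le_iff₀ (by positivity)]
    have : a ^ 2 ≤ 0.4668 ^ 2 := by gcongr
    norm_num at *
    linarith
  have e5 : 9 / (2 * b) = 1 / (2 * b) + 4 / b := by field_simp; norm_num
  rw [e3]
  linarith

namespace H1Path4

variable {p : H1Path4} {θ κ s w z : ℝ}

theorem bound_of_cross_collision (hp : action p ≠ ∞) (hadm : inAdm (QE2set θ) p) (hθ : 0 < θ)
    (hθ' : θ < π / 2) (hκ : 0 < κ) (hκ3 : κ ^ 3 = 2) (hs : 0 < s) (hsθ : s ^ 3 = θ) (hw : 0 < w)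
    (hwω : w ^ 3 = π / 2 + θ) (hz : 0 < z) (hzπ : z ^ 3 = π) {i j : Fin 4} {τ : ℝ}
    (hτ : τ ∈ Icc (0 : ℝ) 1) (hi : i = 0 ∨ i = 1) (hj : j = 2 ∨ j = 3) (h : p.q τ i = p.q τ j) :
    3 / 4 * κ * (z ^ 2 + w ^ 2 + s ^ 2) ≤ ∫ t in (0 : ℝ)..1, p.lag t := by
  have hij : i ≠ j := by rcases hi with rfl | rfl <;> rcases hj with rfl | rfl <;> decide
  have S := sum_pairs_le hp
  rw [sum_pairs_four] at S
  have h1 := eighth_bound (p.pot_nonneg i j) hκ hκ3 hz (hzπ.symm ▸ kin_pot_of_collision hp hij hτ h)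
  have h2 := eighth_bound (p.pot_nonneg 0 1) hκ hκ3 hw
    (hwω.symm ▸ kin_pot_zero_one hp hadm hθ hθ')
  have h3 := eighth_bound (p.pot_nonneg 2 3) hκ hκ3 hs
    (hsθ.symm ▸ kin_pot_two_three hp hadm hθ hθ')
  have k := p.kin_nonneg
  have l := p.pot_nonneg
  rcases hi with rfl | rfl <;> rcases hj with rfl | rfl <;>
    linarith [k 0 2, k 0 3, k 1 2, k 1 3, l 0 2, l 0 3, l 1 2, l 1 3]

theorem bound_of_outer_collision (hp : action p ≠ ∞) (hadm : inAdm (QE2set θ) p) (hθ : 0 < θ)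
    (hθ' : θ < π / 2) (hκ : 0 < κ) (hκ3 : κ ^ 3 = 2) (hw : 0 < w)
    (hwω : w ^ 3 = π / 2 + θ) (hz : 0 < z) (hzπ : z ^ 3 = π) {τ : ℝ}
    (hτ : τ ∈ Icc (0 : ℝ) 1) (h : p.q τ 2 = p.q τ 3) :
    3 / 4 * κ ^ 2 * (z ^ 2 + w ^ 2) ≤ ∫ t in (0 : ℝ)..1, p.lag t := by
  have S := binary_pairs_le hp
  have h1 := quarter_bound (p.pot_nonneg 2 3) hκ hκ3 hz
    (hzπ.symm ▸ kin_pot_of_collision hp (by decide) hτ h)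
  have h2 := quarter_bound (p.pot_nonneg 0 1) hκ hκ3 hw
    (hwω.symm ▸ kin_pot_zero_one hp hadm hθ hθ')
  linarith

theorem bound_of_inner_collision (hp : action p ≠ ∞) (hadm : inAdm (QE2set θ) p) (hθ : 0 < θ)
    (hθ' : θ < π / 2) (hθ1 : θ ≤ 1) (hκ : 0 < κ) (hκ3 : κ ^ 3 = 2) (hs : 0 < s) (hsθ : s ^ 3 = θ)
    (hz : 0 < z) (hzπ : z ^ 3 = π) {τ : ℝ}
    (hτ : τ ∈ Icc (0 : ℝ) 1) (h : p.q τ 0 = p.q τ 1) :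
    (1 - θ ^ 2 / 2) * (3 / 4 * κ ^ 2 * z ^ 2) + 3 * κ * s ^ 2 ≤ ∫ t in (0 : ℝ)..1, p.lag t := by
  have h1 := quarter_bound (p.pot_nonneg 0 1) hκ hκ3 hz
    (hzπ.symm ▸ kin_pot_of_collision hp (by decide) hτ h)
  have hm : (κ ^ 2 / s ^ 2) ^ 3 * θ ^ 2 = 4 := by
    rw [← hsθ]
    field_simp
    linear_combination (κ ^ 3 + 2) * hκ3
  have S := action_ge_of_collision_zero_one hp hadm hθ hθ' (m := κ ^ 2 / s ^ 2) (by positivity) hm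
    hτ h
  have e : 6 / (κ ^ 2 / s ^ 2) = 3 * κ * s ^ 2 := by
    field_simp
    linear_combination (-3) * hκ3
  have h2 := mul_le_mul_of_nonneg_left h1 (by nlinarith : 0 ≤ 1 - θ ^ 2 / 2)
  linarith

theorem action_ne_top_and_collisionFree (hθ0 : 0 < θ) (hθ1 : θ ≤ 0.0664 * π)
    (hp : isMin (QE2set θ) p) :
    action p ≠ ∞ ∧ ∀ t ∈ Icc (0 : ℝ) 1, ∀ i j : Fin 4, i ≠ j → p.q t i ≠ p.q t j := by
  obtain ⟨κ, hκ, hκ3⟩ := exists_cube_root (show (0 : ℝ) < 2 by norm_num)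
  obtain ⟨s, hs, hsθ⟩ := exists_cube_root hθ0
  obtain ⟨w, hw, hwω⟩ := exists_cube_root (show 0 < π / 2 + θ by positivity)
  obtain ⟨z, hz, hzπ⟩ := exists_cube_root Real.pi_pos
  have hπ1 := Real.pi_gt_d4
  have hπ2 := Real.pi_lt_d4
  norm_num at hπ1 hπ2
  have lo : ∀ {x c : ℝ}, 0 < x → 0 ≤ c → c ^ 3 ≤ x ^ 3 → c ≤ x := fun hx hc h =>
    le_of_pow_le_pow_left₀ three_ne_zero hx.le h
  have up : ∀ {x c : ℝ}, 0 < x → 0 ≤ c → x ^ 3 ≤ c ^ 3 → x ≤ c := fun hx hc h =>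
    le_of_pow_le_pow_left₀ three_ne_zero hc h
  have k1 : 1.2599 ≤ κ := lo hκ (by norm_num) (by rw [hκ3]; norm_num)
  have k2 : κ ≤ 1.26 := up hκ (by norm_num) (by rw [hκ3]; norm_num)
  have hθb : θ ≤ 0.20861 := by norm_num at hθ1 ⊢; linarith
  have s1 : s ≤ 0.59309 := up hs (by norm_num) (by rw [hsθ]; refine hθb.trans (by norm_num))
  have w1 : 1.1624 ≤ w := lo hw (by norm_num) (by rw [hwω]; norm_num; linarith)
  have w2 : w ≤ 1.2119 := up hw (by norm_num) (by rw [hwω]; norm_num at hθb ⊢; linarith)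
  have z1 : 1.4645 ≤ z := lo hz (by norm_num) (by rw [hzπ]; norm_num; linarith)
  have s2 : s ^ 2 ≤ 0.59309 ^ 2 := by gcongr
  have w3 : 1.1624 ^ 2 ≤ w ^ 2 := by gcongr
  have w4 : w ^ 2 ≤ 1.2119 ^ 2 := by gcongr
  have z2 : 1.4645 ^ 2 ≤ z ^ 2 := by gcongr
  have kk1 : 1.2599 ^ 2 ≤ κ ^ 2 := by gcongr
  have kk2 : κ ^ 2 ≤ 1.26 ^ 2 := by gcongr
  have hθπ : θ < π / 2 := by norm_num at hθb; linarith
  obtain ⟨p', hadm', hle⟩ := action_upper_bound hκ hκ3 hs hsθ hw hwω k1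
    (by norm_num at w3 ⊢; linarith) (by norm_num at s2 ⊢; linarith)
  have hfin : action p ≠ ∞ := ne_top_of_le_ne_top ENNReal.ofReal_ne_top ((hp.2 p' hadm').trans hle)
  refine ⟨hfin, fun t ht i j hij he => ?_⟩
  have hub : ∫ t in (0 : ℝ)..1, p.lag t ≤ 3 / 4 * κ ^ 2 * w ^ 2 + 5.1513 * s ^ 2 + 0.0175 := by
    have := (hp.2 p' hadm').trans hle
    rwa [action_eq hfin, ENNReal.ofReal_le_ofReal_iff (by positivity)] at this
  have m1 : κ ^ 2 * w ^ 2 ≤ 1.26 ^ 2 * 1.2119 ^ 2 := by gcongr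
  have m2 : 1.2599 ^ 2 * 1.4645 ^ 2 ≤ κ ^ 2 * z ^ 2 := by gcongr
  have m3 : 1.2599 * s ^ 2 ≤ κ * s ^ 2 := by gcongr
  have m4 : 1.2599 * 1.4645 ^ 2 ≤ κ * z ^ 2 := by gcongr
  have m5 : 1.2599 * w ^ 2 ≤ κ * w ^ 2 := by gcongr
  have m6 : κ ^ 2 * w ^ 2 ≤ 1.26 ^ 2 * w ^ 2 := by gcongr
  have m7 : (1 - 0.20861 ^ 2 / 2) * (1.2599 ^ 2 * 1.4645 ^ 2) ≤
      (1 - θ ^ 2 / 2) * (κ ^ 2 * z ^ 2) := by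
    have : θ ^ 2 ≤ 0.20861 ^ 2 := by gcongr
    refine mul_le_mul (by linarith) m2 (by positivity) (by norm_num at this ⊢; linarith)
  have cross : ∀ i j : Fin 4, (i = 0 ∨ i = 1) → (j = 2 ∨ j = 3) → p.q t i ≠ p.q t j :=
    fun i j hi hj h => by
      have := bound_of_cross_collision hfin hp.1 hθ0 hθπ hκ hκ3 hs hsθ hw hwω hz hzπ ht hi hj h
      norm_num at *
      linarith
  have outer : p.q t 2 ≠ p.q t 3 := fun h => by
    have := bound_of_outer_collision hfin hp.1 hθ0 hθπ hκ hκ3 hw hwω hz hzπ ht h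
    norm_num at *
    linarith
  have inner : p.q t 0 ≠ p.q t 1 := fun h => by
    have := bound_of_inner_collision hfin hp.1 hθ0 hθπ (hθb.trans (by norm_num)) hκ hκ3 hs hsθ hz
      hzπ ht h
    norm_num at *
    linarith
  fin_cases i <;> fin_cases j <;> first
    | exact hij rfl
    | exact inner he
    | exact inner he.symm
    | exact outer he
    | exact outer he.symm
    | exact cross _ _ (by decide) (by decide) he
    | exact cross _ _ (by decide) (by decide) he.symm

end H1Path4

theorem IsPrim.integral_mul {f f' g g' : ℝ → ℝ} (hf : IsPrim f f' 0 1) (hg : IsPrim g g' 0 1) :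
    ∫ t in (0 : ℝ)..1, (f' t * g t + f t * g' t) = f 1 * g 1 - f 0 * g 0 := by
  rw [← AbsolutelyContinuousOnInterval.integral_deriv_mul_eq_sub (hf.ac zero_le_one)
    (hg.ac zero_le_one)]
  refine intervalIntegral.integral_congr_ae_restrict ?_
  rw [uIoc_of_le zero_le_one, ← Measure.restrict_congr_set (Ioo_ae_eq_Ioc (μ := volume))]
  refine (ae_restrict_iff' measurableSet_Ioo).2 ?_
  filter_upwards [hf.ae_hasDerivAt zero_le_one, hg.ae_hasDerivAt zero_le_one] with t h1 h2 ht
  rw [(h1 ht).deriv, (h2 ht).deriv]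

/-- The Euclidean inner product of row vectors. -/
def dot2 (w z : ℝ × ℝ) : ℝ := w.1 * z.1 + w.2 * z.2

theorem continuous_dot2 : Continuous fun x : (ℝ × ℝ) × (ℝ × ℝ) => dot2 x.1 x.2 := by
  unfold dot2; fun_prop

theorem enorm2_add_smul_sq (r w : ℝ × ℝ) (ε : ℝ) :
    enorm2 (r + ε • w) ^ 2 = enorm2 r ^ 2 + ε * (2 * dot2 r w) + ε ^ 2 * enorm2 w ^ 2 := by
  simp only [enorm2_sq, dot2, Prod.fst_add, Prod.snd_add, Prod.smul_fst, Prod.smul_snd, smul_eq_mul]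
  ring

theorem abs_dot2_le (r w : ℝ × ℝ) : |dot2 r w| ≤ enorm2 r * enorm2 w := by
  refine abs_le_of_sq_le_sq ?_ (mul_nonneg (enorm2_nonneg _) (enorm2_nonneg _))
  rw [mul_pow, enorm2_sq, enorm2_sq, dot2]
  nlinarith [sq_nonneg (r.1 * w.2 - r.2 * w.1)]

theorem inv_le_taylor {n D s X : ℝ} (hn : 0 < n) (hX : 0 ≤ X) (hXn : X ≤ n / 2)
    (hs : |s| ≤ n * X) (hD : 0 ≤ D) (h : D ^ 2 = n ^ 2 + 2 * s + X ^ 2) :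
    n / 2 ≤ D ∧ D⁻¹ ≤ n⁻¹ - s / n ^ 3 + 13 * X ^ 2 / n ^ 3 := by
  obtain ⟨s1, s2⟩ := abs_le.1 hs
  have hDn : n / 2 ≤ D := by
    refine le_of_sq_le_sq ?_ hD
    nlinarith
  refine ⟨hDn, ?_⟩
  have hD0 : 0 < D := by linarith
  set e := D ^ 2 - n ^ 2 with he
  have step1 : D⁻¹ ≤ n⁻¹ - e / (2 * n ^ 3) + 2 * e ^ 2 / n ^ 5 := by
    have h1 : n⁻¹ - e / (2 * n ^ 3) + 2 * e ^ 2 / n ^ 5 - D⁻¹ =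
        (D - n) ^ 2 * (4 * D * (D + n) ^ 2 - n ^ 2 * (D + 2 * n)) / (2 * n ^ 5 * D) := by
      rw [he]
      field_simp
      ring
    have h2 : 0 ≤ 4 * D * (D + n) ^ 2 - n ^ 2 * (D + 2 * n) := by
      nlinarith [mul_nonneg (by linarith : 0 ≤ D - n / 2) (mul_pos hn hn).le,
        mul_nonneg (by linarith : 0 ≤ D - n / 2) (sq_nonneg (D + n)), pow_pos hD0 3, sq_nonneg D,
        mul_pos hD0 hn]
    have h3 : 0 ≤ (D - n) ^ 2 * (4 * D * (D + n) ^ 2 - n ^ 2 * (D + 2 * n)) / (2 * n ^ 5 * D) := by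
      positivity
    linarith
  have he1 : e = 2 * s + X ^ 2 := by rw [he, h]; ring
  have he2 : e ^ 2 ≤ 6.25 * (n ^ 2 * X ^ 2) := by
    have : |e| ≤ 2.5 * (n * X) := by
      rw [he1, abs_le]
      constructor <;> nlinarith
    have := sq_le_sq' (abs_le.1 this).1 (abs_le.1 this).2
    nlinarith
  have step2 : 2 * e ^ 2 / n ^ 5 ≤ 12.5 * X ^ 2 / n ^ 3 := by
    rw [div_le_div_iff₀ (by positivity) (by positivity)]
    have : 2 * e ^ 2 * n ^ 3 ≤ 2 * (6.25 * (n ^ 2 * X ^ 2)) * n ^ 3 := by gcongr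
    refine this.trans (le_of_eq ?_)
    ring
  have step3 : e / (2 * n ^ 3) = s / n ^ 3 + X ^ 2 / n ^ 3 / 2 := by
    rw [he1]
    field_simp
  have h4 : 0 ≤ X ^ 2 / n ^ 3 := by positivity
  have h5 : 12.5 * X ^ 2 / n ^ 3 = 12.5 * (X ^ 2 / n ^ 3) := by ring
  have h6 : 13 * X ^ 2 / n ^ 3 = 13 * (X ^ 2 / n ^ 3) := by ring
  rw [h6]
  rw [step3] at step1
  rw [h5] at step2
  linarith

theorem inv_enorm2_add_smul_le {r w : ℝ × ℝ} {ε : ℝ} (hr : r ≠ 0)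
    (h : |ε| * enorm2 w ≤ enorm2 r / 2) : r + ε • w ≠ 0 ∧
    (enorm2 (r + ε • w))⁻¹ ≤ (enorm2 r)⁻¹ + ε * (-(dot2 r w / enorm2 r ^ 3)) +
      ε ^ 2 * (13 * enorm2 w ^ 2 / enorm2 r ^ 3) := by
  have hr0 := enorm2_pos.2 hr
  have := inv_le_taylor (n := enorm2 r) (D := enorm2 (r + ε • w)) (s := ε * dot2 r w)
    (X := |ε| * enorm2 w) hr0 (mul_nonneg (abs_nonneg _) (enorm2_nonneg _)) h
    (by
      rw [abs_mul]
      have := mul_le_mul_of_nonneg_left (abs_dot2_le r w) (abs_nonneg ε)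
      linarith) (enorm2_nonneg _) (by
      rw [enorm2_add_smul_sq, mul_pow, sq_abs]
      ring)
  refine ⟨enorm2_pos.1 (by linarith [this.1]), this.2.trans (le_of_eq ?_)⟩
  rw [mul_pow, sq_abs]
  ring

namespace H1Path4

/-- The variation `p + ε z`. -/
def addSMul (p : H1Path4) (ε : ℝ) (z : H1Path4) : H1Path4 where
  q t i := p.q t i + ε • z.q t i
  v t i := p.v t i + ε • z.v t i
  hvInt i := (p.hvInt i).add ((z.hvInt i).smul ε)
  hrep i t ht := by
    have hsub : uIcc 0 t ⊆ uIcc (0 : ℝ) 1 := by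
      rw [uIcc_of_le ht.1, uIcc_of_le zero_le_one]; exact Icc_subset_Icc le_rfl ht.2
    rw [intervalIntegral.integral_add ((p.intervalIntegrable_v i).mono_set hsub)
      (g := fun s => ε • z.v s i) (((z.intervalIntegrable_v i).mono_set hsub).smul ε),
      intervalIntegral.integral_smul,
      p.hrep i t ht, z.hrep i t ht, smul_add]
    abel
  hL2 i := by
    have h1 := (p.memLp_fst i).add ((z.memLp_fst i).const_mul ε)
    have h2 := (p.memLp_snd i).add ((z.memLp_snd i).const_mul ε)
    simp only [enorm2_sq]
    exact h1.integrable_sq.add h2.integrable_sq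

variable {p : H1Path4}

theorem exists_bound (f : Fin 4 → Fin 4 → ℝ → ℝ) (hf : ∀ i j, ContinuousOn (f i j) (Icc 0 1)) :
    ∃ M, 0 < M ∧ ∀ i j, ∀ t ∈ Icc (0 : ℝ) 1, f i j t ≤ M := by
  have h : ContinuousOn (fun t (x : Fin 4 × Fin 4) => f x.1 x.2 t) (Icc 0 1) :=
    continuousOn_pi.2 fun x => hf x.1 x.2
  obtain ⟨C, hC⟩ := isCompact_Icc.exists_bound_of_continuousOn h
  refine ⟨max C 1, by positivity, fun i j t ht => le_max_of_le_left ?_⟩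
  exact (le_abs_self _).trans ((norm_le_pi_norm (fun x : Fin 4 × Fin 4 => f x.1 x.2 t) (i, j)).trans
    (hC t ht))

theorem continuousOn_inv_dist_pow
    (hne : ∀ t ∈ Icc (0 : ℝ) 1, ∀ i j : Fin 4, i ≠ j → p.q t i ≠ p.q t j) (i j : Fin 4) (k : ℕ) :
    ContinuousOn (fun t => (enorm2 (p.q t i - p.q t j) ^ k)⁻¹) (Icc 0 1) := by
  rcases eq_or_ne i j with rfl | hij
  · simpa using continuousOn_const
  · exact ((continuous_enorm2.comp_continuousOn
      ((p.continuousOn_q i).sub (p.continuousOn_q j))).pow k).inv₀ fun t ht =>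
      pow_ne_zero k (enorm2_pos.2 (sub_ne_zero.2 (hne t ht i j hij))).ne.symm

/-- The first variation of the Lagrangian. -/
def lagFst (p z : H1Path4) (t : ℝ) : ℝ :=
  ∑ i, dot2 (p.v t i) (z.v t i) + ∑ i : Fin 4, ∑ j ∈ Finset.univ.filter (fun j => i < j),
    -(dot2 (p.q t i - p.q t j) (z.q t i - z.q t j) / enorm2 (p.q t i - p.q t j) ^ 3)

/-- A bound for the second variation of the Lagrangian. -/
def lagSnd (p z : H1Path4) (t : ℝ) : ℝ :=
  (1/2) * ∑ i, enorm2 (z.v t i) ^ 2 + ∑ i : Fin 4, ∑ j ∈ Finset.univ.filter (fun j => i < j),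
    13 * enorm2 (z.q t i - z.q t j) ^ 2 / enorm2 (p.q t i - p.q t j) ^ 3

theorem lag_addSMul_le {z : H1Path4} {ε t : ℝ}
    (hne : ∀ i j : Fin 4, i ≠ j → p.q t i ≠ p.q t j)
    (hε : ∀ i j : Fin 4, i ≠ j →
      |ε| * enorm2 (z.q t i - z.q t j) ≤ enorm2 (p.q t i - p.q t j) / 2) :
    (∀ i j : Fin 4, i < j → (p.addSMul ε z).q t i ≠ (p.addSMul ε z).q t j) ∧
    (p.addSMul ε z).lag t ≤ p.lag t + (ε * lagFst p z t + ε ^ 2 * lagSnd p z t) := by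
  have e : ∀ i j, (p.addSMul ε z).q t i - (p.addSMul ε z).q t j =
      (p.q t i - p.q t j) + ε • (z.q t i - z.q t j) := fun i j => by
    simp only [addSMul, smul_sub]; abel
  have key := fun i j (hij : i < j) =>
    inv_enorm2_add_smul_le (sub_ne_zero.2 (hne i j hij.ne)) (hε i j hij.ne)
  refine ⟨fun i j hij => ?_, ?_⟩
  · rw [← sub_ne_zero, e]
    exact (key i j hij).1
  · have h1 : (1/2 : ℝ) * ∑ i, enorm2 ((p.addSMul ε z).v t i) ^ 2 =
        (1/2) * ∑ i, enorm2 (p.v t i) ^ 2 + ε * ∑ i, dot2 (p.v t i) (z.v t i) +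
        ε ^ 2 * ((1/2) * ∑ i, enorm2 (z.v t i) ^ 2) := by
      have : ∀ i, enorm2 ((p.addSMul ε z).v t i) ^ 2 = enorm2 (p.v t i) ^ 2 +
          ε * (2 * dot2 (p.v t i) (z.v t i)) + ε ^ 2 * enorm2 (z.v t i) ^ 2 := fun i =>
        enorm2_add_smul_sq _ _ _
      simp only [this, Fin.sum_univ_four]
      ring
    have h2 : ∑ i : Fin 4, ∑ j ∈ Finset.univ.filter (fun j => i < j),
        (enorm2 ((p.addSMul ε z).q t i - (p.addSMul ε z).q t j))⁻¹ ≤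
        ∑ i : Fin 4, ∑ j ∈ Finset.univ.filter (fun j => i < j), ((enorm2 (p.q t i - p.q t j))⁻¹ +
          ε * (-(dot2 (p.q t i - p.q t j) (z.q t i - z.q t j) / enorm2 (p.q t i - p.q t j) ^ 3)) +
          ε ^ 2 * (13 * enorm2 (z.q t i - z.q t j) ^ 2 / enorm2 (p.q t i - p.q t j) ^ 3)) :=
      Finset.sum_le_sum fun i _ => Finset.sum_le_sum fun j hj => by
        rw [e]
        exact (key i j (by simpa using hj)).2
    unfold lag lagFst lagSnd
    rw [h1]
    simp only [sum_pairs_four] at h2 ⊢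
    linarith

end H1Path4

/-- The Newtonian force on each body. -/
def force (c : Fin 4 → ℝ × ℝ) (i : Fin 4) : ℝ × ℝ :=
  ∑ j ∈ Finset.univ.erase i, (1 / enorm2 (c j - c i) ^ 3) • (c j - c i)

theorem force_eq (c : Fin 4 → ℝ × ℝ) (i : Fin 4) :
    force c i = ∑ j, (1 / enorm2 (c j - c i) ^ 3) • (c j - c i) :=
  Finset.sum_erase _ (by simp)

theorem sum_dot2_force (c d : Fin 4 → ℝ × ℝ) :
    ∑ i, dot2 (force c i) (d i) = ∑ i : Fin 4, ∑ j ∈ Finset.univ.filter (fun j => i < j),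
      -(dot2 (c i - c j) (d i - d j) / enorm2 (c i - c j) ^ 3) := by
  rw [sum_pairs_four]
  simp only [force_eq, Fin.sum_univ_four, dot2, Prod.fst_add, Prod.snd_add, Prod.smul_fst,
    Prod.smul_snd, Prod.fst_sub, Prod.snd_sub, smul_eq_mul]
  rw [enorm2_sub_comm (c 1) (c 0), enorm2_sub_comm (c 2) (c 0), enorm2_sub_comm (c 3) (c 0),
    enorm2_sub_comm (c 2) (c 1), enorm2_sub_comm (c 3) (c 1), enorm2_sub_comm (c 3) (c 2)]
  ring

theorem sum_force (c : Fin 4 → ℝ × ℝ) : ∑ i, force c i = 0 := by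
  simp only [force_eq, Fin.sum_univ_four]
  rw [enorm2_sub_comm (c 1) (c 0), enorm2_sub_comm (c 2) (c 0), enorm2_sub_comm (c 3) (c 0),
    enorm2_sub_comm (c 2) (c 1), enorm2_sub_comm (c 3) (c 1), enorm2_sub_comm (c 3) (c 2)]
  ext
  · simp
    ring
  · simp
    ring

namespace H1Path4

variable {p z : H1Path4} {E : Set (Fin 4 → ℝ × ℝ)}

theorem intervalIntegrable_dot2_v (i : Fin 4) :
    IntervalIntegrable (fun t => dot2 (p.v t i) (z.v t i)) volume 0 1 := by
  rw [intervalIntegrable_iff_integrableOn_Icc_of_le zero_le_one]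
  exact ((p.memLp_fst i).integrable_mul (z.memLp_fst i)).add
    ((p.memLp_snd i).integrable_mul (z.memLp_snd i))

theorem intervalIntegrable_lagFst
    (hne : ∀ t ∈ Icc (0 : ℝ) 1, ∀ i j : Fin 4, i ≠ j → p.q t i ≠ p.q t j) :
    IntervalIntegrable (lagFst p z) volume 0 1 := by
  refine (intervalIntegrable_fun_sum _ fun i _ => intervalIntegrable_dot2_v i).add
    (intervalIntegrable_fun_sum _ fun i _ => intervalIntegrable_fun_sum _ fun j _ =>
      ContinuousOn.intervalIntegrable_of_Icc zero_le_one ?_)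
  simp only [div_eq_mul_inv]
  exact ((continuous_dot2.comp_continuousOn (((p.continuousOn_q i).sub (p.continuousOn_q j)).prodMk
    ((z.continuousOn_q i).sub (z.continuousOn_q j)))).mul (continuousOn_inv_dist_pow hne i j 3)).neg

theorem intervalIntegrable_lagSnd
    (hne : ∀ t ∈ Icc (0 : ℝ) 1, ∀ i j : Fin 4, i ≠ j → p.q t i ≠ p.q t j) :
    IntervalIntegrable (lagSnd p z) volume 0 1 := by
  refine ((intervalIntegrable_fun_sum _ fun i _ => ?_).const_mul _).add
    (intervalIntegrable_fun_sum _ fun i _ => intervalIntegrable_fun_sum _ fun j _ =>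
      ContinuousOn.intervalIntegrable_of_Icc zero_le_one ?_)
  · rw [intervalIntegrable_iff_integrableOn_Icc_of_le zero_le_one]
    exact z.hL2 i
  · simp only [div_eq_mul_inv]
    exact (((continuous_enorm2.comp_continuousOn
      ((z.continuousOn_q i).sub (z.continuousOn_q j))).pow 2).const_mul 13).mul
        (continuousOn_inv_dist_pow hne i j 3)

theorem eventually_mul_dist_le
    (hne : ∀ t ∈ Icc (0 : ℝ) 1, ∀ i j : Fin 4, i ≠ j → p.q t i ≠ p.q t j) :
    ∀ᶠ ε in nhds (0 : ℝ), ∀ t ∈ Icc (0 : ℝ) 1, ∀ i j : Fin 4, i ≠ j →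
      |ε| * enorm2 (z.q t i - z.q t j) ≤ enorm2 (p.q t i - p.q t j) / 2 := by
  obtain ⟨M, hM0, hM⟩ := exists_bound
    (fun i j t => enorm2 (z.q t i - z.q t j) * (enorm2 (p.q t i - p.q t j) ^ 1)⁻¹)
    fun i j => (continuous_enorm2.comp_continuousOn
      ((z.continuousOn_q i).sub (z.continuousOn_q j))).mul (continuousOn_inv_dist_pow hne i j 1)
  have h : ∀ᶠ ε in nhds (0 : ℝ), |ε| * M < 1 / 2 := by
    have : Filter.Tendsto (fun ε : ℝ => |ε| * M) (nhds 0) (nhds (|0| * M)) :=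
      (continuous_abs.mul continuous_const).tendsto 0
    exact this.eventually_lt_const (by simp)
  filter_upwards [h] with ε hε t ht i j hij
  have hd := enorm2_pos.2 (sub_ne_zero.2 (hne t ht i j hij))
  have h1 := hM i j t ht
  simp only [pow_one] at h1
  rw [← div_eq_mul_inv, div_le_iff₀ hd] at h1
  calc |ε| * enorm2 (z.q t i - z.q t j) ≤ |ε| * (M * enorm2 (p.q t i - p.q t j)) := by gcongr
    _ = |ε| * M * enorm2 (p.q t i - p.q t j) := by ring
    _ ≤ 1 / 2 * enorm2 (p.q t i - p.q t j) := by gcongr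
    _ = _ := by ring

theorem action_addSMul_le (hfin : action p ≠ ∞)
    (hne : ∀ t ∈ Icc (0 : ℝ) 1, ∀ i j : Fin 4, i ≠ j → p.q t i ≠ p.q t j) {ε : ℝ}
    (hε : ∀ t ∈ Icc (0 : ℝ) 1, ∀ i j : Fin 4, i ≠ j →
      |ε| * enorm2 (z.q t i - z.q t j) ≤ enorm2 (p.q t i - p.q t j) / 2) :
    0 ≤ (∫ t in (0 : ℝ)..1, p.lag t) +
      (ε * (∫ t in (0 : ℝ)..1, lagFst p z t) + ε ^ 2 * ∫ t in (0 : ℝ)..1, lagSnd p z t) ∧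
    action (p.addSMul ε z) ≤ ENNReal.ofReal ((∫ t in (0 : ℝ)..1, p.lag t) +
      (ε * (∫ t in (0 : ℝ)..1, lagFst p z t) + ε ^ 2 * ∫ t in (0 : ℝ)..1, lagSnd p z t)) := by
  have i1 := (intervalIntegrable_lagFst (z := z) hne).const_mul ε
  have i2 := (intervalIntegrable_lagSnd (z := z) hne).const_mul (ε ^ 2)
  have i3 := (intervalIntegrable_lag hfin).add (i1.add i2)
  rw [← intervalIntegral.integral_const_mul, ← intervalIntegral.integral_const_mul,
    ← intervalIntegral.integral_add i1 i2,
    ← intervalIntegral.integral_add (intervalIntegrable_lag hfin) (i1.add i2)]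
  have key : ∀ t ∈ Icc (0 : ℝ) 1, _ := fun t ht => lag_addSMul_le (hne t ht) (hε t ht)
  have hnn : ∀ t ∈ Icc (0 : ℝ) 1, 0 ≤ p.lag t + (ε * lagFst p z t + ε ^ 2 * lagSnd p z t) :=
    fun t ht => (lag_nonneg _ t).trans (key t ht).2
  refine ⟨intervalIntegral.integral_nonneg zero_le_one hnn, ?_⟩
  rw [intervalIntegral.integral_of_le zero_le_one, ← integral_Icc_eq_integral_Ioc,
    ofReal_integral_eq_lintegral_ofReal
      ((intervalIntegrable_iff_integrableOn_Icc_of_le zero_le_one).1 i3)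
      ((ae_restrict_iff' measurableSet_Icc).2 (ae_of_all _ hnn))]
  refine lintegral_mono_ae ((ae_restrict_iff' measurableSet_Icc).2 (ae_of_all _ fun t ht => ?_))
  rw [ofReal_lag _ (key t ht).1]
  exact ENNReal.ofReal_le_ofReal (key t ht).2

theorem eq_zero_of_eventually_nonneg {L M : ℝ}
    (h : ∀ᶠ ε in nhds (0 : ℝ), 0 ≤ ε * L + ε ^ 2 * M) : L = 0 := by
  have hd : HasDerivAt (fun ε : ℝ => ε * L + ε ^ 2 * M) L 0 := by
    have h1 := (hasDerivAt_id (0 : ℝ)).mul_const L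
    have h2 := ((hasDerivAt_id (0 : ℝ)).pow 2).mul_const M
    exact (h1.fun_add h2).congr_deriv (by simp)
  have hmin : IsLocalMin (fun ε : ℝ => ε * L + ε ^ 2 * M) 0 := by
    filter_upwards [h] with ε hε
    simpa using hε
  exact hmin.hasDerivAt_eq_zero hd

theorem integral_lagFst_eq_zero (hp : isMin E p) (hfin : action p ≠ ∞)
    (hne : ∀ t ∈ Icc (0 : ℝ) 1, ∀ i j : Fin 4, i ≠ j → p.q t i ≠ p.q t j)
    (hadm : ∀ᶠ ε in nhds (0 : ℝ), inAdm E (p.addSMul ε z)) :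
    ∫ t in (0 : ℝ)..1, lagFst p z t = 0 := by
  refine eq_zero_of_eventually_nonneg (M := ∫ t in (0 : ℝ)..1, lagSnd p z t) ?_
  filter_upwards [hadm, eventually_mul_dist_le (z := z) hne] with ε hε1 hε2
  obtain ⟨h0, h1⟩ := action_addSMul_le hfin hne hε2
  have := (hp.2 _ hε1).trans h1
  rw [action_eq hfin, ENNReal.ofReal_le_ofReal_iff h0] at this
  linarith

theorem lagFst_eq (t : ℝ) : lagFst p z t =
    ∑ i, (dot2 (p.v t i) (z.v t i) + dot2 (force (p.q t) i) (z.q t i)) := by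
  rw [lagFst, Finset.sum_add_distrib, sum_dot2_force]

end H1Path4

theorem continuous_force_comp {q : ℝ → Fin 4 → ℝ × ℝ} (hq : ∀ i, Continuous fun t => q t i)
    (hne : ∀ t, ∀ i j : Fin 4, i ≠ j → q t i ≠ q t j) (i : Fin 4) :
    Continuous fun t => force (q t) i := by
  refine continuous_finsetSum _ fun j hj => ?_
  have h : Continuous fun t => q t j - q t i := (hq j).sub (hq i)
  refine (continuous_const.div ((continuous_enorm2.comp h).pow 3) fun t => ?_).smul h
  exact pow_ne_zero _ (enorm2_pos.2 (sub_ne_zero.2 (hne t j i (Finset.ne_of_mem_erase hj)))).ne'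

theorem IsPrim.intervalIntegrable_mul_add {f f' g g' : ℝ → ℝ} (hf : IsPrim f f' 0 1)
    (hg : IsPrim g g' 0 1) :
    IntervalIntegrable (fun t => f' t * g t + f t * g' t) volume 0 1 := by
  have h1 := hf.continuousOn zero_le_one
  have h2 := hg.continuousOn zero_le_one
  rw [← uIcc_of_le zero_le_one] at h1 h2
  exact (hf.int.mul_continuousOn h2).add (hg.int.continuousOn_mul h1)

theorem isPrim_of_hasDerivAt {f f' : ℝ → ℝ} (h : ∀ t, HasDerivAt f (f' t) t) (hc : Continuous f') :
    IsPrim f f' 0 1 := by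
  refine ⟨hc.intervalIntegrable _ _, fun t _ => ?_⟩
  rw [intervalIntegral.integral_eq_sub_of_hasDerivAt (fun s _ => h s) (hc.intervalIntegrable _ _)]
  ring

namespace H1Path4

variable {p z : H1Path4} {E : Set (Fin 4 → ℝ × ℝ)} {Y F : ℝ → Fin 4 → ℝ × ℝ}

theorem intervalIntegrable_dot2_add (h1 : ∀ i, IsPrim (fun t => (Y t i).1) (fun t => (F t i).1) 0 1)
    (h2 : ∀ i, IsPrim (fun t => (Y t i).2) (fun t => (F t i).2) 0 1) (i : Fin 4) :
    IntervalIntegrable (fun t => dot2 (Y t i) (z.v t i) + dot2 (F t i) (z.q t i)) volume 0 1 := by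
  refine (((h1 i).intervalIntegrable_mul_add (z.isPrim_fst i)).add
    ((h2 i).intervalIntegrable_mul_add (z.isPrim_snd i))).congr fun t _ => ?_
  simp only [dot2]
  ring

theorem integral_dot2_add (h1 : ∀ i, IsPrim (fun t => (Y t i).1) (fun t => (F t i).1) 0 1)
    (h2 : ∀ i, IsPrim (fun t => (Y t i).2) (fun t => (F t i).2) 0 1) :
    ∫ t in (0 : ℝ)..1, ∑ i, (dot2 (Y t i) (z.v t i) + dot2 (F t i) (z.q t i)) =
      ∑ i, (dot2 (Y 1 i) (z.q 1 i) - dot2 (Y 0 i) (z.q 0 i)) := by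
  rw [intervalIntegral.integral_finsetSum fun i _ => intervalIntegrable_dot2_add h1 h2 i]
  refine Finset.sum_congr rfl fun i _ => ?_
  have e1 := (h1 i).integral_mul (z.isPrim_fst i)
  have e2 := (h2 i).integral_mul (z.isPrim_snd i)
  calc _ = ∫ t in (0 : ℝ)..1, (((F t i).1 * (z.q t i).1 + (Y t i).1 * (z.v t i).1) +
        ((F t i).2 * (z.q t i).2 + (Y t i).2 * (z.v t i).2)) := by
        congr 1
        funext t
        simp only [dot2]
        ring
    _ = _ := by
        rw [intervalIntegral.integral_add ((h1 i).intervalIntegrable_mul_add (z.isPrim_fst i))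
          ((h2 i).intervalIntegrable_mul_add (z.isPrim_snd i)), e1, e2]
        simp only [dot2]
        ring

theorem eq_zero_of_integral_sq_eq_zero (h0 : z.q 0 = 0)
    (h : ∫ t in (0 : ℝ)..1, ∑ i, dot2 (z.v t i) (z.v t i) = 0) :
    ∀ t ∈ Icc (0 : ℝ) 1, z.q t = 0 := by
  have hi1 : ∀ i, IntervalIntegrable (fun t => (z.v t i).1 ^ 2) volume 0 1 := fun i => by
    rw [intervalIntegrable_iff_integrableOn_Icc_of_le zero_le_one]
    exact (z.memLp_fst i).integrable_sq
  have hi2 : ∀ i, IntervalIntegrable (fun t => (z.v t i).2 ^ 2) volume 0 1 := fun i => by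
    rw [intervalIntegrable_iff_integrableOn_Icc_of_le zero_le_one]
    exact (z.memLp_snd i).integrable_sq
  rw [intervalIntegral.integral_finsetSum fun i _ => intervalIntegrable_dot2_v i] at h
  have he : ∀ i, ∫ t in (0 : ℝ)..1, dot2 (z.v t i) (z.v t i) =
      (∫ t in (0 : ℝ)..1, (z.v t i).1 ^ 2) + ∫ t in (0 : ℝ)..1, (z.v t i).2 ^ 2 := fun i => by
    rw [← intervalIntegral.integral_add (hi1 i) (hi2 i)]
    congr 1
    funext t
    simp only [dot2]
    ring
  have hn1 : ∀ i, 0 ≤ ∫ t in (0 : ℝ)..1, (z.v t i).1 ^ 2 := fun i =>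
    intervalIntegral.integral_nonneg zero_le_one fun t _ => sq_nonneg _
  have hn2 : ∀ i, 0 ≤ ∫ t in (0 : ℝ)..1, (z.v t i).2 ^ 2 := fun i =>
    intervalIntegral.integral_nonneg zero_le_one fun t _ => sq_nonneg _
  intro t ht
  funext i
  have hz := (Finset.sum_eq_zero_iff_of_nonneg fun i _ => by
    rw [he]; exact add_nonneg (hn1 i) (hn2 i)).1 h i (Finset.mem_univ i)
  rw [he] at hz
  have b1 := (z.isPrim_fst i).sq_le_of_zero (hi1 i) (τ := 0) (by simp) (by simp [h0]) ht
  have b2 := (z.isPrim_snd i).sq_le_of_zero (hi2 i) (τ := 0) (by simp) (by simp [h0]) ht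
  have c1 : (z.q t i).1 = 0 := by
    refine pow_eq_zero_iff (two_ne_zero) |>.1 (le_antisymm ?_ (sq_nonneg _))
    linarith [hn1 i, hn2 i]
  have c2 : (z.q t i).2 = 0 := by
    refine pow_eq_zero_iff (two_ne_zero) |>.1 (le_antisymm ?_ (sq_nonneg _))
    linarith [hn1 i, hn2 i]
  exact Prod.ext c1 c2

/-- The path with prescribed endpoints and acceleration given by the forces along `p`. -/
theorem exists_path_of_force
    (hne : ∀ t ∈ Icc (0 : ℝ) 1, ∀ i j : Fin 4, i ≠ j → p.q t i ≠ p.q t j) :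
    ∃ w : H1Path4, w.q 0 = p.q 0 ∧ w.q 1 = p.q 1 ∧
      (∀ i t, HasDerivAt (fun s => w.q s i) (w.v t i) t) ∧
      (∀ i t, HasDerivAt (fun s => w.v s i) (force (p.q (projIcc 0 1 zero_le_one t)) i) t) ∧
      (∀ i, Continuous fun t => force (p.q (projIcc (0 : ℝ) 1 zero_le_one t)) i) := by
  set G : Fin 4 → ℝ → ℝ × ℝ := fun i t => force (p.q (projIcc (0 : ℝ) 1 zero_le_one t)) i with hG
  have hGc : ∀ i, Continuous (G i) := fun i =>
    continuous_force_comp (q := fun t => p.q (projIcc (0 : ℝ) 1 zero_le_one t))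
      (fun j => (p.continuousOn_q j).comp_continuous
        (continuous_subtype_val.comp continuous_projIcc) fun t => Subtype.coe_prop _)
      (fun t => hne _ (Subtype.coe_prop _)) i
  set P : Fin 4 → ℝ → ℝ × ℝ := fun i t => ∫ s in (0 : ℝ)..t, G i s with hP
  have hPd : ∀ i t, HasDerivAt (P i) (G i t) t := fun i t =>
    intervalIntegral.integral_hasDerivAt_right ((hGc i).intervalIntegrable _ _)
      ((hGc i).stronglyMeasurableAtFilter _ _) (hGc i).continuousAt
  have hPc : ∀ i, Continuous (P i) := fun i =>
    continuous_iff_continuousAt.2 fun t => (hPd i t).continuousAt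
  set I : Fin 4 → ℝ → ℝ × ℝ := fun i t => ∫ s in (0 : ℝ)..t, P i s with hI
  have hId : ∀ i t, HasDerivAt (I i) (P i t) t := fun i t =>
    intervalIntegral.integral_hasDerivAt_right ((hPc i).intervalIntegrable _ _)
      ((hPc i).stronglyMeasurableAtFilter _ _) (hPc i).continuousAt
  set c : Fin 4 → ℝ × ℝ := fun i => p.q 1 i - p.q 0 i - I i 1 with hc
  refine ⟨ofC1 (fun t i => p.q 0 i + (t • c i + I i t)) (fun t i => c i + P i t) (fun i t => ?_)
    (fun i => continuous_const.add (hPc i)), ?_, ?_, fun i t => ?_, fun i t => ?_, hGc⟩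
  · simpa using (((hasDerivAt_id t).smul_const (c i)).add (hId i t)).const_add (p.q 0 i)
  · funext i
    simp [ofC1, hI]
  · funext i
    simp [ofC1, hc]
  · simpa [ofC1] using (((hasDerivAt_id t).smul_const (c i)).add (hId i t)).const_add (p.q 0 i)
  · exact (hPd i t).const_add (c i)

end H1Path4

namespace H1Path4

variable {p w z : H1Path4} {E : Set (Fin 4 → ℝ × ℝ)} {c : ℝ → Fin 4 → ℝ × ℝ}

theorem sum_eq_zero_of_force (hq : ∀ i t, HasDerivAt (fun s => w.q s i) (w.v t i) t)
    (hv : ∀ i t, HasDerivAt (fun s => w.v s i) (force (c t) i) t)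
    (h0 : ∑ i, w.q 0 i = 0) (h1 : ∑ i, w.q 1 i = 0) (t : ℝ) : ∑ i, w.q t i = 0 := by
  have hV : ∀ s, HasDerivAt (fun s => ∑ i, w.v s i) 0 s := fun s => by
    rw [← sum_force (c s)]
    exact HasDerivAt.fun_sum fun i _ => hv i s
  have hVc : ∀ s, ∑ i, w.v s i = ∑ i, w.v 0 i := fun s =>
    is_const_of_deriv_eq_zero (fun s => (hV s).differentiableAt) (fun s => (hV s).deriv) s 0
  have hS : ∀ s, HasDerivAt (fun s => (∑ i, w.q s i) - s • ∑ i, w.v 0 i) 0 s := fun s => by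
    have := (HasDerivAt.fun_sum (u := Finset.univ) fun i _ => hq i s).fun_sub
      ((hasDerivAt_id s).smul_const (∑ i, w.v 0 i))
    refine this.congr_deriv ?_
    rw [hVc s, one_smul, sub_self]
  have hSc : ∀ s, (∑ i, w.q s i) - s • ∑ i, w.v 0 i = 0 := fun s => by
    have := is_const_of_deriv_eq_zero (fun s => (hS s).differentiableAt)
      (fun s => (hS s).deriv) s 0
    rw [this, h0, zero_smul, sub_self]
  have hV0 : ∑ i, w.v 0 i = 0 := by simpa [h1] using hSc 1
  simpa [hV0] using hSc t

theorem isPrim_v_fst (hv : ∀ i t, HasDerivAt (fun s => w.v s i) (force (c t) i) t)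
    (hc : ∀ i, Continuous fun t => force (c t) i) (i : Fin 4) :
    IsPrim (fun t => (w.v t i).1) (fun t => (force (c t) i).1) 0 1 :=
  isPrim_of_hasDerivAt (fun t => (hv i t).fst) (hc i).fst

theorem isPrim_v_snd (hv : ∀ i t, HasDerivAt (fun s => w.v s i) (force (c t) i) t)
    (hc : ∀ i, Continuous fun t => force (c t) i) (i : Fin 4) :
    IsPrim (fun t => (w.v t i).2) (fun t => (force (c t) i).2) 0 1 :=
  isPrim_of_hasDerivAt (fun t => (hv i t).snd) (hc i).snd

theorem integral_lagFst_sub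
    (hne : ∀ t ∈ Icc (0 : ℝ) 1, ∀ i j : Fin 4, i ≠ j → p.q t i ≠ p.q t j)
    (hv : ∀ i t, HasDerivAt (fun s => w.v s i) (force (c t) i) t)
    (hc : ∀ i, Continuous fun t => force (c t) i) (hcp : ∀ t ∈ Icc (0 : ℝ) 1, c t = p.q t) :
    ∫ t in (0 : ℝ)..1, ∑ i, dot2 (p.v t i - w.v t i) (z.v t i) = (∫ t in (0 : ℝ)..1, lagFst p z t) -
      ∑ i, (dot2 (w.v 1 i) (z.q 1 i) - dot2 (w.v 0 i) (z.q 0 i)) := by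
  rw [← integral_dot2_add (isPrim_v_fst hv hc) (isPrim_v_snd hv hc),
    ← intervalIntegral.integral_sub (intervalIntegrable_lagFst hne)
      (intervalIntegrable_fun_sum _ fun i _ => intervalIntegrable_dot2_add (isPrim_v_fst hv hc)
        (isPrim_v_snd hv hc) i)]
  refine intervalIntegral.integral_congr fun t ht => ?_
  rw [uIcc_of_le zero_le_one] at ht
  simp only [lagFst_eq, hcp t ht]
  rw [← Finset.sum_sub_distrib]
  refine Finset.sum_congr rfl fun i _ => ?_
  simp only [dot2, Prod.fst_sub, Prod.snd_sub]
  ring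

theorem eq_of_isMin (hp : isMin E p) (hfin : action p ≠ ∞)
    (hne : ∀ t ∈ Icc (0 : ℝ) 1, ∀ i j : Fin 4, i ≠ j → p.q t i ≠ p.q t j)
    (h0 : w.q 0 = p.q 0) (h1 : w.q 1 = p.q 1)
    (hq : ∀ i t, HasDerivAt (fun s => w.q s i) (w.v t i) t)
    (hv : ∀ i t, HasDerivAt (fun s => w.v s i) (force (c t) i) t)
    (hc : ∀ i, Continuous fun t => force (c t) i) (hcp : ∀ t ∈ Icc (0 : ℝ) 1, c t = p.q t) :
    ∀ t ∈ Icc (0 : ℝ) 1, w.q t = p.q t := by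
  obtain ⟨hchi, hS, hE⟩ := hp.1
  have hw := sum_eq_zero_of_force hq hv (by rw [h0]; exact hchi 0 (by simp))
    (by rw [h1]; exact hchi 1 (by simp))
  have z0 : (p.addSMul (-1) w).q 0 = 0 := by
    funext i; simp [addSMul, h0]
  have z1 : (p.addSMul (-1) w).q 1 = 0 := by
    funext i; simp [addSMul, h1]
  have hz : ∫ t in (0 : ℝ)..1, lagFst p (p.addSMul (-1) w) t = 0 := by
    refine integral_lagFst_eq_zero hp hfin hne (Filter.Eventually.of_forall fun ε => ⟨?_, ?_, ?_⟩)
    · intro t ht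
      have e1 := hchi t ht
      have e2 := hw t
      simp only [addSMul, Finset.sum_add_distrib, ← Finset.smul_sum, e1, e2]
      simp
    · convert hS using 1
      funext i
      simp [addSMul, h0]
    · convert hE using 1
      funext i
      simp [addSMul, h1]
  have key := integral_lagFst_sub (z := p.addSMul (-1) w) hne hv hc hcp
  rw [hz, z0, z1] at key
  have := eq_zero_of_integral_sq_eq_zero z0 (by
    convert key using 1
    · congr 1
      funext t
      refine Finset.sum_congr rfl fun i _ => ?_
      simp only [addSMul, dot2, Prod.fst_sub, Prod.snd_sub, Prod.fst_add, Prod.snd_add,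
        Prod.smul_fst, Prod.smul_snd, smul_eq_mul]
      ring
    · simp [dot2])
  intro t ht
  have e := this t ht
  funext i
  have ei := congrFun e i
  simp only [addSMul, neg_smul, one_smul, Pi.zero_apply] at ei
  exact (add_neg_eq_zero.1 ei).symm

theorem integral_dot2_sub_const (k : Fin 4 → ℝ × ℝ) (h0 : w.q 0 = p.q 0) (h1 : w.q 1 = p.q 1) :
    ∫ t in (0 : ℝ)..1, ∑ i, dot2 (p.v t i - w.v t i) (k i) = 0 := by
  have key : ∀ i, IsPrim (fun t => dot2 (p.q t i - w.q t i) (k i))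
      (fun t => dot2 (p.v t i - w.v t i) (k i)) 0 1 := fun i => by
    have hx := (p.isPrim_fst i).lin (w.isPrim_fst i) 1 (-1)
    have hy := (p.isPrim_snd i).lin (w.isPrim_snd i) 1 (-1)
    refine cast ?_ (hx.lin hy (k i).1 (k i).2)
    congr 1 <;> funext t <;> simp only [dot2, Prod.fst_sub, Prod.snd_sub] <;> ring
  rw [intervalIntegral.integral_finsetSum fun i _ => (key i).int]
  refine Finset.sum_eq_zero fun i _ => ?_
  have := (key i).eq 1 (by simp)
  rw [h0, h1] at this
  simpa [dot2] using this.symm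

/-- The first-order boundary conditions satisfied by a minimizer. -/
theorem boundary_eq_zero (hp : isMin E p) (hfin : action p ≠ ∞)
    (hne : ∀ t ∈ Icc (0 : ℝ) 1, ∀ i j : Fin 4, i ≠ j → p.q t i ≠ p.q t j)
    (h0 : w.q 0 = p.q 0) (h1 : w.q 1 = p.q 1)
    (hv : ∀ i t, HasDerivAt (fun s => w.v s i) (force (c t) i) t)
    (hc : ∀ i, Continuous fun t => force (c t) i) (hcp : ∀ t ∈ Icc (0 : ℝ) 1, c t = p.q t)
    {ζ η : Fin 4 → ℝ × ℝ} (hζ : ∑ i, ζ i = 0) (hη : ∑ i, η i = 0)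
    (hS : ∀ᶠ ε in nhds (0 : ℝ), (fun i => p.q 0 i + ε • ζ i) ∈ QSset)
    (hE : ∀ᶠ ε in nhds (0 : ℝ), (fun i => p.q 1 i + ε • η i) ∈ E) :
    ∑ i, (dot2 (w.v 1 i) (η i) - dot2 (w.v 0 i) (ζ i)) = 0 := by
  set z : H1Path4 := ofC1 (fun t i => ζ i + t • (η i - ζ i)) (fun _ i => η i - ζ i)
    (fun i t => by simpa using ((hasDerivAt_id t).smul_const (η i - ζ i)).const_add (ζ i))
    (fun i => continuous_const) with hz
  have z0 : z.q 0 = ζ := by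
    funext i; simp [hz, ofC1]
  have z1 : z.q 1 = η := by
    funext i; simp [hz, ofC1]
  have key := integral_lagFst_sub (z := z) hne hv hc hcp
  rw [z0, z1, integral_lagFst_eq_zero hp hfin hne] at key
  · have h := integral_dot2_sub_const (fun i => η i - ζ i) h0 h1
    have h' := h.symm.trans key
    linarith
  · filter_upwards [hS, hE] with ε h2 h3
    refine ⟨fun t ht => ?_, ?_, ?_⟩
    · have e1 := hp.1.1 t ht
      simp only [addSMul, Finset.sum_add_distrib, ← Finset.smul_sum, e1, hz, ofC1,
        Finset.sum_sub_distrib, hζ, hη]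
      simp
    · convert h2 using 1
      funext i
      simp [addSMul, z0]
    · convert h3 using 1
      funext i
      simp [addSMul, z1]

end H1Path4

/-- The reflection of the plane across the line through the origin at angle `φ / 2`. -/
def refl2 (φ : ℝ) (w : ℝ × ℝ) : ℝ × ℝ :=
  (w.1 * Real.cos φ + w.2 * Real.sin φ, w.1 * Real.sin φ - w.2 * Real.cos φ)

/-- Act on configurations by permuting the bodies and reflecting the plane. -/
def reflPerm (φ : ℝ) (τ : Equiv.Perm (Fin 4)) (x : Fin 4 → ℝ × ℝ) : Fin 4 → ℝ × ℝ :=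
  fun i => refl2 φ (x (τ i))

/-- The permutation of the bodies fixing the configurations in `QSset` up to reflection. -/
def permS : Equiv.Perm (Fin 4) := Equiv.swap 2 3

/-- The permutation of the bodies fixing the configurations in `QE2set` up to reflection. -/
def permE : Equiv.Perm (Fin 4) := Equiv.swap 0 1 * Equiv.swap 2 3

theorem permS_apply : permS 0 = 0 ∧ permS 1 = 1 ∧ permS 2 = 3 ∧ permS 3 = 2 := by
  unfold permS; decide

theorem permE_apply : permE 0 = 1 ∧ permE 1 = 0 ∧ permE 2 = 3 ∧ permE 3 = 2 := by
  unfold permE; decide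

theorem reflPerm_zero_permS_eq_iff {x y : Fin 4 → ℝ × ℝ} : reflPerm 0 permS x = y ↔
    ((x 0).1 = (y 0).1 ∧ -(x 0).2 = (y 0).2) ∧ ((x 1).1 = (y 1).1 ∧ -(x 1).2 = (y 1).2) ∧
    ((x 3).1 = (y 2).1 ∧ -(x 3).2 = (y 2).2) ∧ ((x 2).1 = (y 3).1 ∧ -(x 2).2 = (y 3).2) := by
  obtain ⟨h0, h1, h2, h3⟩ := permS_apply
  rw [funext_iff, Fin.forall_fin_succ, Fin.forall_fin_succ, Fin.forall_fin_succ,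
    Fin.forall_fin_succ]
  simp [reflPerm, refl2, h0, h1, h2, h3, Prod.ext_iff]

theorem refl2_two_mul_rotV (θ : ℝ) (w : ℝ × ℝ) : refl2 (2 * θ) (rotV θ w) = rotV θ (refl2 0 w) := by
  have h := Real.sin_sq_add_cos_sq θ
  simp only [refl2, rotV, Real.cos_two_mul, Real.sin_two_mul, Real.cos_zero, Real.sin_zero]
  ext
  · dsimp only
    linear_combination 2 * Real.cos θ * w.1 * h
  · dsimp only
    linear_combination -2 * Real.cos θ * w.2 * h

theorem refl2_two_mul_eq_neg {θ : ℝ} {u w : ℝ × ℝ}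
    (h1 : Real.cos θ * (u.1 + w.1) + Real.sin θ * (u.2 + w.2) = 0)
    (h2 : Real.cos θ * (u.2 - w.2) - Real.sin θ * (u.1 - w.1) = 0) : refl2 (2 * θ) w = -u := by
  have h := Real.sin_sq_add_cos_sq θ
  simp only [refl2, Real.cos_two_mul, Real.sin_two_mul]
  ext
  · simp only [Prod.fst_neg]
    linear_combination Real.cos θ * h1 - Real.sin θ * h2 + (w.1 - u.1) * h
  · simp only [Prod.snd_neg]
    linear_combination Real.sin θ * h1 + Real.cos θ * h2 + (- w.2 - u.2) * h

namespace H1Path4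

variable {p w : H1Path4} {θ a b c : ℝ} {E : Set (Fin 4 → ℝ × ℝ)}

theorem eventually_nonneg_add_mul (hb : 0 < b) (β : ℝ) : ∀ᶠ ε in nhds (0 : ℝ), 0 ≤ b + ε * β := by
  have : Filter.Tendsto (fun ε : ℝ => b + ε * β) (nhds 0) (nhds (b + 0 * β)) :=
    (by fun_prop : Continuous fun ε : ℝ => b + ε * β).tendsto 0
  filter_upwards [this.eventually_const_lt (by simpa using hb)] with ε hε using hε.le

theorem eventually_mem_QSset (hb : 0 < b) (hc : 0 < c) {x : Fin 4 → ℝ × ℝ}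
    (hx : x = ![(-a - c, 0), (-a, 0), ((2 * a + c) / 2, b), ((2 * a + c) / 2, -b)]) (α β γ : ℝ) :
    ∀ᶠ ε in nhds (0 : ℝ), (fun i => x i + ε • (![(-α - γ, 0), (-α, 0), ((2 * α + γ) / 2, β),
      ((2 * α + γ) / 2, -β)] : Fin 4 → ℝ × ℝ) i) ∈ QSset := by
  filter_upwards [eventually_nonneg_add_mul hb β, eventually_nonneg_add_mul hc γ] with ε h1 h2
  refine ⟨a + ε * α, b + ε * β, c + ε * γ, h1, h2, ?_⟩
  subst hx
  funext i
  fin_cases i <;> ext <;> simp <;> ring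

theorem eventually_mem_QE2set (hb : 0 < b) (hc : 0 < c) {x : Fin 4 → ℝ × ℝ}
    (hx : x = fun i => rotV θ (![(-a, -b), (-a, b), (a, c), (a, -c)] i)) (α β γ : ℝ) :
    ∀ᶠ ε in nhds (0 : ℝ), (fun i => x i + ε • rotV θ
      ((![(-α, -β), (-α, β), (α, γ), (α, -γ)] : Fin 4 → ℝ × ℝ) i)) ∈ QE2set θ := by
  filter_upwards [eventually_nonneg_add_mul hb β, eventually_nonneg_add_mul hc γ] with ε h1 h2
  refine ⟨a + ε * α, b + ε * β, c + ε * γ, h1, h2, ?_⟩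
  subst hx
  funext i
  fin_cases i <;> ext <;> simp [rotV] <;> ring

theorem exists_pos_of_mem_QSset {x : Fin 4 → ℝ × ℝ} (hx : x ∈ QSset)
    (hne : ∀ i j, i ≠ j → x i ≠ x j) : ∃ a b c : ℝ, 0 < b ∧ 0 < c ∧
      x = ![(-a - c, 0), (-a, 0), ((2 * a + c) / 2, b), ((2 * a + c) / 2, -b)] := by
  obtain ⟨a, b, c, hb, hc, rfl⟩ := hx
  refine ⟨a, b, c, hb.lt_of_ne ?_, hc.lt_of_ne ?_, rfl⟩
  · rintro rfl
    exact hne 2 3 (by decide) (by simp)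
  · rintro rfl
    exact hne 0 1 (by decide) (by simp)

theorem exists_pos_of_mem_QE2set {x : Fin 4 → ℝ × ℝ} (hx : x ∈ QE2set θ)
    (hne : ∀ i j, i ≠ j → x i ≠ x j) : ∃ a b c : ℝ, 0 < b ∧ 0 < c ∧
      x = fun i => rotV θ (![(-a, -b), (-a, b), (a, c), (a, -c)] i) := by
  obtain ⟨a, b, c, hb, hc, rfl⟩ := hx
  refine ⟨a, b, c, hb.lt_of_ne ?_, hc.lt_of_ne ?_, rfl⟩
  · rintro rfl
    exact hne 0 1 (by decide) (by simp)
  · rintro rfl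
    exact hne 2 3 (by decide) (by simp)

theorem reflPerm_of_mem_QSset {x : Fin 4 → ℝ × ℝ} (hx : x ∈ QSset) : reflPerm 0 permS x = x := by
  obtain ⟨a, b, c, -, -, rfl⟩ := hx
  simp [reflPerm_zero_permS_eq_iff]

theorem reflPerm_of_mem_QE2set {x : Fin 4 → ℝ × ℝ} (hx : x ∈ QE2set θ) :
    reflPerm (2 * θ) permE x = x := by
  obtain ⟨a, b, c, -, -, rfl⟩ := hx
  obtain ⟨h0, h1, h2, h3⟩ := permE_apply
  funext i
  rw [reflPerm, refl2_two_mul_rotV]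
  congr 1
  fin_cases i <;> simp [refl2, h0, h1, h2, h3]

theorem reflPerm_velocity_start (hS : ∀ α β γ : ℝ, ∑ i, dot2 (w.v 0 i)
      ((![(-α - γ, 0), (-α, 0), ((2 * α + γ) / 2, β), ((2 * α + γ) / 2, -β)] : Fin 4 → ℝ × ℝ) i) = 0)
    (h : ∑ i, w.v 0 i = 0) : reflPerm 0 permS (w.v 0) = -w.v 0 := by
  have e1 := hS 1 0 0
  have e2 := hS 0 1 0
  have e3 := hS 0 0 1
  have e4 := congrArg Prod.fst h
  simp [Fin.sum_univ_four, dot2] at e1 e2 e3 e4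
  simp only [reflPerm_zero_permS_eq_iff, Pi.neg_apply, Prod.fst_neg, Prod.snd_neg]
  refine ⟨⟨?_, ?_⟩, ⟨?_, ?_⟩, ⟨?_, ?_⟩, ⟨?_, ?_⟩⟩ <;> first | trivial | linarith

theorem reflPerm_velocity_final (hE : ∀ α β γ : ℝ, ∑ i, dot2 (w.v 1 i)
      (rotV θ ((![(-α, -β), (-α, β), (α, γ), (α, -γ)] : Fin 4 → ℝ × ℝ) i)) = 0)
    (h : ∑ i, w.v 1 i = 0) : reflPerm (2 * θ) permE (w.v 1) = -w.v 1 := by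
  have e1 := hE 1 0 0
  have e2 := hE 0 1 0
  have e3 := hE 0 0 1
  have e4 := congrArg Prod.fst h
  have e5 := congrArg Prod.snd h
  obtain ⟨h0, h1, h2, h3⟩ := permE_apply
  simp only [Fin.sum_univ_four, dot2, rotV, Prod.fst_add, Prod.snd_add, Prod.fst_zero,
    Prod.snd_zero, Matrix.cons_val] at e1 e2 e3 e4 e5
  have k : ∀ i, refl2 (2 * θ) (w.v 1 (permE i)) = -w.v 1 i := by
    intro i
    fin_cases i <;> apply refl2_two_mul_eq_neg <;> simp only [Fin.zero_eta, Fin.mk_one,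
      Fin.reduceFinMk, h0, h1, h2, h3]
    · linear_combination (Real.cos θ * e4 + Real.sin θ * e5 - e1) / 2
    · linear_combination -e2
    · linear_combination (Real.cos θ * e4 + Real.sin θ * e5 - e1) / 2
    · linear_combination e2
    · linear_combination (Real.cos θ * e4 + Real.sin θ * e5 + e1) / 2
    · linear_combination e3
    · linear_combination (Real.cos θ * e4 + Real.sin θ * e5 + e1) / 2
    · linear_combination -e3
  exact funext k

/-- A minimizer is the restriction of a curve solving the Newtonian equations on `[0, 1]` and
meeting both boundary sets compatibly with their reflection symmetries. -/
theorem exists_newtonian_arc {θ : ℝ} (hp : isMin (QE2set θ) p) (hfin : action p ≠ ∞)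
    (hne : ∀ t ∈ Icc (0 : ℝ) 1, ∀ i j : Fin 4, i ≠ j → p.q t i ≠ p.q t j) :
    ∃ q v : ℝ → Fin 4 → ℝ × ℝ, (∀ t ∈ Icc (0 : ℝ) 1, q t = p.q t) ∧
      (∀ t, HasDerivAt q (v t) t) ∧ (∀ t ∈ Icc (0 : ℝ) 1, HasDerivAt v (force (q t)) t) ∧
      reflPerm 0 permS (q 0) = q 0 ∧ reflPerm 0 permS (v 0) = -v 0 ∧
      reflPerm (2 * θ) permE (q 1) = q 1 ∧ reflPerm (2 * θ) permE (v 1) = -v 1 := by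
  obtain ⟨w, h0, h1, hq, hv, hc⟩ := exists_path_of_force hne
  have hcp : ∀ t ∈ Icc (0 : ℝ) 1, p.q (projIcc (0 : ℝ) 1 zero_le_one t) = p.q t := fun t ht => by
    rw [projIcc_of_mem zero_le_one ht]
  have hw := eq_of_isMin hp hfin hne h0 h1 hq hv hc hcp
  obtain ⟨hchi, hS, hE⟩ := hp.1
  have hsum := sum_eq_zero_of_force hq hv (by rw [h0]; exact hchi 0 (by simp))
    (by rw [h1]; exact hchi 1 (by simp))
  have hsumv : ∀ t, ∑ i, w.v t i = 0 := fun t => by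
    have k := HasDerivAt.fun_sum (u := Finset.univ) fun i _ => hq i t
    simp only [hsum] at k
    exact k.unique (hasDerivAt_const t 0)
  obtain ⟨a, b, c, hb, hc0, hx⟩ := exists_pos_of_mem_QSset hS (hne 0 (by simp))
  obtain ⟨a', b', c', hb', hc', hx'⟩ := exists_pos_of_mem_QE2set hE (hne 1 (by simp))
  have bd := fun α β γ α' β' γ' => boundary_eq_zero hp hfin hne h0 h1 hv hc hcp
    (by ext <;> simp [Fin.sum_univ_four]; ring)
    (by ext <;> simp [Fin.sum_univ_four, rotV] <;> ring)
    (eventually_mem_QSset hb hc0 hx α β γ) (eventually_mem_QE2set hb' hc' hx' α' β' γ')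
  refine ⟨w.q, w.v, hw, fun t => hasDerivAt_pi.2 fun i => hq i t, fun t ht =>
    hasDerivAt_pi.2 fun i => ?_, ?_, ?_, ?_, ?_⟩
  · have := hv i t
    rwa [hcp t ht, ← hw t ht] at this
  · rw [h0]
    exact reflPerm_of_mem_QSset hS
  · refine reflPerm_velocity_start (fun α β γ => ?_) (hsumv 0)
    have k := bd α β γ 0 0 0
    rw [Finset.sum_sub_distrib, sub_eq_zero] at k
    rw [← k]
    simp [Fin.sum_univ_four, dot2, rotV]
  · rw [h1]
    exact reflPerm_of_mem_QE2set hE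
  · refine reflPerm_velocity_final (fun α β γ => ?_) (hsumv 1)
    have k := bd 0 0 0 α β γ
    rw [Finset.sum_sub_distrib, sub_eq_zero] at k
    rw [k]
    simp [Fin.sum_univ_four, dot2]

end H1Path4

theorem hasDerivAt_of_left_right {F : Type*} [NormedAddCommGroup F] [NormedSpace ℝ F]
    {f g h : ℝ → F} {d : F} {a : ℝ} (hg : HasDerivAt g d a) (hh : HasDerivAt h d a)
    (hfg : ∀ᶠ s in nhds a, s ≤ a → f s = g s) (hfh : ∀ᶠ s in nhds a, a ≤ s → f s = h s) :
    HasDerivAt f d a := by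
  have h1 : HasDerivWithinAt f d (Iic a) a :=
    hg.hasDerivWithinAt.congr_of_eventuallyEq
      (by filter_upwards [hfg.filter_mono nhdsWithin_le_nhds, self_mem_nhdsWithin] with s hs hs'
          using hs hs') (hfg.self_of_nhds le_rfl)
  have h2 : HasDerivWithinAt f d (Ici a) a :=
    hh.hasDerivWithinAt.congr_of_eventuallyEq
      (by filter_upwards [hfh.filter_mono nhdsWithin_le_nhds, self_mem_nhdsWithin] with s hs hs'
          using hs hs') (hfh.self_of_nhds le_rfl)
  have := h1.union h2
  rwa [Iic_union_Ici, hasDerivWithinAt_univ] at this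

/-- Extend `f` from `[-1, 1)` to the line by `f (t + 2) = C (f t)`. -/
def shiftExtend {F : Type*} [NormedAddCommGroup F] [NormedSpace ℝ F] (C : F ≃L[ℝ] F) (f : ℝ → F)
    (t : ℝ) : F :=
  (C ^ ⌊(t + 1) / 2⌋) (f (t - 2 * ⌊(t + 1) / 2⌋))

section shiftExtend

variable {F : Type*} [NormedAddCommGroup F] [NormedSpace ℝ F] {C : F ≃L[ℝ] F} {f f' : ℝ → F}

theorem shiftExtend_eq_of_mem {t : ℝ} {n : ℤ} (h1 : 2 * n - 1 ≤ t) (h2 : t < 2 * n + 1) :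
    shiftExtend C f t = (C ^ n) (f (t - 2 * n)) := by
  have : ⌊(t + 1) / 2⌋ = n := Int.floor_eq_iff.2 ⟨by linarith, by linarith⟩
  rw [shiftExtend, this]

theorem exists_int_mem (t : ℝ) : ∃ n : ℤ, 2 * n - 1 ≤ t ∧ t < 2 * n + 1 :=
  ⟨⌊(t + 1) / 2⌋, by linarith [Int.floor_le ((t + 1) / 2)],
    by linarith [Int.lt_floor_add_one ((t + 1) / 2)]⟩

theorem shiftExtend_add_two (t : ℝ) : shiftExtend C f (t + 2) = C (shiftExtend C f t) := by
  obtain ⟨n, h1, h2⟩ := exists_int_mem t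
  rw [shiftExtend_eq_of_mem h1 h2, shiftExtend_eq_of_mem (n := 1 + n) (by push_cast; linarith)
    (by push_cast; linarith), zpow_one_add]
  push_cast
  rw [show t + 2 - 2 * (1 + n) = t - 2 * n by ring]
  rfl

theorem shiftExtend_eq_of_mem_Icc (hC : C (f (-1)) = f 1) {t : ℝ} {n : ℤ} (h1 : 2 * n - 1 ≤ t)
    (h2 : t ≤ 2 * n + 1) : shiftExtend C f t = (C ^ n) (f (t - 2 * n)) := by
  rcases h2.lt_or_eq with h | rfl
  · exact shiftExtend_eq_of_mem h1 h
  · rw [shiftExtend_eq_of_mem (n := n + 1) (by push_cast; linarith) (by push_cast; linarith),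
      zpow_add_one]
    push_cast
    rw [show 2 * (n : ℝ) + 1 - 2 * (n + 1) = -1 by ring, show 2 * (n : ℝ) + 1 - 2 * n = 1 by ring,
      ← hC]
    rfl

theorem hasDerivAt_shiftExtend (hf : ∀ t ∈ Icc (-1 : ℝ) 1, HasDerivAt f (f' t) t)
    (hC : C (f (-1)) = f 1) (hC' : C (f' (-1)) = f' 1) (t : ℝ) :
    HasDerivAt (shiftExtend C f) (shiftExtend C f' t) t := by
  have key : ∀ n : ℤ, 2 * n - 1 ≤ t → t ≤ 2 * n + 1 →
      HasDerivAt (fun s => (C ^ n) (f (s - 2 * n))) (shiftExtend C f' t) t := fun n h1 h2 => by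
    rw [shiftExtend_eq_of_mem_Icc hC' h1 h2]
    exact (C ^ n).hasFDerivAt.comp_hasDerivAt t
      ((hf (t - 2 * n) ⟨by linarith, by linarith⟩).comp_sub_const t (2 * n))
  obtain ⟨n, h1, h2⟩ := exists_int_mem t
  rcases h1.lt_or_eq with h | h
  · refine (key n h1 h2.le).congr_of_eventuallyEq ?_
    filter_upwards [Ioo_mem_nhds h h2] with s hs
    exact shiftExtend_eq_of_mem hs.1.le hs.2
  · refine hasDerivAt_of_left_right (key (n - 1) (by push_cast; linarith) (by push_cast; linarith))
      (key n h1 h2.le) ?_ ?_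
    · filter_upwards [lt_mem_nhds (show t - 1 < t by linarith)] with s hs hs'
      exact shiftExtend_eq_of_mem_Icc hC (by push_cast; linarith) (by push_cast; linarith)
    · filter_upwards [gt_mem_nhds h2] with s hs hs'
      exact shiftExtend_eq_of_mem (h1.trans hs') hs

end shiftExtend

/-- Linear automorphisms of the configuration space commuting with the Newtonian force and
preserving collisions. -/
def forceSymm : Subgroup ((Fin 4 → ℝ × ℝ) ≃L[ℝ] (Fin 4 → ℝ × ℝ)) where
  carrier := {g | ∀ x, force (g x) = g (force x) ∧
    (Function.Injective (g x) ↔ Function.Injective x)}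
  mul_mem' {g h} hg hh x :=
    ⟨((hg (h x)).1.trans (congrArg g (hh x).1)), (hg (h x)).2.trans (hh x).2⟩
  one_mem' x := ⟨rfl, Iff.rfl⟩
  inv_mem' {g} hg x := by
    have e : g (g⁻¹ x) = x := g.apply_symm_apply x
    have h := hg (g⁻¹ x)
    rw [e] at h
    refine ⟨?_, h.2.symm⟩
    rw [h.1]
    exact (g.symm_apply_apply _).symm

theorem refl2_refl2 (φ ψ : ℝ) (w : ℝ × ℝ) : refl2 φ (refl2 ψ w) = rotV (φ - ψ) w := by
  simp only [refl2, rotV, Real.cos_sub, Real.sin_sub]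
  ext <;> dsimp only <;> ring

theorem rotV_zero (w : ℝ × ℝ) : rotV 0 w = w := by
  simp [rotV]

theorem rotV_rotV (φ ψ : ℝ) (w : ℝ × ℝ) : rotV φ (rotV ψ w) = rotV (φ + ψ) w := by
  simp only [rotV, Real.cos_add, Real.sin_add]
  ext <;> dsimp only <;> ring

theorem refl2_involutive (φ : ℝ) : Function.Involutive (refl2 φ) := fun w => by
  rw [refl2_refl2, sub_self, rotV_zero]

theorem refl2_sub (φ : ℝ) (u w : ℝ × ℝ) : refl2 φ (u - w) = refl2 φ u - refl2 φ w := by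
  simp only [refl2]
  ext <;> simp <;> ring

theorem refl2_smul (φ k : ℝ) (w : ℝ × ℝ) : refl2 φ (k • w) = k • refl2 φ w := by
  simp only [refl2]
  ext <;> simp <;> ring

theorem refl2_add (φ : ℝ) (u w : ℝ × ℝ) : refl2 φ (u + w) = refl2 φ u + refl2 φ w := by
  simp only [refl2]
  ext <;> simp <;> ring

theorem enorm2_refl2 (φ : ℝ) (w : ℝ × ℝ) : enorm2 (refl2 φ w) = enorm2 w := by
  rw [enorm2, enorm2]
  congr 1
  simp only [refl2]
  linear_combination (w.1 ^ 2 + w.2 ^ 2) * Real.sin_sq_add_cos_sq φ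

theorem force_reflPerm (φ : ℝ) (τ : Equiv.Perm (Fin 4)) (x : Fin 4 → ℝ × ℝ) :
    force (reflPerm φ τ x) = reflPerm φ τ (force x) := by
  funext i
  simp only [reflPerm, force_eq, ← refl2_sub, enorm2_refl2, ← refl2_smul]
  rw [Equiv.sum_comp τ fun j => refl2 φ ((1 / enorm2 (x j - x (τ i)) ^ 3) • (x j - x (τ i)))]
  simp only [Fin.sum_univ_four, refl2_add]

theorem injective_reflPerm_iff {φ : ℝ} {τ : Equiv.Perm (Fin 4)} {x : Fin 4 → ℝ × ℝ} :
    Function.Injective (reflPerm φ τ x) ↔ Function.Injective x := by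
  change Function.Injective (refl2 φ ∘ (x ∘ τ)) ↔ _
  rw [(refl2_involutive φ).injective.of_comp_iff, τ.injective_comp]

/-- `reflPerm` as a continuous linear automorphism, for an involution `τ`. -/
def reflPermL (φ : ℝ) (τ : Equiv.Perm (Fin 4)) (hτ : Function.Involutive τ) :
    (Fin 4 → ℝ × ℝ) ≃L[ℝ] (Fin 4 → ℝ × ℝ) :=
  (LinearEquiv.ofInvolutive
    ({ toFun := reflPerm φ τ
       map_add' := fun x y => funext fun i => refl2_add φ (x (τ i)) (y (τ i))
       map_smul' := fun k x => funext fun i => refl2_smul φ k (x (τ i)) } :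
      (Fin 4 → ℝ × ℝ) →ₗ[ℝ] (Fin 4 → ℝ × ℝ))
    fun x => funext fun i => by
      change refl2 φ (refl2 φ (x (τ (τ i)))) = x i
      rw [refl2_involutive φ, hτ]).toContinuousLinearEquiv

theorem reflPerm_reflPerm (φ : ℝ) {τ : Equiv.Perm (Fin 4)} (hτ : Function.Involutive τ)
    (x : Fin 4 → ℝ × ℝ) : reflPerm φ τ (reflPerm φ τ x) = x :=
  funext fun i => by rw [reflPerm, reflPerm, refl2_involutive φ, hτ]

theorem reflPermL_mem_forceSymm (φ : ℝ) (τ : Equiv.Perm (Fin 4)) (hτ : Function.Involutive τ) :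
    reflPermL φ τ hτ ∈ forceSymm :=
  fun x => ⟨force_reflPerm φ τ x, injective_reflPerm_iff⟩

theorem permS_involutive : Function.Involutive permS := by
  unfold permS Function.Involutive; decide

theorem permE_involutive : Function.Involutive permE := by
  unfold permE Function.Involutive; decide

/-- The composition of the two boundary reflections. -/
def shiftSymm (θ : ℝ) : (Fin 4 → ℝ × ℝ) ≃L[ℝ] (Fin 4 → ℝ × ℝ) :=
  reflPermL (2 * θ) permE permE_involutive * reflPermL 0 permS permS_involutive

theorem shiftSymm_apply (θ : ℝ) (x : Fin 4 → ℝ × ℝ) :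
    shiftSymm θ x = reflPerm (2 * θ) permE (reflPerm 0 permS x) := rfl

theorem shiftSymm_shiftSymm (θ : ℝ) (x : Fin 4 → ℝ × ℝ) (i : Fin 4) :
    shiftSymm θ (shiftSymm θ x) i = rotV (4 * θ) (x i) := by
  have h : ∀ i, permS (permE (permS (permE i))) = i := by
    unfold permS permE; decide
  simp only [shiftSymm_apply, reflPerm, refl2_refl2, rotV_rotV, h]
  congr 1
  ring

theorem shiftSymm_mem_forceSymm (θ : ℝ) : shiftSymm θ ∈ forceSymm :=
  mul_mem (reflPermL_mem_forceSymm _ _ _) (reflPermL_mem_forceSymm _ _ _)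

theorem force_shiftExtend {C : (Fin 4 → ℝ × ℝ) ≃L[ℝ] (Fin 4 → ℝ × ℝ)} (hC : C ∈ forceSymm)
    (f : ℝ → Fin 4 → ℝ × ℝ) (t : ℝ) :
    force (shiftExtend C f t) = shiftExtend C (fun s => force (f s)) t :=
  (zpow_mem hC _ _).1

theorem injective_shiftExtend {C : (Fin 4 → ℝ × ℝ) ≃L[ℝ] (Fin 4 → ℝ × ℝ)} (hC : C ∈ forceSymm)
    {f : ℝ → Fin 4 → ℝ × ℝ} (hf : ∀ t ∈ Icc (-1 : ℝ) 1, Function.Injective (f t)) (t : ℝ) :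
    Function.Injective (shiftExtend C f t) := by
  obtain ⟨n, h1, h2⟩ := exists_int_mem t
  rw [shiftExtend_eq_of_mem h1 h2]
  exact (zpow_mem hC n _).2.2 (hf _ ⟨by linarith, by linarith⟩)

theorem contDiff_two_of_force {Q V : ℝ → Fin 4 → ℝ × ℝ} (hQ : ∀ t, HasDerivAt Q (V t) t)
    (hV : ∀ t, HasDerivAt V (force (Q t)) t) (hne : ∀ t, Function.Injective (Q t)) :
    ContDiff ℝ 2 Q := by
  have hd : deriv Q = V := funext fun t => (hQ t).deriv
  have hd' : deriv V = fun t => force (Q t) := funext fun t => (hV t).deriv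
  have hc : ∀ i, Continuous fun t => Q t i := fun i => continuous_iff_continuousAt.2 fun t =>
    (hasDerivAt_pi.1 (hQ t) i).continuousAt
  rw [show (2 : WithTop ℕ∞) = 1 + 1 by norm_num, contDiff_succ_iff_deriv, hd,
    contDiff_one_iff_deriv, hd']
  exact ⟨fun t => (hQ t).differentiableAt, by simp, fun t => (hV t).differentiableAt,
    continuous_pi fun i => continuous_force_comp hc (fun t i j hij => (hne t).ne hij) i⟩

theorem newton_of_force {Q V : ℝ → Fin 4 → ℝ × ℝ} (hQ : ∀ t, HasDerivAt Q (V t) t)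
    (hV : ∀ t, HasDerivAt V (force (Q t)) t) : newton Q univ := by
  intro i t _
  have hd : deriv (fun u => Q u i) = fun u => V u i :=
    funext fun u => (hasDerivAt_pi.1 (hQ u) i).deriv
  rw [hd]
  exact (hasDerivAt_pi.1 (hV t) i).deriv

/-- Extend `f` from `[0, ∞)` to the line by `f (-t) = B (f t)`. -/
def reflExtend {F : Type*} (B : F → F) (f : ℝ → F) (t : ℝ) : F :=
  if 0 ≤ t then f t else B (f (-t))

theorem reflExtend_of_nonneg {F : Type*} {B : F → F} {f : ℝ → F} {t : ℝ} (ht : 0 ≤ t) :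
    reflExtend B f t = f t := if_pos ht

theorem reflExtend_of_nonpos {F : Type*} {B : F → F} {f : ℝ → F} (h0 : B (f 0) = f 0) {t : ℝ}
    (ht : t ≤ 0) : reflExtend B f t = B (f (-t)) := by
  rcases ht.lt_or_eq with h | rfl
  · exact if_neg h.not_ge
  · rw [reflExtend_of_nonneg le_rfl, neg_zero, h0]

theorem hasDerivAt_reflExtend {F : Type*} [NormedAddCommGroup F] [NormedSpace ℝ F]
    {B B' : F ≃L[ℝ] F} (hB : ∀ x, B' x = -B x) {f f' : ℝ → F}
    (hf : ∀ t ∈ Icc (0 : ℝ) 1, HasDerivAt f (f' t) t)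
    (h0 : B (f 0) = f 0) (h0' : B' (f' 0) = f' 0) :
    ∀ t ∈ Icc (-1 : ℝ) 1, HasDerivAt (reflExtend B f) (reflExtend B' f' t) t := by
  have key : ∀ t ∈ Icc (-1 : ℝ) 0, HasDerivAt (fun s => B (f (-s))) (reflExtend B' f' t) t := by
    intro t ht
    rw [reflExtend_of_nonpos h0' ht.2, hB, ← map_neg]
    have := B.hasFDerivAt.comp_hasDerivAt t
      ((hf (-t) ⟨by linarith [ht.2], by linarith [ht.1]⟩).scomp t (hasDerivAt_neg t))
    simpa [Function.comp_def] using this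
  intro t ht
  rcases lt_trichotomy t 0 with h | rfl | h
  · refine (key t ⟨ht.1, h.le⟩).congr_of_eventuallyEq ?_
    filter_upwards [gt_mem_nhds h] with s hs
    exact reflExtend_of_nonpos h0 (le_of_lt hs)
  · refine hasDerivAt_of_left_right (key 0 (by simp)) (h := f) ?_
      (Filter.Eventually.of_forall fun s hs => reflExtend_of_nonpos h0 hs)
      (Filter.Eventually.of_forall fun s hs => reflExtend_of_nonneg hs)
    rw [reflExtend_of_nonneg le_rfl]
    exact hf 0 (by simp)
  · rw [reflExtend_of_nonneg h.le]
    refine (hf t ⟨h.le, ht.2⟩).congr_of_eventuallyEq ?_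
    filter_upwards [lt_mem_nhds h] with s hs
    exact reflExtend_of_nonneg (le_of_lt hs)

/-- Extension of a Newtonian arc by reflection at both ends. -/
theorem exists_newtonian_extension {θ : ℝ} {q v : ℝ → Fin 4 → ℝ × ℝ}
    (hq : ∀ t ∈ Icc (0 : ℝ) 1, HasDerivAt q (v t) t)
    (hv : ∀ t ∈ Icc (0 : ℝ) 1, HasDerivAt v (force (q t)) t)
    (hne : ∀ t ∈ Icc (0 : ℝ) 1, Function.Injective (q t))
    (q0 : reflPerm 0 permS (q 0) = q 0) (v0 : reflPerm 0 permS (v 0) = -v 0)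
    (q1 : reflPerm (2 * θ) permE (q 1) = q 1) (v1 : reflPerm (2 * θ) permE (v 1) = -v 1) :
    ∃ Q V : ℝ → Fin 4 → ℝ × ℝ, (∀ t, HasDerivAt Q (V t) t) ∧
      (∀ t, HasDerivAt V (force (Q t)) t) ∧ (∀ t, Function.Injective (Q t)) ∧
      (∀ t ∈ Icc (0 : ℝ) 1, Q t = q t) ∧ ∀ t, Q (t + 2) = shiftSymm θ (Q t) := by
  set B := reflPermL 0 permS permS_involutive with hB
  set D := reflPermL (2 * θ) permE permE_involutive with hD
  have hBB : ∀ x, B (B x) = x := reflPerm_reflPerm 0 permS_involutive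
  have hC := shiftSymm_mem_forceSymm θ
  have hCB : ∀ x, shiftSymm θ (B x) = D x := fun x => congrArg D (hBB x)
  set N : (Fin 4 → ℝ × ℝ) ≃L[ℝ] (Fin 4 → ℝ × ℝ) :=
    (ContinuousLinearEquiv.neg ℝ) * B with hN
  have hNB : ∀ x, N x = -B x := fun x => rfl
  have hBN : ∀ x, B x = -N x := fun x => (neg_neg _).symm
  set Q₁ := reflExtend B q with hQ₁
  set V₁ := reflExtend N v with hV₁
  replace q0 : B (q 0) = q 0 := q0
  have hN0 : N (v 0) = v 0 := by rw [hNB]; exact neg_eq_iff_eq_neg.2 v0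
  have hf : ∀ t, reflExtend B (fun s => force (q s)) t = force (Q₁ t) := fun t => by
    rw [hQ₁, reflExtend, reflExtend]
    split_ifs
    · rfl
    · exact (force_reflPerm 0 permS _).symm
  have dQ := hasDerivAt_reflExtend hNB hq q0 hN0
  have dV : ∀ t ∈ Icc (-1 : ℝ) 1, HasDerivAt V₁ (force (Q₁ t)) t := fun t ht => by
    rw [← hf]
    refine hasDerivAt_reflExtend hBN hv hN0 ?_ t ht
    rw [← (reflPermL_mem_forceSymm 0 permS permS_involutive (q 0)).1]
    exact congrArg force q0
  have hinj : ∀ t ∈ Icc (-1 : ℝ) 1, Function.Injective (Q₁ t) := fun t ht => by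
    rw [hQ₁, reflExtend]
    split_ifs with h
    · exact hne t ⟨h, ht.2⟩
    · exact injective_reflPerm_iff.2 (hne (-t) ⟨by linarith, by linarith [ht.1]⟩)
  have hQ1 : Q₁ 1 = q 1 := reflExtend_of_nonneg zero_le_one
  have cQ : shiftSymm θ (Q₁ (-1)) = Q₁ 1 := by
    rw [hQ1, hQ₁, reflExtend_of_nonpos q0 (by norm_num), neg_neg, hCB]
    exact q1
  have cV : shiftSymm θ (V₁ (-1)) = V₁ 1 := by
    rw [hV₁, reflExtend_of_nonpos hN0 (by norm_num), neg_neg, reflExtend_of_nonneg zero_le_one,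
      hNB, map_neg, hCB]
    exact neg_eq_iff_eq_neg.2 v1
  have cF : shiftSymm θ (force (Q₁ (-1))) = force (Q₁ 1) := by
    rw [← (hC _).1, cQ]
  refine ⟨shiftExtend (shiftSymm θ) Q₁, shiftExtend (shiftSymm θ) V₁,
    hasDerivAt_shiftExtend dQ cQ cV, fun t => ?_, injective_shiftExtend hC hinj, fun t ht => ?_,
    shiftExtend_add_two⟩
  · rw [force_shiftExtend hC]
    exact hasDerivAt_shiftExtend dV cV cF t
  · rw [shiftExtend_eq_of_mem_Icc (n := 0) cQ (by push_cast; linarith [ht.1])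
      (by push_cast; linarith [ht.2])]
    simp only [Int.cast_zero, mul_zero, sub_zero, zpow_zero]
    exact reflExtend_of_nonneg ht.1

theorem rotV_two_pi_mul_nat (k : ℕ) (w : ℝ × ℝ) : rotV (k * (2 * π)) w = w := by
  have h : Real.sin (k * (2 * π)) = 0 := by
    simpa [mul_assoc, mul_left_comm] using Real.sin_nat_mul_pi (2 * k)
  rw [rotV, Real.cos_nat_mul_two_pi, h]
  simp

/-- For `0 < θ ≤ 0.0664·π`, an action minimizer over `P(Q_S, Q_{E₂})`
extends to a global, collision-free, `C²` solution of the Newtonian equations with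
rotation symmetry `Qᵢ(t+4) = Qᵢ(t)·R(4θ)`; if `θ = (k/l)·π` the extension is
periodic with period `4l`. -/
theorem statement3 (θ : ℝ) (hθ0 : 0 < θ) (hθ1 : θ ≤ 0.0664 * π)
    (p : H1Path4) (hp : isMin (QE2set θ) p) :
    ∃ Q : ℝ → Fin 4 → ℝ × ℝ,
      ContDiff ℝ 2 Q ∧
      (∀ t : ℝ, ∀ i j : Fin 4, i ≠ j → Q t i ≠ Q t j) ∧
      newton Q Set.univ ∧
      (∀ t ∈ Icc (0:ℝ) 1, Q t = p.q t) ∧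
      (∀ t : ℝ, ∀ i : Fin 4, Q (t + 4) i = rotV (4 * θ) (Q t i)) ∧
      (∀ k l : ℕ, 0 < k → 0 < l → θ = (k : ℝ) / l * π →
        ∀ t : ℝ, Q (t + 4 * l) = Q t) := by
  obtain ⟨hfin, hne⟩ := H1Path4.action_ne_top_and_collisionFree hθ0 hθ1 hp
  obtain ⟨q, v, hqp, hq, hv, q0, v0, q1, v1⟩ := H1Path4.exists_newtonian_arc hp hfin hne
  obtain ⟨Q, V, hQ, hV, hinj, hQq, hshift⟩ := exists_newtonian_extension (fun t _ => hq t) hv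
    (fun t ht i j => by
      contrapose
      rw [hqp t ht]
      exact hne t ht i j) q0 v0 q1 v1
  have hrot : ∀ t : ℝ, ∀ i : Fin 4, Q (t + 4) i = rotV (4 * θ) (Q t i) := fun t i => by
    rw [show t + 4 = t + 2 + 2 by ring, hshift, hshift, shiftSymm_shiftSymm]
  refine ⟨Q, contDiff_two_of_force hQ hV hinj, fun t i j hij => (hinj t).ne hij,
    newton_of_force hQ hV, fun t ht => (hQq t ht).trans (hqp t ht), hrot, ?_⟩
  intro k l _ hl hkl t
  have hiter : ∀ n : ℕ, ∀ i : Fin 4, Q (t + 4 * n) i = rotV (n * (4 * θ)) (Q t i) := by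
    intro n i
    induction n with
    | zero => simp [rotV_zero]
    | succ n ih =>
      rw [show t + 4 * ((n + 1 : ℕ) : ℝ) = t + 4 * n + 4 by push_cast; ring, hrot, ih, rotV_rotV]
      congr 1
      push_cast
      ring
  funext i
  have hl' : (l : ℝ) ≠ 0 := by positivity
  rw [hiter l i, show (l : ℝ) * (4 * θ) = ((2 * k : ℕ) : ℝ) * (2 * π) by
    rw [hkl]; push_cast; field_simp; ring, rotV_two_pi_mul_nat]

end
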